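/- Let q be a prime power and let f(x) = Σ_{j=0}^{k} a_j x^{q^j} ∈ F_{q^n}[x] be a monic F_q-linearized polynomial of q-degree k < n which is not a monomial, with a_t = 0 for the index t, and such that either t = 0 and a_0 = 0, or t ≥ 1, a_0 ≠ 0 and one of: (i) t = 1 and k ≥ 3; (ii) t ≥ 2, with k ≥ 3t if t | k and k ≥ 2t−1 if t ∤ k, and either f(x) = a_0 x + a_1 x^q + Σ_{j>t} a_j x^{q^j} with k ≥ t+2, or f(x) = a_0 x + Σ_{j>t} a_j x^{q^j}. Suppose f is r-fat of index t with maximum weight W ≥ 2. Then r ≥ (q^n − c_1·√(q^n) − c_2) / (q^{2W} − q^{W+1} − q^W + q), where c_1 = (q^k + q^t − q − 2)(q^k + q^t − q − 3) and c_2 = 2q^{k−v} + q^k − q^{h+1} + q^h − 1 if t = 0 (with v = min{ j : a_j ≠ 0 } and h = dim_{F_q} ker(f)), while c_2 = q^k + q^t − q − 1 if t > 0. -/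

import Mathlib

open IsDedekindDomain WithZero
set_option hygiene false in
notation:max "KX" => Polynomial K
set_option hygiene false in
notation:max "KXX" => Polynomial (Polynomial K)
set_option hygiene false in
notation:max "aR" => algebraMap (Polynomial K) R
set_option hygiene false in
notation:max "aL" => algebraMap (Polynomial K) L
set_option hygiene false in
notation:max "aF" => algebraMap (Polynomial K) F
set_option hygiene false in
notation:max "BdF" => Module.Basis (Fin d) L F
set_option hygiene false in
notation:max "NZP" => Nat.card {z : K × K // (P.map (Polynomial.evalRingHom z.1)).eval z.2 = 0}
set_option hygiene false in
notation:max "GHw" => GH Q d vi P y b O O' d₁ d₂ w'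
set_option hygiene false in
notation:max "NAD" => Nat.card {z : K × K // AA q k t a z.1 z.2 = 0 ∧ DD q z.1 z.2 ≠ 0}
set_option hygiene false in
notation:max "LPz" => LP q k a z.1.1 / z.1.1 ^ q ^ t
set_option hygiene false in
notation:max "c1n" => (c.out.1 + Finsupp.single P1 (n : ℤ) : ι →₀ ℤ)
set_option hygiene false in
notation:max "qr" => (q : ℝ)
set_option hygiene false in
notation:max "Qr" => (Q : ℝ)
set_option hygiene false in
notation:max "cOP" => Nat.card (O ⧸ P.asIdeal)
set_option hygiene false in
notation:max "sdd" => Sum.elim d₁ d₂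
set_option hygiene false in
notation:max "Vz" => H.V k t a m
set_option hygiene false in
notation:max "QK" => QF p e q n K
set_option hygiene false in
notation:max "cK" => Nat.card K
set_option hygiene false in
notation:max "AHb" => AH b y P
set_option hygiene false in
notation:max "VF" => Valuation F ℤᵐ⁰
set_option hygiene false in
notation:max "VL" => Valuation L ℤᵐ⁰
notation:max "HOS" => HeightOneSpectrum
set_option hygiene false in
notation:max "PK" => PowerSeries K
def Mlat {F ι : Type*} [Field F] (v : ι → VF) (D : ι → ℤ) : AddSubgroup F where
  carrier := {f | ∀ P, v P f ≤ exp (D P)}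
  zero_mem' := by intro P; simp
  add_mem' := by
    intro a b ha hb P
    exact (Valuation.map_add _ _ _).trans (max_le (ha P) (hb P))
  neg_mem' := by intro a ha P; simpa using ha P
theorem mem_Mlat {F ι : Type*} [Field F] {v : ι → VF} {D : ι → ℤ} {f : F} :
    f ∈ Mlat v D ↔ ∀ P, v P f ≤ exp (D P) := Iff.rfl
theorem Mlat_mono {F ι : Type*} [Field F] {v : ι → VF} {D D' : ι → ℤ} (h : D ≤ D') :
    Mlat v D ≤ Mlat v D' := fun _ hf P => (hf P).trans (exp_le_exp.2 (h P))
section chart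
variable {B F : Type*} [CommRing B] [IsDedekindDomain B] [Field F] [Algebra B F] [IsFractionRing B F]
noncomputable def dval (B F : Type*) [CommRing B] [IsDedekindDomain B] [Field F] [Algebra B F]
    [IsFractionRing B F] : HOS B → VF :=
  fun P => P.valuation F
theorem exists_rho (P : HOS B) :
    ∃ ρ : F, dval B F P ρ = exp 1 ∧ ∀ P', P' ≠ P → dval B F P' ρ ≤ 1 := by
  obtain ⟨ρ, h1, h2⟩ := FractionalIdeal.exists_notMem_one_of_ne_bot (K := F) P.ne_bot
    P.isPrime.ne_top
  have hmul : ∀ x ∈ P.asIdeal, ∃ b : B, algebraMap B F b = ρ * algebraMap B F x := by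
    intro x hx
    rw [FractionalIdeal.mem_inv_iff (by simpa using P.ne_bot)] at h1
    have := h1 (algebraMap B F x) (FractionalIdeal.mem_coeIdeal_of_mem _ hx)
    rw [FractionalIdeal.mem_one_iff] at this
    exact this
  have hoff : ∀ P', P' ≠ P → dval B F P' ρ ≤ 1 := by
    intro P' hne
    have : ¬ P.asIdeal ≤ P'.asIdeal := by
      intro hle
      apply hne
      have := (Ring.DimensionLEOne.maximalOfPrime P.ne_bot P.isPrime).eq_of_le P'.isPrime.ne_top hle
      exact HeightOneSpectrum.ext this.symm
    obtain ⟨x, hx, hx'⟩ := Set.not_subset.1 this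
    obtain ⟨b, hb⟩ := hmul x hx
    have hx1 : P'.valuation F (algebraMap B F x) = 1 := by
      refine le_antisymm (P'.valuation_le_one x) (not_lt.1 fun h => hx' ?_)
      exact (P'.valuation_lt_one_iff_mem x).1 h
    have : P'.valuation F (algebraMap B F b) ≤ 1 := P'.valuation_le_one b
    rw [hb, map_mul, hx1, mul_one] at this
    exact this
  refine ⟨ρ, le_antisymm ?_ ?_, hoff⟩
  · obtain ⟨π, hπ⟩ := P.intValuation_exists_uniformizer
    have hπ' : P.valuation F (algebraMap B F π) = exp (-1) := by
      rw [HeightOneSpectrum.valuation_of_algebraMap, hπ]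
    have hmem : π ∈ P.asIdeal := by
      rw [← HeightOneSpectrum.valuation_lt_one_iff_mem (K := F)]
      have h0 : exp (-1:ℤ) < (1:ℤᵐ⁰) := by rw [← exp_zero, exp_lt_exp]; norm_num
      exact hπ'.trans_lt h0
    obtain ⟨b, hb⟩ := hmul π hmem
    have : P.valuation F (algebraMap B F b) ≤ 1 := P.valuation_le_one b
    rw [hb, map_mul, hπ', exp_neg] at this
    exact (mul_inv_le_iff₀ exp_pos).1 this |>.trans_eq (one_mul _)
  · by_contra hlt
    apply h2
    rw [FractionalIdeal.mem_one_iff]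
    have h0 : P.valuation F ρ ≤ 1 := by
      have := not_le.1 hlt
      have h3 : exp (1:ℤ) = (1:ℤᵐ⁰) * exp 1 := by simp
      rw [h3] at this
      exact (lt_mul_exp_iff_le one_ne_zero).1 this
    obtain ⟨b, hb⟩ := HeightOneSpectrum.mem_integers_of_valuation_le_one (R := B) F ρ (by
      intro P'
      by_cases h : P' = P
      · subst h; exact h0
      · exact hoff P' h)
    exact ⟨b, hb⟩
theorem exists_small (D : HOS B →₀ ℤ) :
    ∃ c : F, c ≠ 0 ∧ ∀ P, dval B F P c ≤ exp (D P) := by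
  induction D using Finsupp.induction_linear with
  | zero => exact ⟨1, one_ne_zero, fun P => by simp⟩
  | add f g hf hg =>
    obtain ⟨c, hc, h⟩ := hf
    obtain ⟨c', hc', h'⟩ := hg
    refine ⟨c * c', mul_ne_zero hc hc', fun P => ?_⟩
    rw [map_mul, Finsupp.add_apply, exp_add]
    exact mul_le_mul' (h P) (h' P)
  | single P n =>
    obtain ⟨π, hπ⟩ := P.intValuation_exists_uniformizer
    have hπ' : P.valuation F (algebraMap B F π) = exp (-1) := by
      rw [HeightOneSpectrum.valuation_of_algebraMap, hπ]
    have hπ0 : algebraMap B F π ≠ 0 := by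
      intro h; rw [h, map_zero] at hπ'; exact exp_ne_zero hπ'.symm
    refine ⟨(algebraMap B F π) ^ n.natAbs, pow_ne_zero _ hπ0, fun P' => ?_⟩
    rw [map_pow]
    classical
    by_cases h : P = P'
    · subst h
      rw [Finsupp.single_eq_same]
      change (P.valuation F (algebraMap B F π)) ^ _ ≤ _
      rw [hπ', ← exp_nsmul, exp_le_exp]
      rw [nsmul_eq_mul, Int.natCast_natAbs]; have := neg_abs_le n; omega
    · rw [Finsupp.single_eq_of_ne (Ne.symm h), exp_zero]
      exact pow_le_one' (P'.valuation_le_one π) _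
theorem exists_adj (D : HOS B →₀ ℤ) (P : HOS B) :
    ∃ c : F, dval B F P c = exp (D P + 1) ∧ ∀ P', P' ≠ P → dval B F P' c ≤ exp (D P') := by
  obtain ⟨c, hc, h⟩ := exists_small (F := F) D
  obtain ⟨ρ, h1, h2⟩ := exists_rho (F := F) P
  have hv : dval B F P c ≠ 0 := (Valuation.ne_zero_iff _).2 hc
  have hle : log (dval B F P c) ≤ D P := (log_le_iff_le_exp hv).2 (h P)
  refine ⟨c * ρ ^ (D P + 1 - log (dval B F P c)).toNat, ?_, ?_⟩
  · rw [map_mul, map_pow, h1, ← exp_nsmul]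
    nth_rewrite 1 [← exp_log hv]
    rw [← exp_add]
    congr 1
    simp
    omega
  · intro P' hne
    rw [map_mul, map_pow]
    calc _ ≤ exp (D P') * 1 := mul_le_mul' (h P') (pow_le_one' (h2 P' hne) _)
      _ = _ := by simp
theorem lat_step (D : HOS B →₀ ℤ) (P : HOS B) :
    (Mlat (dval B F) D).relIndex (Mlat (dval B F) (D + Finsupp.single P 1 : _ →₀ ℤ)) =
      Nat.card (B ⧸ P.asIdeal) := by
  classical
  obtain ⟨c, h1, h2⟩ := exists_adj (F := F) D P
  have hc : c ≠ 0 := by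
    rintro rfl; rw [map_zero] at h1; exact exp_ne_zero h1.symm
  let g : B →+ F := (AddMonoidHom.mulRight c).comp (algebraMap B F).toAddMonoidHom
  have hg : ∀ b, g b = algebraMap B F b * c := fun b => rfl
  have hle1 : ∀ (P' : HOS B) b, dval B F P' (algebraMap B F b) ≤ 1 :=
    fun P' b => P'.valuation_le_one b
  have hcomap : (Mlat (dval B F) D).comap g = P.asIdeal.toAddSubgroup := by
    ext b
    rw [AddSubgroup.mem_comap, mem_Mlat]
    change _ ↔ b ∈ P.asIdeal
    rw [← HeightOneSpectrum.valuation_lt_one_iff_mem (K := F)]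
    change _ ↔ dval B F P (algebraMap B F b) < 1
    have key : dval B F P (g b) ≤ exp (D P) ↔ dval B F P (algebraMap B F b) < 1 := by
      rw [hg, map_mul, h1, ← lt_mul_exp_iff_le exp_ne_zero, ← exp_add]
      exact mul_lt_iff_lt_one_left exp_pos
    rw [← key]
    refine ⟨fun h => h P, fun h P' => ?_⟩
    by_cases hP : P' = P
    · subst hP; exact h
    · rw [hg, map_mul]
      calc _ ≤ 1 * exp (D P') := mul_le_mul' (hle1 P' b) (h2 P' hP)
        _ = _ := one_mul _
  have hsup : g.range ⊔ Mlat (dval B F) D = Mlat (dval B F) (D + Finsupp.single P 1 : _ →₀ ℤ) := by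
    apply le_antisymm
    · refine sup_le ?_ (Mlat_mono fun P' => ?_)
      · rintro _ ⟨b, rfl⟩ P'
        rw [hg, map_mul]
        by_cases hP : P' = P
        · subst hP
          rw [h1]
          calc _ ≤ 1 * exp (D P' + 1) := mul_le_mul' (hle1 P' b) le_rfl
            _ = _ := by simp
        · calc _ ≤ 1 * exp (D P') := mul_le_mul' (hle1 P' b) (h2 P' hP)
            _ = _ := by simp [Finsupp.single_eq_of_ne hP]
      · rw [Finsupp.add_apply]
        by_cases hP : P' = P
        · subst hP; simp
        · simp [Finsupp.single_eq_of_ne hP]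
    · intro f hf
      have hfP : dval B F P (f / c) ≤ 1 := by
        rw [map_div₀, h1, div_le_one₀ exp_pos]
        have := hf P
        simpa using this
      obtain ⟨b, hb⟩ := HeightOneSpectrum.exists_valuation_sub_lt_of_integer P hfP 1
      have hb' : dval B F P (f / c - algebraMap B F b) < 1 := by
        rw [Valuation.map_sub_swap]; exact hb
      rw [AddSubgroup.mem_sup]
      refine ⟨g b, ⟨b, rfl⟩, f - g b, fun P' => ?_, by abel⟩
      by_cases hP : P' = P
      · subst hP
        have : f - g b = (f / c - algebraMap B F b) * c := by rw [hg]; field_simp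
        rw [this, map_mul, h1, ← lt_mul_exp_iff_le exp_ne_zero, ← exp_add]
        exact (mul_lt_iff_lt_one_left exp_pos).2 hb'
      · refine (Valuation.map_sub _ _ _).trans (max_le ?_ ?_)
        · simpa [Finsupp.single_eq_of_ne hP] using hf P'
        · rw [hg, map_mul]
          calc _ ≤ 1 * exp (D P') := mul_le_mul' (hle1 P' b) (h2 P' hP)
            _ = _ := one_mul _
  rw [← hsup, AddSubgroup.relIndex_sup_right, ← AddSubgroup.index_comap, hcomap]
  rfl
def dgr {ι : Type*} (dg : ι → ℕ) (D : ι →₀ ℤ) : ℤ := D.sum fun P n => n * dg P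
theorem dgr_add {ι : Type*} (dg : ι → ℕ) (D D' : ι →₀ ℤ) :
    dgr dg (D + D') = dgr dg D + dgr dg D' := by
  classical
  unfold dgr
  rw [Finsupp.sum_add_index'] <;> intros <;> ring
theorem dgr_single {ι : Type*} (dg : ι → ℕ) (P : ι) (n : ℤ) :
    dgr dg (Finsupp.single P n) = n * dg P := by
  unfold dgr
  rw [Finsupp.sum_single_index]; ring
theorem dgr_zero {ι : Type*} (dg : ι → ℕ) : dgr dg 0 = 0 := by simp [dgr]
theorem dgr_neg {ι : Type*} (dg : ι → ℕ) (D : ι →₀ ℤ) : dgr dg (-D) = - dgr dg D := by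
  have := dgr_add dg D (-D)
  rw [add_neg_cancel, dgr_zero] at this
  linarith
theorem dgr_sub {ι : Type*} (dg : ι → ℕ) (D D' : ι →₀ ℤ) :
    dgr dg (D - D') = dgr dg D - dgr dg D' := by
  rw [sub_eq_add_neg, dgr_add, dgr_neg]; ring
theorem dgr_nonneg {ι : Type*} (dg : ι → ℕ) {D : ι →₀ ℤ} (h : 0 ≤ D) : 0 ≤ dgr dg D := by
  unfold dgr
  exact Finset.sum_nonneg fun P _ => mul_nonneg (h P) (by positivity)
theorem dgr_mono {ι : Type*} (dg : ι → ℕ) {D D' : ι →₀ ℤ} (h : D ≤ D') :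
    dgr dg D ≤ dgr dg D' := by
  have := dgr_nonneg dg (sub_nonneg.2 h)
  rw [dgr_sub] at this; linarith
theorem eff_induction {ι : Type*} {motive : (ι →₀ ℤ) → Prop} (h0 : motive 0)
    (hs : ∀ D P, 0 ≤ D → motive D → motive (D + Finsupp.single P 1)) (D : ι →₀ ℤ) (hD : 0 ≤ D) :
    motive D := by
  classical
  have key : ∀ n : ℕ, ∀ D : ι →₀ ℤ, 0 ≤ D → dgr (fun _ => 1) D = n → motive D := by
    intro n
    induction n with
    | zero =>
      intro D hD h
      have : D = 0 := by
        ext P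
        by_contra hne
        have hP : 1 ≤ D P := by
          have h1 := hD P
          simp at h1 hne
          omega
        have hle : Finsupp.single P 1 ≤ D := by
          intro P'
          by_cases h : P' = P
          · subst h; simpa using hP
          · rw [Finsupp.single_eq_of_ne h]; exact hD P'
        have := dgr_mono (fun _ => 1) hle
        rw [dgr_single, h] at this
        simp at this
      rw [this]; exact h0
    | succ n ih =>
      intro D hD h
      have : ∃ P, 1 ≤ D P := by
        by_contra hcon
        push Not at hcon
        have : D = 0 := by
          ext P
          have h1 := hD P
          have h2 := hcon P
          simp at h1 ⊢
          omega
        rw [this, dgr_zero] at h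
        push_cast at h; omega
      obtain ⟨P, hP⟩ := this
      have hle : Finsupp.single P 1 ≤ D := by
        intro P'
        by_cases h : P' = P
        · subst h; simpa using hP
        · rw [Finsupp.single_eq_of_ne h]; exact hD P'
      have hd := ih (D - Finsupp.single P 1) (sub_nonneg.2 hle) (by
        rw [dgr_sub, dgr_single, h]; push_cast; ring)
      have := hs _ P (sub_nonneg.2 hle) hd
      rwa [sub_add_cancel] at this
  exact key (dgr (fun _ => 1) D).toNat D hD (by
    rw [Int.toNat_of_nonneg (dgr_nonneg _ hD)])
theorem lat_index {Q : ℕ} {dg : HOS B → ℕ}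
    (hdg : ∀ P : HOS B, Nat.card (B ⧸ P.asIdeal) = Q ^ dg P)
    (D D' : HOS B →₀ ℤ) (h : D ≤ D') :
    (Mlat (dval B F) D).relIndex (Mlat (dval B F) D') = Q ^ (dgr dg D' - dgr dg D).toNat := by
  have key : ∀ E : HOS B →₀ ℤ, 0 ≤ E →
      (Mlat (dval B F) D).relIndex (Mlat (dval B F) (D + E : _ →₀ ℤ)) = Q ^ (dgr dg E).toNat := by
    intro E hE
    refine eff_induction (motive := fun E => (Mlat (dval B F) D).relIndex
      (Mlat (dval B F) (D + E : _ →₀ ℤ)) = Q ^ (dgr dg E).toNat) ?_ ?_ E hE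
    · simp [dgr_zero]
    · intro E P hE ih
      rw [← AddSubgroup.relIndex_mul_relIndex _ (Mlat (dval B F) (D + E : _ →₀ ℤ)) _
        (Mlat_mono ?_) (Mlat_mono ?_), ih, ← add_assoc, lat_step, hdg, ← pow_add, dgr_add, dgr_single]
      · congr 1
        have := dgr_nonneg dg hE
        omega
      · exact le_add_of_nonneg_right (a := D) hE
      · have : (0 : HOS B →₀ ℤ) ≤ Finsupp.single P 1 := by
          classical
          intro P'; rw [Finsupp.single_apply]; split_ifs <;> simp
        exact (add_le_add_iff_left D).2 (le_add_of_nonneg_right (a := E) this)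
  have := key (D' - D) (sub_nonneg.2 h)
  rw [add_sub_cancel, dgr_sub] at this
  exact this
end chart
noncomputable def dv {F ι : Type*} [Field F] (v : ι → VF) (u : F) : ι →₀ ℤ :=
  open Classical in
  if h : (Function.support fun P => log (v P u)).Finite then Finsupp.ofSupportFinite _ h else 0
def FinSup {F ι : Type*} [Field F] (v : ι → VF) : Prop :=
  ∀ u : F, u ≠ 0 → {P | v P u ≠ 1}.Finite
theorem dv_apply {F ι : Type*} [Field F] {v : ι → VF} (hv : FinSup v) {u : F}
    (hu : u ≠ 0) (P : ι) : dv v u P = log (v P u) := by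
  have h : (Function.support fun P => log (v P u)).Finite := by
    refine (hv u hu).subset ?_
    intro P hP h1
    apply hP
    simp only [h1, log_one]
  unfold dv
  rw [dif_pos h]; rfl
theorem exp_dv {F ι : Type*} [Field F] {v : ι → VF} (hv : FinSup v) {u : F}
    (hu : u ≠ 0) (P : ι) : exp (dv v u P) = v P u := by
  rw [dv_apply hv hu, exp_log ((Valuation.ne_zero_iff _).2 hu)]
theorem dv_mul {F ι : Type*} [Field F] {v : ι → VF} (hv : FinSup v) {u w : F}
    (hu : u ≠ 0) (hw : w ≠ 0) : dv v (u * w) = dv v u + dv v w := by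
  ext P
  apply exp_injective
  rw [exp_dv hv (mul_ne_zero hu hw), Finsupp.add_apply, exp_add, exp_dv hv hu, exp_dv hv hw, map_mul]
theorem dv_one {F ι : Type*} [Field F] {v : ι → VF} (hv : FinSup v) :
    dv v (1 : F) = 0 := by
  ext P
  rw [dv_apply hv one_ne_zero]; simp
theorem dv_inv {F ι : Type*} [Field F] {v : ι → VF} (hv : FinSup v) {u : F}
    (hu : u ≠ 0) : dv v u⁻¹ = - dv v u := by
  have := dv_mul hv hu (inv_ne_zero hu)
  rw [mul_inv_cancel₀ hu, dv_one hv] at this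
  exact (neg_eq_of_add_eq_zero_right this.symm).symm
theorem mul_mem_Mlat {F ι : Type*} [Field F] {v : ι → VF} (hv : FinSup v) {u : F}
    (hu : u ≠ 0) (D : ι →₀ ℤ) (f : F) : u * f ∈ Mlat v (D + dv v u : ι →₀ ℤ) ↔ f ∈ Mlat v D := by
  rw [mem_Mlat, mem_Mlat]
  refine forall_congr' fun P => ?_
  rw [map_mul, Finsupp.add_apply, exp_add, exp_dv hv hu, mul_comm]
  have : 0 < v P u := (Valuation.pos_iff _).2 hu
  exact mul_le_mul_iff_left₀ this
theorem card_Mlat_mul {F ι : Type*} [Field F] {v : ι → VF} (hv : FinSup v) {u : F}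
    (hu : u ≠ 0) (D : ι →₀ ℤ) : Nat.card (Mlat v (D + dv v u : ι →₀ ℤ)) = Nat.card (Mlat v D) := by
  refine Nat.card_congr (Equiv.symm ?_)
  exact (Equiv.mulLeft₀ u hu).subtypeEquiv fun f => (mul_mem_Mlat hv hu D f).symm
theorem mem_Mlat_dv {F ι : Type*} [Field F] {v : ι → VF} (hv : FinSup v) {u : F}
    (hu : u ≠ 0) (D : ι →₀ ℤ) : u ∈ Mlat v D ↔ dv v u ≤ D := by
  rw [mem_Mlat]
  refine forall_congr' fun P => ?_
  rw [← exp_dv hv hu, exp_le_exp]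
theorem finSup_dval (B F : Type*) [CommRing B] [IsDedekindDomain B] [Field F] [Algebra B F]
    [IsFractionRing B F] : FinSup (dval B F) := by
  intro u hu
  refine ((HeightOneSpectrum.Support.finite B u).union
    (HeightOneSpectrum.Support.finite B u⁻¹)).subset ?_
  intro P hP
  rcases lt_or_gt_of_ne hP with h | h
  · right
    change 1 < P.valuation F u⁻¹
    rw [map_inv₀]
    exact (one_lt_inv₀ ((Valuation.pos_iff _).2 hu)).2 h
  · left; exact h
theorem relIndex_alpha {G : Type*} [AddCommGroup G] (I I' J : AddSubgroup G) (h : I ≤ I')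
    (hJ : I ⊔ J = ⊤) : (I ⊓ J).relIndex (I' ⊓ J) = I.relIndex I' := by
  have h1 : I' = (I' ⊓ J) ⊔ I := by
    apply le_antisymm
    · intro x hx
      have : x ∈ I ⊔ J := by rw [hJ]; trivial
      obtain ⟨a, ha, b, hb, rfl⟩ := AddSubgroup.mem_sup.1 this
      refine AddSubgroup.mem_sup.2 ⟨b, ⟨?_, hb⟩, a, ha, add_comm _ _⟩
      have := I'.sub_mem hx (h ha)
      simpa using this
    · exact sup_le inf_le_left h
  have h2 : I ⊓ J = I ⊓ (I' ⊓ J) := by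
    rw [← inf_assoc, inf_eq_left.2 h]
  conv_rhs => rw [h1, AddSubgroup.relIndex_sup_right]
  rw [h2, AddSubgroup.inf_relIndex_right]
section two
variable {B₁ B₂ F : Type*} [CommRing B₁] [IsDedekindDomain B₁] [Field F] [Algebra B₁ F]
  [IsFractionRing B₁ F] [CommRing B₂] [IsDedekindDomain B₂] [Algebra B₂ F] [IsFractionRing B₂ F]
noncomputable def tval (B₁ B₂ F : Type*) [CommRing B₁] [IsDedekindDomain B₁] [Field F] [Algebra B₁ F]
  [IsFractionRing B₁ F] [CommRing B₂] [IsDedekindDomain B₂] [Algebra B₂ F] [IsFractionRing B₂ F] :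
  HOS B₁ ⊕ HOS B₂ → VF :=
  Sum.elim (dval B₁ F) (dval B₂ F)
theorem finSup_tval : FinSup (tval B₁ B₂ F) := by
  intro u hu
  refine (((finSup_dval B₁ F u hu).image Sum.inl).union
    ((finSup_dval B₂ F u hu).image Sum.inr)).subset ?_
  rintro (P | P) hP
  · left; exact ⟨P, hP, rfl⟩
  · right; exact ⟨P, hP, rfl⟩
noncomputable def dl {α β : Type*} (D : α ⊕ β →₀ ℤ) : α →₀ ℤ :=
  D.comapDomain Sum.inl Sum.inl_injective.injOn
noncomputable def drt {α β : Type*} (D : α ⊕ β →₀ ℤ) : β →₀ ℤ :=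
  D.comapDomain Sum.inr Sum.inr_injective.injOn
theorem dl_apply {α β : Type*} (D : α ⊕ β →₀ ℤ) (a : α) : dl D a = D (Sum.inl a) := rfl
theorem drt_apply {α β : Type*} (D : α ⊕ β →₀ ℤ) (a : β) : drt D a = D (Sum.inr a) := rfl
theorem dgr_split {α β : Type*} (d₁ : α → ℕ) (d₂ : β → ℕ) (D : α ⊕ β →₀ ℤ) :
    dgr sdd D = dgr d₁ (dl D) + dgr d₂ (drt D) := by
  induction D using Finsupp.induction_linear with
  | zero =>
    have h1 : dl (0 : α ⊕ β →₀ ℤ) = 0 := by ext; rfl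
    have h2 : drt (0 : α ⊕ β →₀ ℤ) = 0 := by ext; rfl
    simp [dgr_zero, h1, h2]
  | add f g hf hg =>
    have h1 : dl (f + g) = dl f + dl g := by ext; rfl
    have h2 : drt (f + g) = drt f + drt g := by ext; rfl
    rw [dgr_add, hf, hg, h1, h2, dgr_add, dgr_add]; ring
  | single P n =>
    classical
    rcases P with P | P
    · have h1 : dl (Finsupp.single (Sum.inl P : α ⊕ β) n) = Finsupp.single P n := by
        ext a; simp [dl_apply, Finsupp.single_apply]
      have h2 : drt (Finsupp.single (Sum.inl P : α ⊕ β) n) = 0 := by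
        ext a; simp [drt_apply]
      rw [h1, h2, dgr_single, dgr_single, dgr_zero]; simp
    · have h1 : drt (Finsupp.single (Sum.inr P : α ⊕ β) n) = Finsupp.single P n := by
        ext a; simp [drt_apply, Finsupp.single_apply]
      have h2 : dl (Finsupp.single (Sum.inr P : α ⊕ β) n) = 0 := by
        ext a; simp [dl_apply]
      rw [h1, h2, dgr_single, dgr_single, dgr_zero]; simp
def Van (B₁ B₂ F : Type*) [CommRing B₁] [IsDedekindDomain B₁] [Field F] [Algebra B₁ F]
  [IsFractionRing B₁ F] [CommRing B₂] [IsDedekindDomain B₂] [Algebra B₂ F] [IsFractionRing B₂ F]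
  (D : HOS B₁ ⊕ HOS B₂ →₀ ℤ) : Prop :=
  Mlat (dval B₁ F) (dl D) ⊔ Mlat (dval B₂ F) (drt D) = ⊤
theorem Mlat_tval (D : HOS B₁ ⊕ HOS B₂ →₀ ℤ) :
    Mlat (tval B₁ B₂ F) D = Mlat (dval B₁ F) (dl D) ⊓ Mlat (dval B₂ F) (drt D) := by
  ext f
  rw [AddSubgroup.mem_inf, mem_Mlat, mem_Mlat, mem_Mlat, Sum.forall]
  rfl
theorem Van_mono {D D' : HOS B₁ ⊕ HOS B₂ →₀ ℤ} (h : D ≤ D')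
    (hD : Van B₁ B₂ F D) : Van B₁ B₂ F D' := by
  unfold Van at *
  rw [eq_top_iff, ← hD]
  exact sup_le_sup (Mlat_mono fun P => h _) (Mlat_mono fun P => h _)
variable {Q : ℕ} {d₁ : HOS B₁ → ℕ} {d₂ : HOS B₂ → ℕ}
theorem van_card (hd₁ : ∀ P : HOS B₁, Nat.card (B₁ ⧸ P.asIdeal) = Q ^ d₁ P)
    (hd₂ : ∀ P : HOS B₂, Nat.card (B₂ ⧸ P.asIdeal) = Q ^ d₂ P)
    {D D' : HOS B₁ ⊕ HOS B₂ →₀ ℤ} (h : D ≤ D')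
    (hD : Van B₁ B₂ F D) :
    Nat.card (Mlat (tval B₁ B₂ F) D') = Nat.card (Mlat (tval B₁ B₂ F) D) *
      Q ^ (dgr sdd D' - dgr sdd D).toNat := by
  have hl : dl D ≤ dl D' := fun P => h _
  have hr : drt D ≤ drt D' := fun P => h _
  have hidx : (Mlat (tval B₁ B₂ F) D).relIndex (Mlat (tval B₁ B₂ F) D') =
      Q ^ (dgr sdd D' - dgr sdd D).toNat := by
    rw [Mlat_tval, Mlat_tval]
    have e1 := relIndex_alpha _ _ (Mlat (dval B₂ F) (drt D)) (Mlat_mono (v := dval B₁ F) hl) hD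
    have hD2 : Mlat (dval B₂ F) (drt D) ⊔ Mlat (dval B₁ F) (dl D') = ⊤ := by
      rw [eq_top_iff, ← hD, sup_comm]
      exact sup_le_sup le_rfl (Mlat_mono hl)
    have e2 := relIndex_alpha _ _ _ (Mlat_mono (v := dval B₂ F) hr) hD2
    rw [lat_index hd₁ _ _ hl] at e1
    rw [lat_index hd₂ _ _ hr, inf_comm, inf_comm (Mlat (dval B₂ F) (drt D'))] at e2
    rw [← AddSubgroup.relIndex_mul_relIndex _ _ _ (inf_le_inf_right _ (Mlat_mono hl))
      (inf_le_inf_left _ (Mlat_mono hr)), e1, e2, ← pow_add, dgr_split, dgr_split]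
    congr 1
    have := dgr_mono d₁ hl
    have := dgr_mono d₂ hr
    omega
  rw [← hidx, ← AddSubgroup.relIndex_bot_left, ← AddSubgroup.relIndex_bot_left,
    AddSubgroup.relIndex_mul_relIndex _ _ _ bot_le (Mlat_mono h)]
theorem finite_Mlat (hQ : 0 < Q)
    (hd₁ : ∀ P : HOS B₁, Nat.card (B₁ ⧸ P.asIdeal) = Q ^ d₁ P)
    (hd₂ : ∀ P : HOS B₂, Nat.card (B₂ ⧸ P.asIdeal) = Q ^ d₂ P)
    (h0 : Finite (Mlat (tval B₁ B₂ F) (0 : _ →₀ ℤ)))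
    (D : HOS B₁ ⊕ HOS B₂ →₀ ℤ) :
    Finite (Mlat (tval B₁ B₂ F) D) := by
  have key : Finite (Mlat (tval B₁ B₂ F) (D ⊔ 0 : _ →₀ ℤ)) := by
    apply Nat.finite_of_card_ne_zero
    rw [← AddSubgroup.relIndex_bot_left,
      ← AddSubgroup.relIndex_mul_relIndex _ (Mlat (tval B₁ B₂ F) (0 : _ →₀ ℤ)) _ bot_le
        (Mlat_mono (le_sup_right (a := D)))]
    refine mul_ne_zero ?_ ?_
    · rw [AddSubgroup.relIndex_bot_left]; exact Nat.card_pos.ne'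
    · rw [Mlat_tval, Mlat_tval]
      have hl : dl (0 : HOS B₁ ⊕ HOS B₂ →₀ ℤ) ≤ dl (D ⊔ 0) :=
        fun P => le_sup_right (a := D) (Sum.inl P)
      have hr : drt (0 : HOS B₁ ⊕ HOS B₂ →₀ ℤ) ≤ drt (D ⊔ 0) :=
        fun P => le_sup_right (a := D) (Sum.inr P)
      rw [← AddSubgroup.relIndex_mul_relIndex _ _ _ (inf_le_inf_right _ (Mlat_mono hl))
        (inf_le_inf_left _ (Mlat_mono hr))]
      have gen : ∀ I I' J : AddSubgroup F, I.relIndex I' ≠ 0 → (I ⊓ J).relIndex (I' ⊓ J) ≠ 0 := by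
        intro I I' J h
        have h1 : I.relIndex (I' ⊓ J) ≠ 0 := AddSubgroup.relIndex_ne_zero_trans
          (K := I') h (by simp [AddSubgroup.relIndex_eq_one.2 (inf_le_left : I' ⊓ J ≤ I')])
        have h2 : J.relIndex (I' ⊓ J) ≠ 0 := by
          rw [AddSubgroup.relIndex_eq_one.2 inf_le_right]; exact one_ne_zero
        exact AddSubgroup.relIndex_inf_ne_zero h1 h2
      refine mul_ne_zero (gen _ _ _ ?_) ?_
      · rw [lat_index hd₁ _ _ hl]; positivity
      · rw [inf_comm, inf_comm (Mlat (dval B₁ F) (dl (D ⊔ 0)))]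
        refine gen _ _ _ ?_
        rw [lat_index hd₂ _ _ hr]; positivity
  exact Finite.Set.subset (Mlat (tval B₁ B₂ F) (D ⊔ 0 : _ →₀ ℤ) : Set F)
    (Mlat_mono (le_sup_left (a := D)))
theorem prodFormula (hQ : 1 < Q)
    (hd₁ : ∀ P : HOS B₁, Nat.card (B₁ ⧸ P.asIdeal) = Q ^ d₁ P)
    (hd₂ : ∀ P : HOS B₂, Nat.card (B₂ ⧸ P.asIdeal) = Q ^ d₂ P)
    (h0 : Finite (Mlat (tval B₁ B₂ F) (0 : _ →₀ ℤ)))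
    (hvan : ∃ D, Van B₁ B₂ F D) (u : F) (hu : u ≠ 0) :
    dgr sdd (dv (tval B₁ B₂ F) u) = 0 := by
  obtain ⟨D, hD⟩ := hvan
  set w := dv (tval B₁ B₂ F) u
  have e := card_Mlat_mul finSup_tval hu (D ⊔ (D - w))
  have hf := finite_Mlat (Q := Q) (by omega) hd₁ hd₂ h0 D
  have e1 := van_card hd₁ hd₂ (le_sup_left : D ≤ D ⊔ (D - w)) hD
  have h2 : D ≤ (D ⊔ (D - w)) + w := by
    have : (D - w) ≤ D ⊔ (D - w) := le_sup_right
    exact sub_le_iff_le_add.1 this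
  have e2 := van_card hd₁ hd₂ h2 hD
  rw [e, e1] at e2
  have hpos : 0 < Nat.card (Mlat (tval B₁ B₂ F) D) := Nat.card_pos
  have e3 := Nat.pow_right_injective hQ (Nat.eq_of_mul_eq_mul_left hpos e2)
  have m1 := dgr_mono sdd (le_sup_left : D ≤ D ⊔ (D - w))
  have m2 := dgr_mono sdd h2
  rw [dgr_add] at m2 e3
  omega
theorem riemannRoch (hQ : 1 < Q)
    (hd₁ : ∀ P : HOS B₁, Nat.card (B₁ ⧸ P.asIdeal) = Q ^ d₁ P)
    (hd₂ : ∀ P : HOS B₂, Nat.card (B₂ ⧸ P.asIdeal) = Q ^ d₂ P)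
    (h0 : Finite (Mlat (tval B₁ B₂ F) (0 : _ →₀ ℤ))) (D0 : ℤ)
    (hvan : ∃ D, Van B₁ B₂ F D)
    (hdual : ∀ D, ¬ Van B₁ B₂ F D → dgr sdd D < D0) :
    ∃ κ : ℝ, 0 < κ ∧ ∀ D, D0 ≤ dgr sdd D →
      (Nat.card (Mlat (tval B₁ B₂ F) D) : ℝ) = κ * Qr ^ dgr sdd D := by
  obtain ⟨D, hD⟩ := hvan
  have hf := finite_Mlat (Q := Q) (by omega) hd₁ hd₂ h0 D
  have hpos : 0 < Nat.card (Mlat (tval B₁ B₂ F) D) := Nat.card_pos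
  have hQ0 : Qr ≠ 0 := by positivity
  have conv : ∀ {A A' : HOS B₁ ⊕ HOS B₂ →₀ ℤ}, A ≤ A' →
      Van B₁ B₂ F A → (Nat.card (Mlat (tval B₁ B₂ F) A') : ℝ) =
        Nat.card (Mlat (tval B₁ B₂ F) A) * (Qr ^ dgr sdd A' *
          (Qr ^ dgr sdd A)⁻¹) := by
    intro A A' h hA
    rw [van_card hd₁ hd₂ h hA]
    push_cast
    congr 1
    rw [← zpow_neg, ← zpow_add₀ hQ0, ← zpow_natCast]
    congr 1
    have := dgr_mono sdd h
    omega
  refine ⟨Nat.card (Mlat (tval B₁ B₂ F) D) * (Qr ^ dgr sdd D)⁻¹, by positivity, ?_⟩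
  intro D' hD'
  have hV : Van B₁ B₂ F D' := by
    by_contra h
    exact absurd (hdual D' h) (not_lt.2 hD')
  have e1 := conv (le_sup_left : D ≤ D ⊔ D') hD
  have e2 := conv (le_sup_right : D' ≤ D ⊔ D') hV
  rw [e1] at e2
  field_simp at e2 ⊢
  linarith
end two
section zeta
variable {ι : Type*} {dg : ι → ℕ} {T : ℕ → Finset ι}
def Xeff (dg : ι → ℕ) (n : ℕ) : Set (ι →₀ ℤ) := {E | 0 ≤ E ∧ dgr dg E = n}
theorem single_nonneg' {P : ι} {j : ℤ} (hj : 0 ≤ j) : (0 : ι →₀ ℤ) ≤ Finsupp.single P j := by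
  classical
  intro P'; rw [Finsupp.single_apply]; split_ifs <;> simp [hj]
theorem single_le' {P : ι} {j : ℤ} {E : ι →₀ ℤ} (hE : 0 ≤ E) (hj : j ≤ E P) :
    Finsupp.single P j ≤ E := by
  classical
  intro P'; rw [Finsupp.single_apply]; split_ifs with h
  · subst h; exact hj
  · exact hE P'
theorem eff_bound (hdg : ∀ P, 1 ≤ dg P) {n : ℕ} {E : ι →₀ ℤ} (hE : E ∈ Xeff dg n) (P : ι) :
    E P * dg P ≤ n := by
  have := dgr_mono dg (single_le' hE.1 (le_refl (E P)))
  rwa [dgr_single, hE.2] at this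
theorem finite_Xeff (hdg : ∀ P, 1 ≤ dg P) (hT : ∀ n P, P ∈ T n ↔ dg P ≤ n) (n : ℕ) :
    (Xeff dg n).Finite := by
  classical
  refine (Set.finite_Icc (0 : ι →₀ ℤ) (Finsupp.indicator (T n) fun _ _ => (n : ℤ))).subset ?_
  intro E hE
  refine ⟨hE.1, fun P => ?_⟩
  rw [Finsupp.indicator_apply]
  have h1 := eff_bound hdg hE P
  have h2 := hE.1 P
  have h3 := hdg P
  simp only [Finsupp.coe_zero, Pi.zero_apply] at h2
  split_ifs with h
  · nlinarith
  · rw [hT] at h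
    by_contra hc
    nlinarith
noncomputable def Aeff (dg : ι → ℕ) (n : ℕ) : ℕ := (Xeff dg n).ncard
def Npt (dg : ι → ℕ) (T : ℕ → Finset ι) (s : ℕ) : ℕ := ∑ P ∈ (T s).filter (fun P => dg P ∣ s), dg P
theorem card_shift (hdg : ∀ P, 1 ≤ dg P) (hT : ∀ n P, P ∈ T n ↔ dg P ≤ n) (n : ℕ) (P : ι) (j : ℕ)
    (hj : j * dg P ≤ n) :
    {E | E ∈ Xeff dg n ∧ (j : ℤ) ≤ E P}.ncard = Aeff dg (n - j * dg P) := by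
  symm
  have : {E | E ∈ Xeff dg n ∧ (j : ℤ) ≤ E P} =
      (fun E => E + Finsupp.single P (j : ℤ)) '' Xeff dg (n - j * dg P) := by
    ext E
    constructor
    · rintro ⟨h1, h2⟩
      refine ⟨E - Finsupp.single P (j : ℤ), ⟨sub_nonneg.2 (single_le' h1.1 h2), ?_⟩, by simp⟩
      rw [dgr_sub, dgr_single, h1.2]
      push_cast [hj]; ring
    · rintro ⟨E, h1, rfl⟩
      refine ⟨⟨add_nonneg h1.1 (single_nonneg' (by positivity)), ?_⟩, ?_⟩
      · rw [dgr_add, dgr_single, h1.2]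
        push_cast [hj]; ring
      · have := h1.1 P
        simpa using this
  rw [this, Set.ncard_image_of_injective _ (add_left_injective _)]
  rfl
theorem nA (hdg : ∀ P, 1 ≤ dg P) (hT : ∀ n P, P ∈ T n ↔ dg P ≤ n) (n : ℕ) :
    n * Aeff dg n = ∑ s ∈ Finset.Icc 1 n, Npt dg T s * Aeff dg (n - s) := by
  classical
  have hfin := finite_Xeff hdg hT n
  set X := hfin.toFinset with hX
  have hmem : ∀ E, E ∈ X ↔ E ∈ Xeff dg n := fun E => by rw [hX, Set.Finite.mem_toFinset]
  have hcard : Aeff dg n = X.card := Set.ncard_eq_toFinset_card _ hfin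
  have h1 : ∀ E ∈ X, (n : ℤ) = ∑ P ∈ T n, E P * dg P := by
    intro E hE
    rw [hmem] at hE
    rw [← hE.2, dgr]
    refine Finsupp.sum_of_support_subset _ ?_ _ (by simp)
    intro P hP
    have b := eff_bound hdg hE P
    have h2 := hE.1 P
    have h3 := hdg P
    rw [hT]
    simp only [Finsupp.coe_zero, Pi.zero_apply, Finsupp.mem_support_iff] at h2 hP
    have : 1 ≤ E P := by omega
    by_contra hc
    nlinarith
  have h2 : ∀ P, ∑ E ∈ X, E P = ∑ j ∈ Finset.Icc 1 n, ((X.filter fun E => (j : ℤ) ≤ E P).card : ℤ) := by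
    intro P
    have : ∀ E ∈ X, E P = ∑ j ∈ Finset.Icc 1 n, if (j : ℤ) ≤ E P then (1 : ℤ) else 0 := by
      intro E hE
      rw [hmem] at hE
      have b := eff_bound hdg hE P
      have h2 := hE.1 P
      have h3 := hdg P
      simp only [Finsupp.coe_zero, Pi.zero_apply] at h2
      have hle : E P ≤ n := by nlinarith
      rw [← Finset.sum_filter, Finset.sum_const]
      have : (Finset.Icc 1 n).filter (fun j : ℕ => (j : ℤ) ≤ E P) = Finset.Icc 1 (E P).toNat := by
        ext j; simp only [Finset.mem_filter, Finset.mem_Icc]; omega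
      rw [this]; simp; omega
    rw [Finset.sum_congr rfl this, Finset.sum_comm]
    refine Finset.sum_congr rfl fun j _ => ?_
    rw [← Finset.sum_filter]; simp
  have h3 : ∀ P, ∑ E ∈ X, E P = ∑ j ∈ (Finset.Icc 1 n).filter (fun j => j * dg P ≤ n),
      (Aeff dg (n - j * dg P) : ℤ) := by
    intro P
    rw [h2, Finset.sum_filter]
    refine Finset.sum_congr rfl fun j hj => ?_
    split_ifs with h
    · rw [← card_shift hdg hT n P j h]
      norm_cast
      rw [← Set.ncard_coe_finset]
      congr 1
      ext E; simp [hmem]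
    · norm_cast
      rw [Finset.card_eq_zero, Finset.filter_eq_empty_iff]
      intro E hE hc
      rw [hmem] at hE
      have b := eff_bound hdg hE P
      apply h
      have : (j : ℤ) * dg P ≤ E P * dg P := by gcongr
      exact_mod_cast this.trans b
  have h4 : ∀ P, ∑ j ∈ (Finset.Icc 1 n).filter (fun j => j * dg P ≤ n),
      (Aeff dg (n - j * dg P) : ℤ) = ∑ s ∈ (Finset.Icc 1 n).filter (fun s => dg P ∣ s),
      (Aeff dg (n - s) : ℤ) := by
    intro P
    have h3 := hdg P
    refine Finset.sum_bij (fun j _ => j * dg P) ?_ ?_ ?_ ?_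
    · intro j hj
      simp only [Finset.mem_filter, Finset.mem_Icc] at hj ⊢
      refine ⟨⟨?_, hj.2⟩, dvd_mul_left _ _⟩
      nlinarith
    · intro a _ b _ h
      exact Nat.eq_of_mul_eq_mul_right (by omega) h
    · intro s hs
      simp only [Finset.mem_filter, Finset.mem_Icc] at hs
      obtain ⟨⟨h1, h2⟩, k, rfl⟩ := hs
      refine ⟨k, ?_, mul_comm _ _⟩
      simp only [Finset.mem_filter, Finset.mem_Icc]
      refine ⟨⟨?_, by nlinarith⟩, by rwa [mul_comm]⟩
      by_contra hc
      have : k = 0 := by omega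
      subst this; simp at h1
    · intros; rfl
  have h5 : (n : ℤ) * Aeff dg n = ∑ P ∈ T n, (∑ E ∈ X, E P) * dg P := by
    rw [hcard]
    calc (n : ℤ) * X.card = ∑ E ∈ X, (n : ℤ) := by simp [mul_comm]
      _ = ∑ E ∈ X, ∑ P ∈ T n, E P * dg P := Finset.sum_congr rfl h1
      _ = _ := by rw [Finset.sum_comm]; simp [Finset.sum_mul]
  have h6 : (n : ℤ) * Aeff dg n = ∑ s ∈ Finset.Icc 1 n, (Npt dg T s : ℤ) * Aeff dg (n - s) := by
    rw [h5]
    simp_rw [h3, h4, Finset.sum_filter, Finset.sum_mul]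
    rw [Finset.sum_comm]
    refine Finset.sum_congr rfl fun s hs => ?_
    rw [Finset.mem_Icc] at hs
    unfold Npt
    push_cast
    rw [Finset.sum_mul]
    have : (T s).filter (fun P => dg P ∣ s) = (T n).filter (fun P => dg P ∣ s) := by
      ext P
      simp only [Finset.mem_filter, hT]
      constructor
      · rintro ⟨a, b⟩; exact ⟨by omega, b⟩
      · rintro ⟨a, b⟩; exact ⟨Nat.le_of_dvd (by omega) b, b⟩
    rw [this, Finset.sum_filter]
    refine Finset.sum_congr rfl fun P _ => ?_
    split_ifs <;> ring
  exact_mod_cast h6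
theorem sig_ext {C F : Type*} (p : C → F → Prop) {c c' : C} (h : c = c') (x : {u // p c u})
    (y : {u // p c' u}) (hxy : x.1 = y.1) : (⟨c, x⟩ : Σ c : C, {u : F // p c u}) = ⟨c', y⟩ := by
  subst h
  rw [Subtype.ext hxy]
section count
variable {F : Type*} [Field F] {v : ι → VF}
def clSetoid (v : ι → VF) (hv : FinSup v) (dg : ι → ℕ) :
    Setoid {D : ι →₀ ℤ // dgr dg D = 0} where
  r D D' := ∃ u : F, u ≠ 0 ∧ D'.1 = D.1 + dv v u
  iseqv := by
    refine ⟨fun D => ⟨1, one_ne_zero, by rw [dv_one hv]; simp⟩, ?_, ?_⟩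
    · rintro D D' ⟨u, hu, h⟩
      exact ⟨u⁻¹, inv_ne_zero hu, by rw [dv_inv hv hu, h]; abel⟩
    · rintro D D' D'' ⟨u, hu, h⟩ ⟨w, hw, h'⟩
      exact ⟨u * w, mul_ne_zero hu hw, by rw [dv_mul hv hu hw, h', h]; abel⟩
theorem count_eff (hv : FinSup v) (hdg : ∀ P, 1 ≤ dg P) (hT : ∀ n P, P ∈ T n ↔ dg P ≤ n)
    (hprod : ∀ u : F, u ≠ 0 → dgr dg (dv v u) = 0) (hfin : ∀ D : ι →₀ ℤ, Finite (Mlat v D))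
    {Q : ℕ} (hQ : 1 < Q) {κ : ℝ} (hκ : 0 < κ) {D0 : ℤ}
    (hRR : ∀ D : ι →₀ ℤ, D0 ≤ dgr dg D → (Nat.card (Mlat v D) : ℝ) = κ * Qr ^ dgr dg D)
    (P1 : ι) (hP1 : dg P1 = 1) :
    ∃ γ : ℝ, ∀ n : ℕ, D0 ≤ n → (Aeff dg n : ℝ) = γ * (κ * Qr ^ n - 1) := by
  classical
  letI := clSetoid v hv dg
  set C := Quotient (clSetoid v hv dg)
  have hdeg : ∀ (c : {D : ι →₀ ℤ // dgr dg D = 0}) (n : ℕ),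
      dgr dg (c.1 + Finsupp.single P1 (n : ℤ)) = n := by
    intro c n; rw [dgr_add, c.2, dgr_single, hP1]; simp
  have hsub : ∀ (E : ι →₀ ℤ) (n : ℕ), E ∈ Xeff dg n → dgr dg (E - Finsupp.single P1 (n : ℤ)) = 0 := by
    intro E n hE; rw [dgr_sub, hE.2, dgr_single, hP1]; simp
  have hCfin : Finite C := by
    obtain ⟨n0, hn0⟩ : ∃ n : ℕ, D0 ≤ n ∧ 1 < κ * Qr ^ n := by
      obtain ⟨m, hm⟩ := pow_unbounded_of_one_lt (κ⁻¹) (show (1 : ℝ) < Q by exact_mod_cast hQ)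
      refine ⟨max m D0.toNat, by push_cast; have := Int.self_le_toNat D0; exact le_max_of_le_right (by exact_mod_cast this), ?_⟩
      have h1 : Qr ^ m ≤ Qr ^ (max m D0.toNat) :=
        pow_le_pow_right₀ (by exact_mod_cast hQ.le) (le_max_left _ _)
      have h2 : κ⁻¹ < Qr ^ (max m D0.toNat) := hm.trans_le h1
      have := mul_lt_mul_of_pos_left h2 hκ
      rwa [mul_inv_cancel₀ hκ.ne'] at this
    have hf := finite_Xeff hdg hT n0
    have := hf.to_subtype
    refine Finite.of_surjective (fun E : Xeff dg n0 => (⟦⟨E.1 - Finsupp.single P1 (n0 : ℤ),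
      hsub _ _ E.2⟩⟧ : C)) ?_
    intro c
    induction c using Quotient.inductionOn with
    | h c =>
    have hc := hRR (c.1 + Finsupp.single P1 (n0 : ℤ)) (by rw [hdeg]; exact hn0.1)
    rw [hdeg, zpow_natCast] at hc
    have hlt : 1 < Nat.card (Mlat v (c.1 + Finsupp.single P1 (n0 : ℤ) : ι →₀ ℤ)) := by
      have := hn0.2; rw [← hc] at this; exact_mod_cast this
    haveI := hfin (c.1 + Finsupp.single P1 (n0 : ℤ))
    haveI := Finite.one_lt_card_iff_nontrivial.1 hlt
    obtain ⟨u, hu⟩ := exists_ne (0 : Mlat v (c.1 + Finsupp.single P1 (n0 : ℤ) : ι →₀ ℤ))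
    have hu0 : (u : F) ≠ 0 := fun h => hu (Subtype.ext h)
    have hle := (mem_Mlat_dv hv hu0 _).1 u.2
    refine ⟨⟨c.1 + Finsupp.single P1 (n0 : ℤ) - dv v u.1, sub_nonneg.2 hle, ?_⟩, ?_⟩
    · rw [dgr_sub, hdeg, hprod _ hu0]; ring
    · apply Quotient.sound
      exact ⟨u.1, hu0, by simp only; abel⟩
  haveI := Fintype.ofFinite C
  set U := {u : F // u ≠ 0 ∧ dv v u = 0}
  have hUfin : Finite U := by
    have := hfin 0
    refine Finite.of_injective (fun u : U => (⟨u.1, (mem_Mlat_dv hv u.2.1 0).2 u.2.2.le⟩ :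
      Mlat v ((0 : ι →₀ ℤ) : ι → ℤ))) ?_
    intro a b h
    exact Subtype.ext (congrArg (fun z => z.1) h)
  have hUpos : 0 < Nat.card U := by
    haveI : Nonempty U := ⟨⟨1, one_ne_zero, dv_one hv⟩⟩
    exact Nat.card_pos
  have key : ∀ n : ℕ, D0 ≤ n → (Aeff dg n : ℝ) * Nat.card U =
      Fintype.card C * (κ * Qr ^ n - 1) := by
    intro n hn
    let Y := Σ c : C, {u : F // u ≠ 0 ∧ u ∈ Mlat v c1n}
    let cl : Xeff dg n → C := fun E => ⟦⟨E.1 - Finsupp.single P1 (n : ℤ), hsub _ _ E.2⟩⟧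
    have hg : ∀ E : Xeff dg n, ∃ g : F, g ≠ 0 ∧
        dv v g = (cl E).out.1 + Finsupp.single P1 (n : ℤ) - E.1 := by
      intro E
      have : (⟨E.1 - Finsupp.single P1 (n : ℤ), hsub _ _ E.2⟩ : {D : ι →₀ ℤ // dgr dg D = 0}) ≈
          (cl E).out := Quotient.exact (Quotient.out_eq (cl E)).symm
      obtain ⟨u, hu, h⟩ := this
      refine ⟨u, hu, ?_⟩
      rw [h]; simp only; abel
    choose g hg0 hg1 using hg
    have hY : Nat.card Y = Nat.card (Xeff dg n × U) := by
      symm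
      let φ : Xeff dg n × U → Y := fun p => ⟨cl p.1, g p.1 * p.2.1, mul_ne_zero (hg0 _) p.2.2.1, by
        rw [mem_Mlat_dv hv (mul_ne_zero (hg0 _) p.2.2.1), dv_mul hv (hg0 _) p.2.2.1, p.2.2.2, hg1,
          add_zero]
        exact sub_le_self _ p.1.2.1⟩
      refine Nat.card_congr (Equiv.ofBijective φ ⟨?_, ?_⟩)
      · rintro ⟨E, u⟩ ⟨E', u'⟩ h
        have h1 : cl E = cl E' := congrArg (fun z => z.1) h
        have h2 : g E * u.1 = g E' * u'.1 := congrArg (fun z : Y => z.2.1) h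
        have h3 : E = E' := by
          have := congrArg (dv v) h2
          rw [dv_mul hv (hg0 _) u.2.1, dv_mul hv (hg0 _) u'.2.1, u.2.2, u'.2.2, hg1, hg1, h1] at this
          apply Subtype.ext
          simpa using this
        subst h3
        have h4 : u = u' := Subtype.ext (mul_left_cancel₀ (hg0 _) h2)
        rw [h4]
      · rintro ⟨c, u, hu0, hu⟩
        have hle := (mem_Mlat_dv hv hu0 _).1 hu
        have hE : c.out.1 + Finsupp.single P1 (n : ℤ) - dv v u ∈ Xeff dg n := by
          refine ⟨sub_nonneg.2 hle, ?_⟩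
          rw [dgr_sub, hdeg, hprod _ hu0]; ring
        set E : Xeff dg n := ⟨_, hE⟩ with hEdef
        have hcl : cl E = c := by
          rw [← Quotient.out_eq c]
          apply Quotient.sound
          exact ⟨u, hu0, by simp only [hEdef]; abel⟩
        have hdvg : dv v (g E) = dv v u := by
          rw [hg1, hcl]; simp [hEdef]
        refine ⟨(E, ⟨u / g E, div_ne_zero hu0 (hg0 _), ?_⟩), ?_⟩
        · rw [div_eq_mul_inv, dv_mul hv hu0 (inv_ne_zero (hg0 _)), dv_inv hv (hg0 _), hdvg]; simp
        · have : g E * (u / g E) = u := by field_simp [hg0 E]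
          simp only [φ]
          exact sig_ext (fun (c : C) (u : F) => u ≠ 0 ∧ u ∈ Mlat v c1n) hcl _ _ this
    have hA : Nat.card (Xeff dg n) = Aeff dg n := rfl
    rw [Nat.card_prod, hA] at hY
    have hfib : ∀ c : C, (Nat.card {u : F // u ≠ 0 ∧ u ∈
        Mlat v c1n} : ℝ) = κ * Qr ^ n - 1 := by
      intro c
      have h1 := hRR (c.out.1 + Finsupp.single P1 (n : ℤ)) (by rw [hdeg]; exact hn)
      rw [hdeg, zpow_natCast] at h1
      rw [← h1]
      have hfi := hfin (c.out.1 + Finsupp.single P1 (n : ℤ))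
      have h2 : Nat.card {u : F // u ≠ 0 ∧ u ∈
          Mlat v c1n} + 1 =
          Nat.card (Mlat v c1n) := by
        set M := Mlat v c1n
        change Set.ncard {u : F | u ≠ 0 ∧ u ∈ M} + 1 = Set.ncard (M : Set F)
        have hMf : (M : Set F).Finite := hfi
        have : {u : F | u ≠ 0 ∧ u ∈ M} = (M : Set F) \ {0} := by
          ext u; simp [and_comm]
        rw [this, Set.ncard_sdiff_singleton_add_one M.zero_mem hMf]
      rw [← h2]; push_cast; ring
    have hYf : ∀ c : C, Finite {u : F // u ≠ 0 ∧ u ∈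
        Mlat v c1n} := by
      intro c
      have hfi := hfin (c.out.1 + Finsupp.single P1 (n : ℤ))
      exact Finite.of_injective (fun u => (⟨u.1, u.2.2⟩ :
        Mlat v c1n)) (by
          intro a b h; exact Subtype.ext (congrArg (fun z => z.1) h))
    have hYsum : Nat.card Y = ∑ c : C, Nat.card {u : F // u ≠ 0 ∧ u ∈
        Mlat v c1n} := Nat.card_sigma
    rw [hYsum] at hY
    have := congrArg (fun m : ℕ => (m : ℝ)) hY
    simp only [Nat.cast_sum, Nat.cast_mul] at this
    rw [← this, Finset.sum_congr rfl (fun c _ => hfib c)]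
    simp; ring
  refine ⟨Fintype.card C / Nat.card U, fun n hn => ?_⟩
  have h := key n hn
  have : (Nat.card U : ℝ) ≠ 0 := by exact_mod_cast hUpos.ne'
  rw [div_mul_eq_mul_div, eq_div_iff this]
  linarith
end count
end zeta
section rh
open PowerSeries
theorem factor_one_sub (B : ℕ) : ∀ L : Polynomial ℂ, L.coeff 0 = 1 → L.natDegree ≤ B →
    ∃ ω : Fin B → ℂ, L = ∏ i, (1 - Polynomial.C (ω i) * Polynomial.X) := by
  induction B with
  | zero =>
    intro L h0 hd
    refine ⟨Fin.elim0, ?_⟩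
    rw [Polynomial.eq_C_of_natDegree_le_zero hd, h0]; simp
  | succ B ih =>
    intro L h0 hd
    by_cases hB : L.natDegree ≤ B
    · obtain ⟨ω, h⟩ := ih L h0 hB
      refine ⟨Fin.cons 0 ω, ?_⟩
      rw [Fin.prod_univ_succ]; simpa using h
    · have hdeg : L.degree ≠ 0 := by
        intro h
        have := Polynomial.natDegree_eq_of_degree_eq_some h
        exact hB (by rw [this]; exact Nat.zero_le _)
      obtain ⟨z, hz⟩ := IsAlgClosed.exists_root L hdeg
      have hz0 : z ≠ 0 := by
        rintro rfl
        rw [Polynomial.IsRoot, ← Polynomial.coeff_zero_eq_eval_zero, h0] at hz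
        exact one_ne_zero hz
      obtain ⟨R, hR⟩ := Polynomial.dvd_iff_isRoot.2 hz
      have hR0 : R ≠ 0 := by rintro rfl; rw [mul_zero] at hR; rw [hR] at h0; simp at h0
      have hRd : R.natDegree ≤ B := by
        have := Polynomial.natDegree_mul (Polynomial.X_sub_C_ne_zero z) hR0
        rw [← hR, Polynomial.natDegree_X_sub_C] at this
        omega
      have hfac : L = (1 - Polynomial.C z⁻¹ * Polynomial.X) * (Polynomial.C (-z) * R) := by
        have h1 : (Polynomial.C z⁻¹ * Polynomial.C z : Polynomial ℂ) = 1 := by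
          rw [← Polynomial.C_mul, inv_mul_cancel₀ hz0, Polynomial.C_1]
        rw [Polynomial.C_neg]
        linear_combination hR - Polynomial.X * R * h1
      obtain ⟨ω, h⟩ := ih (Polynomial.C (-z) * R) (by
        rw [hfac, Polynomial.mul_coeff_zero] at h0; simpa using h0)
        ((Polynomial.natDegree_C_mul_le _ _).trans hRd)
      refine ⟨Fin.cons z⁻¹ ω, ?_⟩
      rw [Fin.prod_univ_succ]
      simp only [Fin.cons_zero, Fin.cons_succ]
      rw [← h]; exact hfac
noncomputable def Gser (ω : ℂ) : PowerSeries ℂ := PowerSeries.mk fun s => if s = 0 then 0 else ω ^ s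
theorem Gser_eq (ω : ℂ) : (X : PowerSeries ℂ) * d⁄dX ℂ (1 - C ω * X) = (1 - C ω * X) * (-Gser ω) := by
  have h1 : d⁄dX ℂ (1 - C ω * X) = - C ω := by
    rw [map_sub, Derivation.map_one_eq_zero, Derivation.leibniz, derivative_C, derivative_X]; simp
  rw [h1]
  ext n
  rcases n with _ | n
  · simp [Gser]
  · rw [sub_mul, one_mul, map_sub, mul_assoc, coeff_C_mul, coeff_succ_X_mul, coeff_succ_X_mul]
    rcases n with _ | n
    · simp [Gser]
    · rw [← map_neg C, coeff_C]
      simp [Gser, pow_succ]; ring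
theorem logder {ι : Type*} (s : Finset ι) (f g : ι → PowerSeries ℂ)
    (h : ∀ i ∈ s, (X : PowerSeries ℂ) * d⁄dX ℂ (f i) = f i * g i) :
    (X : PowerSeries ℂ) * d⁄dX ℂ (∏ i ∈ s, f i) = (∏ i ∈ s, f i) * ∑ i ∈ s, g i := by
  classical
  induction s using Finset.induction_on with
  | empty => simp
  | insert a s ha ih =>
    rw [Finset.prod_insert ha, Finset.sum_insert ha, Derivation.leibniz]
    have h1 := h a (Finset.mem_insert_self _ _)
    have h2 := ih fun i hi => h i (Finset.mem_insert_of_mem hi)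
    simp only [smul_eq_mul]
    linear_combination f a * h2 + (∏ i ∈ s, f i) * h1
theorem zeta_roots {Q : ℕ} (A N : ℕ → ℕ) (B : ℕ) (γ κ : ℝ) (hA0 : A 0 = 1)
    (hA : ∀ n : ℕ, B ≤ n + 1 → (A n : ℝ) = γ * (κ * Qr ^ n - 1)) (hB : B = 0 → κ = Q)
    (hnA : ∀ n, n * A n = ∑ s ∈ Finset.Icc 1 n, N s * A (n - s)) :
    ∃ ω : Fin B → ℂ, ∀ s, 1 ≤ s → (N s : ℂ) = (Q : ℂ) ^ s + 1 - ∑ i, ω i ^ s := by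
  set Z : PowerSeries ℂ := PowerSeries.mk fun n => (A n : ℂ) with hZ
  set S : PowerSeries ℂ := PowerSeries.mk fun n => if n = 0 then 0 else (N n : ℂ) with hS
  have hZS : (X : PowerSeries ℂ) * d⁄dX ℂ Z = Z * S := by
    ext n
    have h1 : coeff n (X * d⁄dX ℂ Z) = n * (A n : ℂ) := by
      rcases n with _ | n
      · simp
      · rw [coeff_succ_X_mul, coeff_derivative, hZ, coeff_mk]; push_cast; ring
    rw [h1, mul_comm Z S, coeff_mul, Finset.Nat.sum_antidiagonal_eq_sum_range_succ
      (fun i j => coeff i S * coeff j Z), Finset.sum_range_succ']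
    have h2 : (n : ℂ) * A n = ∑ s ∈ Finset.Icc 1 n, (N s : ℂ) * A (n - s) := by exact_mod_cast hnA n
    rw [h2, hS, hZ]
    simp only [coeff_mk]
    rw [Finset.range_eq_Ico, Finset.sum_Ico_add' (fun k => (if k = 0 then 0 else (N k : ℂ)) * (A (n - k) : ℂ)) 0 n 1]
    simp only [if_true, zero_mul, add_zero, zero_add]
    apply Finset.sum_congr
    · rfl
    · intro s hs; simp at hs; rw [if_neg (by omega)]
  set L : PowerSeries ℂ := (1 - C 1 * X) * (1 - C (Q : ℂ) * X) * Z with hL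
  have hLexp : L = Z - C ((Q : ℂ) + 1) * (X * Z) + C (Q : ℂ) * (X * (X * Z)) := by
    rw [hL, map_add, map_one]; ring
  have hAc : ∀ n : ℕ, B ≤ n + 1 → (A n : ℂ) = γ * (κ * (Q : ℂ) ^ n - 1) := by
    intro n hn; have := hA n hn; exact_mod_cast congrArg (fun x : ℝ => (x : ℂ)) this
  have hL0 : coeff 0 L = 1 := by
    rw [hLexp]; simp [hZ, hA0]
  have hLn : ∀ n, B < n → coeff n L = 0 := by
    intro n hn
    rw [hLexp]
    set Q1 : ℂ := (Q : ℂ) + 1 with hQ1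
    rcases n with _ | _ | n
    · omega
    · have hB0 : B = 0 := by omega
      have hκ := hB hB0
      simp only [map_add, map_sub, coeff_C_mul, zero_add, hZ]
      rw [show (1 : ℕ) = 0 + 1 from rfl, coeff_succ_X_mul, coeff_succ_X_mul, coeff_mk, coeff_mk,
        coeff_zero_X_mul, hAc 0 (by omega), hAc (0 + 1) (by omega), hκ]
      rw [hQ1]; push_cast; ring
    · simp only [map_add, map_sub, coeff_C_mul, hZ, coeff_succ_X_mul, coeff_mk]
      rw [hAc n (by omega), hAc (n + 1) (by omega), hAc (n + 1 + 1) (by omega), hQ1]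
      ring
  set Lp : Polynomial ℂ := trunc (B + 1) L with hLp
  have hLL : (Lp : PowerSeries ℂ) = L := by
    ext n
    rw [Polynomial.coeff_coe, hLp, coeff_trunc]
    split_ifs with h
    · rfl
    · rw [hLn n (by omega)]
  obtain ⟨ω, hω⟩ := factor_one_sub B Lp (by rw [← Polynomial.coeff_coe, hLL, hL0]) (by
    exact Nat.lt_succ_iff.1 (natDegree_trunc_lt L B))
  have hLω : L = ∏ i, (1 - C (ω i) * X) := by
    rw [← hLL, hω, ← Polynomial.coeToPowerSeries.ringHom_apply, map_prod]
    apply Finset.prod_congr rfl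
    intro i _
    simp
  have hd1 : X * d⁄dX ℂ L = L * ∑ i, -Gser (ω i) := by
    rw [hLω]; exact logder _ _ _ fun i _ => Gser_eq _
  have hd2 : X * d⁄dX ℂ L = L * (S - Gser 1 - Gser Q) := by
    rw [hL, Derivation.leibniz, Derivation.leibniz]
    have e1 := Gser_eq 1
    have e2 := Gser_eq Q
    simp only [smul_eq_mul]
    linear_combination (1 - C 1 * X) * (1 - C (Q : ℂ) * X) * hZS + Z * (1 - C (Q : ℂ) * X) * e1 +
       Z * (1 - C 1 * X) * e2
  have hLne : L ≠ 0 := by intro h; rw [h] at hL0; simp at hL0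
  have hfin := mul_left_cancel₀ hLne (hd1.symm.trans hd2)
  refine ⟨ω, fun s hs => ?_⟩
  have := congrArg (coeff s) hfin
  simp only [map_sum, map_neg, map_sub, Gser, hS, coeff_mk, if_neg (show s ≠ 0 by omega), one_pow] at this
  rw [Finset.sum_neg_distrib] at this
  linear_combination -this
theorem rh_roots {B : ℕ} (ω : Fin B → ℂ) {Q : ℕ} (hQ : 1 < Q) (C : ℝ)
    (h : ∀ m : ℕ, 1 ≤ m → ∑ i, (ω i ^ (2 * m)).re ≤ 1 + C * Qr ^ m) (i : Fin B) :
    ‖ω i‖ ≤ Real.sqrt Q := by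
  by_contra hcon
  push Not at hcon
  have hpol : ∀ z : ℂ, ∃ c : Circle, z = ‖z‖ * (c : ℂ) := by
    intro z
    refine ⟨Circle.exp z.arg, ?_⟩
    rw [Circle.coe_exp]; exact (Complex.norm_mul_exp_arg_mul_I z).symm
  choose c hc using fun j => hpol (ω j)
  have hcl := mapClusterPt_one_atTop_pow (c ^ 2)
  have hnb : {g : Fin B → Circle | ∀ j, (1 / 2 : ℝ) < ((g j : Circle) : ℂ).re} ∈ nhds (1 : Fin B → Circle) := by
    have : {g : Fin B → Circle | ∀ j, (1 / 2 : ℝ) < ((g j : Circle) : ℂ).re} =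
      ⋂ j, {g : Fin B → Circle | (1 / 2 : ℝ) < ((g j : Circle) : ℂ).re} := by ext; simp
    rw [this]
    apply IsOpen.mem_nhds
    · apply isOpen_iInter_of_finite
      intro j
      apply isOpen_lt continuous_const
      exact Complex.continuous_re.comp (continuous_subtype_val.comp (continuous_apply j))
    · simp; norm_num
  have hfr := hcl.frequently hnb
  have hQ0 : (0 : ℝ) < Q := by positivity
  set x : ℝ := ‖ω i‖ ^ 2 / Q with hx
  have hx1 : 1 < x := by
    rw [hx, lt_div_iff₀ hQ0, one_mul, ← Real.sq_sqrt hQ0.le]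
    exact pow_lt_pow_left₀ hcon (Real.sqrt_nonneg _) two_ne_zero
  have htend := tendsto_pow_atTop_atTop_of_one_lt hx1
  have hev := (htend.eventually_gt_atTop (2 * (1 + |C|))).and (Filter.eventually_ge_atTop 1)
  obtain ⟨m, hm1, hm2, hm3⟩ := (hfr.and_eventually hev).exists
  have hle := h m hm3
  have hterm : ∀ j, ‖ω j‖ ^ (2 * m) / 2 ≤ (ω j ^ (2 * m)).re := by
    intro j
    have h1 : ω j ^ (2 * m) = ((‖ω j‖ ^ (2 * m) : ℝ) : ℂ) * ((((c ^ 2) ^ m) j : Circle) : ℂ) := by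
      conv_lhs => rw [hc j]
      rw [mul_pow, ← pow_mul]; push_cast; simp
    rw [h1, Complex.re_ofReal_mul]
    have h2 : 1 / 2 < ((((c ^ 2) ^ m) j : Circle) : ℂ).re := hm1 j
    have h3 : 0 ≤ ‖ω j‖ ^ (2 * m) := by positivity
    nlinarith
  have h4 : ‖ω i‖ ^ (2 * m) / 2 ≤ ∑ j, (ω j ^ (2 * m)).re := by
    calc _ ≤ (ω i ^ (2 * m)).re := hterm i
      _ ≤ _ := Finset.single_le_sum (f := fun j => (ω j ^ (2 * m)).re)
        (fun j _ => le_trans (by positivity) (hterm j)) (Finset.mem_univ i)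
  have h5 : ‖ω i‖ ^ (2 * m) = x ^ m * Qr ^ m := by
    rw [hx, div_pow, pow_mul]; field_simp
  have h6 : (1 : ℝ) ≤ Qr ^ m := one_le_pow₀ (by exact_mod_cast hQ.le)
  have h7 : C ≤ |C| := le_abs_self C
  have h8 : 0 ≤ |C| := abs_nonneg C
  rw [h5] at h4
  nlinarith [mul_lt_mul_of_pos_right hm2 (show (0 : ℝ) < Qr ^ m by positivity), mul_le_mul_of_nonneg_right h7 (show (0 : ℝ) ≤ Qr ^ m by positivity)]
theorem rh_abs {Q : ℕ} (hQ : 1 < Q) (A N : ℕ → ℕ) (B : ℕ) (γ κ : ℝ) (hA0 : A 0 = 1)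
    (hA : ∀ n : ℕ, B ≤ n + 1 → (A n : ℝ) = γ * (κ * Qr ^ n - 1)) (hB : B = 0 → κ = Q)
    (hnA : ∀ n, n * A n = ∑ s ∈ Finset.Icc 1 n, N s * A (n - s)) (C : ℝ)
    (hlow : ∀ m : ℕ, 1 ≤ m → Qr ^ (2 * m) - C * Qr ^ m ≤ N (2 * m)) :
    Qr + 1 - B * Real.sqrt Q ≤ N 1 := by
  obtain ⟨ω, hω⟩ := zeta_roots A N B γ κ hA0 hA hB hnA
  have hre : ∀ s, 1 ≤ s → (N s : ℝ) = Qr ^ s + 1 - ∑ i, (ω i ^ s).re := by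
    intro s hs
    have := congrArg Complex.re (hω s hs)
    rw [Complex.sub_re, Complex.re_sum, Complex.add_re] at this
    have e1 : ((Q : ℂ) ^ s).re = Qr ^ s := by
      rw [← Complex.ofReal_natCast, ← Complex.ofReal_pow, Complex.ofReal_re]
    rw [e1] at this
    simpa using this
  have hr := rh_roots ω hQ C (fun m hm => by
    have h1 := hlow m hm
    rw [hre _ (by omega)] at h1
    linarith)
  rw [hre 1 le_rfl]
  have : ∑ i, (ω i ^ 1).re ≤ ∑ i : Fin B, Real.sqrt Q := by
    apply Finset.sum_le_sum
    intro i _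
    rw [pow_one]
    exact (Complex.re_le_norm _).trans (hr i)
  simp at this
  simp; linarith
theorem weil_abs {ι F : Type*} [Field F] {v : ι → VF} {dg : ι → ℕ} {T : ℕ → Finset ι}
    (hv : FinSup v) (hdg : ∀ P, 1 ≤ dg P) (hT : ∀ n P, P ∈ T n ↔ dg P ≤ n)
    (hprod : ∀ u : F, u ≠ 0 → dgr dg (dv v u) = 0) (hfin : ∀ D : ι →₀ ℤ, Finite (Mlat v D))
    {Q : ℕ} (hQ : 1 < Q) {κ : ℝ} (hκ : 0 < κ) {D0 : ℤ}
    (hRR : ∀ D : ι →₀ ℤ, D0 ≤ dgr dg D → (Nat.card (Mlat v D) : ℝ) = κ * Qr ^ dgr dg D)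
    (P1 : ι) (hP1 : dg P1 = 1) (C : ℝ)
    (hlow : ∀ m : ℕ, 1 ≤ m → Qr ^ (2 * m) - C * Qr ^ m ≤ Npt dg T (2 * m)) :
    -1 ≤ D0 ∧ Qr + 1 - (D0 + 1) * Real.sqrt Q ≤ Npt dg T 1 := by
  have hneg : ∀ j : ℤ, j < 0 → Nat.card (Mlat v (Finsupp.single P1 j : ι →₀ ℤ)) = 1 := by
    intro j hj
    rw [Nat.card_eq_one_iff_unique]
    refine ⟨⟨?_⟩, ⟨0⟩⟩
    have : ∀ a : Mlat v (Finsupp.single P1 j : ι →₀ ℤ), a = 0 := by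
      rintro ⟨a, ha⟩
      by_contra hne
      have ha0 : a ≠ 0 := fun h => hne (Subtype.ext h)
      have := dgr_mono dg ((mem_Mlat_dv hv ha0 _).1 ha)
      rw [hprod _ ha0, dgr_single, hP1] at this
      push_cast at this; omega
    intro a b; rw [this a, this b]
  have hQ0 : (0 : ℝ) < Q := by positivity
  have hk : ∀ j : ℤ, j < 0 → D0 ≤ j → (1 : ℝ) = κ * Qr ^ j := by
    intro j hj hD
    have := hRR (Finsupp.single P1 j) (by rw [dgr_single, hP1]; simpa using hD)
    rw [hneg j hj, dgr_single, hP1] at this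
    simpa using this
  have hD0 : -1 ≤ D0 := by
    by_contra hcon
    have h1 := hk (-1) (by norm_num) (by omega)
    have h2 := hk (-2) (by norm_num) (by omega)
    have h3 : Qr ^ (-1 : ℤ) = Qr ^ (-2 : ℤ) * Q := by
      rw [show (-1 : ℤ) = -2 + 1 by norm_num, zpow_add_one₀ hQ0.ne']
    rw [h3, ← mul_assoc, ← h2, one_mul] at h1
    have : (1 : ℝ) < Q := by exact_mod_cast hQ
    linarith
  refine ⟨hD0, ?_⟩
  obtain ⟨B, hB⟩ := Int.eq_ofNat_of_zero_le (show 0 ≤ D0 + 1 by omega)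
  obtain ⟨γ, hγ⟩ := count_eff hv hdg hT hprod hfin hQ hκ hRR P1 hP1
  have := rh_abs hQ (Aeff dg) (Npt dg T) B γ κ ?_ (fun n hn => hγ n (by omega)) ?_ (nA hdg hT) C hlow
  · have e : (D0 : ℝ) + 1 = B := by exact_mod_cast hB
    rw [e]; exact this
  · unfold Aeff
    rw [Set.ncard_eq_one]
    refine ⟨0, ?_⟩
    ext E
    simp only [Set.mem_singleton_iff]
    constructor
    · intro hE
      have h1 := eff_bound hdg hE
      ext P
      have h2 := h1 P
      have h3 := hE.1 P
      have h4 := hdg P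
      simp at h3 h2 ⊢
      have h5 : (1 : ℤ) ≤ dg P := by exact_mod_cast h4
      nlinarith
    · rintro rfl
      exact ⟨le_rfl, by simp [dgr_zero]⟩
  · intro h
    have h1 := hk (-1) (by norm_num) (by omega)
    rw [zpow_neg_one] at h1
    field_simp at h1
    exact h1.symm
end rh
open Polynomial (X C)
section crv
variable {L F : Type*} [Field L] [Field F] [Algebra L F] {d : ℕ}
noncomputable def co (b : BdF) (j : ℕ) : F →ₗ[L] L :=
  if h : j < d then b.coord ⟨j, h⟩ else 0
theorem co_lt (b : BdF) (j : Fin d) (f : F) : co b j f = b.repr f j := by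
  simp [co]
theorem co_pow {b : BdF} {y : F} (hb : ∀ i, b i = y ^ (i : ℕ)) (j i : ℕ) (hi : i < d) :
    co b j (y ^ i) = if i = j then 1 else 0 := by
  have h1 : y ^ i = b ⟨i, hi⟩ := (hb ⟨i, hi⟩).symm
  rw [h1]
  unfold co
  split_ifs with h h2 h2
  · rw [Module.Basis.coord_apply, Module.Basis.repr_self, Finsupp.single_apply, if_pos (Fin.ext h2)]
  · rw [Module.Basis.coord_apply, Module.Basis.repr_self, Finsupp.single_apply, if_neg (fun h => h2 (congrArg Fin.val h))]
  · omega
  · rfl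
theorem co_sum {b : BdF} {y : F} (hb : ∀ i, b i = y ^ (i : ℕ)) (f : F) :
    f = ∑ i ∈ Finset.range d, co b i f • y ^ i := by
  conv_lhs => rw [← b.sum_repr f]
  rw [Finset.sum_range]
  apply Finset.sum_congr rfl
  intro i _
  rw [co_lt, hb]
theorem co_rec {b : BdF} {y : F} (hb : ∀ i, b i = y ^ (i : ℕ)) {p : Polynomial L}
    (hp : p.Monic) (hpd : p.natDegree = d) (hpy : Polynomial.aeval y p = 0) (j : ℕ) (hj : j + 1 < d) (g : F) :
    co b j g = co b (j + 1) (y * g) + p.coeff (j + 1) * co b (d - 1) g := by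
  have hyd : y ^ d = - ∑ i ∈ Finset.range d, p.coeff i • y ^ i := by
    rw [Polynomial.aeval_eq_sum_range, hpd, Finset.sum_range_succ] at hpy
    rw [← hpd, Polynomial.Monic.coeff_natDegree hp, hpd, one_smul] at hpy
    linear_combination hpy
  have : ∀ i, i < d → co b j (y ^ i) = co b (j + 1) (y * y ^ i) + p.coeff (j + 1) * co b (d - 1) (y ^ i) := by
    intro i hi
    rw [co_pow hb _ _ hi, co_pow hb _ _ hi]
    by_cases h : i + 1 < d
    · rw [← pow_succ', co_pow hb _ _ h]
      rw [if_neg (show i ≠ d - 1 by omega)]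
      simp
    · have hi' : i + 1 = d := by omega
      rw [← pow_succ', hi', hyd, map_neg, map_sum]
      simp only [map_smul, smul_eq_mul]
      rw [Finset.sum_eq_single (j + 1)]
      · rw [co_pow hb _ _ hj, if_neg (by omega), if_pos rfl, if_pos (by omega)]; ring
      · intro c hc hcj
        rw [co_pow hb _ _ (Finset.mem_range.1 hc), if_neg hcj, mul_zero]
      · intro h; exact absurd (Finset.mem_range.2 hj) h
  conv_lhs => rw [co_sum hb g]
  conv_rhs => rw [co_sum hb g]
  rw [Finset.mul_sum]
  simp only [map_sum, map_smul, smul_eq_mul, mul_smul_comm]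
  rw [Finset.mul_sum, ← Finset.sum_add_distrib]
  apply Finset.sum_congr rfl
  intro i hi
  rw [this i (Finset.mem_range.1 hi)]; ring
theorem co_tri {b : BdF} {y : F} (hb : ∀ i, b i = y ^ (i : ℕ)) {p : Polynomial L}
    (hp : p.Monic) (hpd : p.natDegree = d) (hpy : Polynomial.aeval y p = 0) (W : ℤ → AddSubgroup L)
    (hW : ∀ i, i ≤ d → ∀ c, ∀ z ∈ W c, p.coeff i * z ∈ W (c + (d - i : ℕ)))
    (m : ℕ) (hm : m < d) : ∀ (c : ℤ) (g : F), (∀ i : ℕ, i < d → co b (d - 1) (g * y ^ i) ∈ W (c + i)) →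
    co b (d - 1 - m) g ∈ W (c + m) := by
  suffices H : ∀ n, m < n → n ≤ d → ∀ (c : ℤ) (g : F), (∀ i : ℕ, i < n → co b (d - 1) (g * y ^ i) ∈ W (c + i)) →
    co b (d - 1 - m) g ∈ W (c + m) from H d hm le_rfl
  induction m with
  | zero =>
    intro n hn hnd c g h
    simpa using h 0 hn
  | succ m ih =>
    intro n hn hnd c g h
    have e : d - 1 - (m + 1) + 1 = d - 1 - m := by omega
    rw [co_rec hb hp hpd hpy _ (by omega), e]
    apply AddSubgroup.add_mem
    · have := ih (by omega) (n - 1) (by omega) (by omega) (c + 1) (y * g) (by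
        intro i hi
        have := h (i + 1) (by omega)
        rw [pow_succ'] at this
        have e2 : y * g * y ^ i = g * (y * y ^ i) := by ring
        rw [e2]; push_cast at this ⊢
        rwa [show c + 1 + i = c + (i + 1) by ring])
      push_cast at this ⊢
      rwa [show c + (m + 1 : ℤ) = c + 1 + m by ring]
    · have := hW (d - 1 - m) (by omega) c _ (by simpa using h 0 (by omega))
      have e3 : d - (d - 1 - m) = m + 1 := by omega
      rwa [e3] at this
theorem tau_surj {b : BdF} {y : F} (hb : ∀ i, b i = y ^ (i : ℕ)) {p : Polynomial L}
    (hp : p.Monic) (hpd : p.natDegree = d) (hpy : Polynomial.aeval y p = 0) (l : F →ₗ[L] L) :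
    ∃ u : F, ∀ f, l f = co b (d - 1) (u * f) := by
  have : Module.Finite L F := Module.Finite.of_basis b
  let φ : F →ₗ[L] (F →ₗ[L] L) := (LinearMap.mul L F).compr₂ (co b (d - 1))
  have hinj : Function.Injective φ := by
    rw [injective_iff_map_eq_zero]
    intro u hu
    have h1 : ∀ f, co b (d - 1) (u * f) = 0 := fun f => LinearMap.congr_fun hu f
    have h2 : ∀ m, m < d → co b (d - 1 - m) u ∈ (⊥ : AddSubgroup L) := by
      intro m hm
      refine co_tri hb hp hpd hpy (fun _ => ⊥) (by intro i _ c z hz; rw [AddSubgroup.mem_bot] at hz ⊢; rw [hz, mul_zero]) m hm 0 u ?_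
      intro i _; rw [h1]; exact AddSubgroup.zero_mem _
    rw [co_sum hb u]
    apply Finset.sum_eq_zero
    intro i hi
    have hi' := Finset.mem_range.1 hi
    have := h2 (d - 1 - i) (by omega)
    rw [show d - 1 - (d - 1 - i) = i by omega, AddSubgroup.mem_bot] at this
    rw [this, zero_smul]
  have hsurj : Function.Surjective φ :=
    (LinearMap.injective_iff_surjective_of_finrank_eq_finrank (by
      rw [Module.finrank_linearMap, Module.finrank_self, mul_one])).1 hinj
  obtain ⟨u, hu⟩ := hsurj l
  exact ⟨u, fun f => by rw [← hu]; rfl⟩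
end crv
open Polynomial (X C)
section dua
variable {K L F : Type*} [Field K] [Field L] [Algebra KX L] [IsFractionRing KX L]
  [Field F] [Algebra L F] [Algebra KX F] [IsScalarTower KX L F]
  [Algebra K F] [IsScalarTower K KX F] {d : ℕ}
structure CH (d : ℕ) (vi : VL) (P : KXX) (y : F)
    (b : BdF) : Prop where
  vp : ∀ p : KX, p ≠ 0 → vi (algebraMap _ L p) = exp (p.natDegree : ℤ)
  d1 : 1 ≤ d
  hb : ∀ i, b i = y ^ (i : ℕ)
  hm : P.Monic
  hd : P.natDegree = d
  hc : ∀ i, i ≤ d → (P.coeff i).natDegree + i ≤ d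
  hy : Polynomial.aeval y P = 0
def RR (K : Type*) {L F : Type*} [Field K] [Field L] [Algebra KX L] [Field F] [Algebra L F] {d : ℕ} (b : BdF) : AddSubgroup F where
  carrier := {f | ∀ j, co b j f ∈ (aL).range}
  zero_mem' := fun j => by rw [map_zero]; exact Subring.zero_mem _
  add_mem' := fun h1 h2 j => by rw [map_add]; exact Subring.add_mem _ (h1 j) (h2 j)
  neg_mem' := fun h1 j => by rw [map_neg]; exact Subring.neg_mem _ (h1 j)
def BV {L : Type*} [Field L] (vi : VL) (c : ℤ) : AddSubgroup L where
  carrier := {z | vi z ≤ exp c}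
  zero_mem' := by simp
  add_mem' := by
    intro a b h1 h2
    exact Valuation.map_add_le vi h1 h2
  neg_mem' := fun h1 => by simpa [Valuation.map_neg] using h1
theorem mem_BV {vi : VL} {c : ℤ} {z : L} : z ∈ BV vi c ↔ vi z ≤ exp c := Iff.rfl
def RI {L F : Type*} [Field L] [Field F] [Algebra L F] {d : ℕ} (b : BdF) (vi : VL) (c : ℤ) : AddSubgroup F where
  carrier := {f | ∀ j : ℕ, co b j f ∈ BV vi (c - j)}
  zero_mem' := fun j => by rw [map_zero]; exact AddSubgroup.zero_mem _
  add_mem' := fun h1 h2 j => by rw [map_add]; exact AddSubgroup.add_mem _ (h1 j) (h2 j)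
  neg_mem' := fun h1 j => by rw [map_neg]; exact AddSubgroup.neg_mem _ (h1 j)
theorem mem_RR {b : BdF} {f : F} :
    f ∈ RR K b ↔ ∀ j, co b j f ∈ (aL).range := Iff.rfl
theorem mem_RI {b : BdF} {vi : VL} {c : ℤ} {f : F} :
    f ∈ RI b vi c ↔ ∀ j : ℕ, co b j f ∈ BV vi (c - j) := Iff.rfl
theorem CH.pL {vi : VL} {P : KXX} {y : F}
    {b : BdF} (h : CH d vi P y b) :
    (P.map (aL)).Monic ∧ (P.map (aL)).natDegree = d ∧
    Polynomial.aeval y (P.map (aL)) = 0 := by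
  refine ⟨h.hm.map _, ?_, ?_⟩
  · rw [h.hm.natDegree_map, h.hd]
  · rw [Polynomial.aeval_map_algebraMap, h.hy]
theorem CH.vle {vi : VL} {P : KXX} {y : F}
    {b : BdF} (h : CH d vi P y b) (p : KX) (c : ℤ) (hp : (p.natDegree : ℤ) ≤ c) :
    vi (algebraMap _ L p) ≤ exp c := by
  by_cases h0 : p = 0
  · simp [h0]
  · rw [h.vp p h0, exp_le_exp]; exact hp
theorem CH.vX {vi : VL} {P : KXX} {y : F}
    {b : BdF} (h : CH d vi P y b) : vi (aL X) = exp 1 := by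
  rw [h.vp _ Polynomial.X_ne_zero]; simp
theorem exists_common (I : AddSubgroup F) (hI : ∀ (p : KX), ∀ f ∈ I, p • f ∈ I)
    (hden : ∀ f : F, ∃ p : KX, p ≠ 0 ∧ p • f ∈ I) (g : ℕ → F) (n : ℕ) :
    ∃ e : KX, e ≠ 0 ∧ ∀ j < n, e • g j ∈ I := by
  induction n with
  | zero => exact ⟨1, one_ne_zero, by simp⟩
  | succ n ih =>
    obtain ⟨e, he, h⟩ := ih
    obtain ⟨p, hp, h'⟩ := hden (g n)
    refine ⟨e * p, mul_ne_zero he hp, fun j hj => ?_⟩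
    rcases Nat.lt_succ_iff_lt_or_eq.1 hj with hj | rfl
    · rw [mul_comm, mul_smul]; exact hI _ _ (h j hj)
    · rw [mul_smul]; exact hI _ _ h'
theorem RR_den {b : BdF} (f : F) : ∃ p : KX, p ≠ 0 ∧ p • f ∈ RR K b := by
  classical
  obtain ⟨p, hp⟩ := IsLocalization.exist_integer_multiples_of_finset (nonZeroDivisors KX)
    ((Finset.range d).image fun j => co b j f)
  refine ⟨p, nonZeroDivisors.coe_ne_zero p, fun j => ?_⟩
  rw [← algebraMap_smul L (p : KX) f, map_smul, algebraMap_smul]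
  by_cases hj : j < d
  · exact hp _ (Finset.mem_image_of_mem _ (Finset.mem_range.2 hj))
  · have : co b j f = 0 := by simp [co, hj]
    rw [this, smul_zero]; exact Subring.zero_mem _
theorem approx {vi : VL} {P : KXX} {y : F}
    {b : BdF} (h : CH d vi P y b) (p : KX) (hp : p ≠ 0) (N : ℕ) :
    ∃ s : KX, vi ((aL p)⁻¹ - aL s * (aL X)⁻¹ ^ N) ≤ exp (-(N : ℤ)) := by
  refine ⟨X ^ N / p, ?_⟩
  have hp' : aL p ≠ 0 := by
    rw [Ne, FaithfulSMul.algebraMap_eq_zero_iff]; exact hp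
  have hX' : aL X ≠ 0 := by
    rw [Ne, FaithfulSMul.algebraMap_eq_zero_iff]; exact Polynomial.X_ne_zero
  have hdm := congrArg (aL) (EuclideanDomain.div_add_mod (X ^ N) p)
  rw [map_add, map_mul, map_pow] at hdm
  set xx := aL X with hxx
  have e : (algebraMap _ L p)⁻¹ - algebraMap _ L (X ^ N / p) * xx⁻¹ ^ N =
      algebraMap _ L (X ^ N % p) * (algebraMap _ L p)⁻¹ * xx⁻¹ ^ N := by
    have h1 : xx ^ N * xx⁻¹ ^ N = 1 := by rw [← mul_pow, mul_inv_cancel₀ hX', one_pow]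
    have h2 := mul_inv_cancel₀ hp'
    linear_combination -hdm * (algebraMap _ L p)⁻¹ * xx⁻¹ ^ N - (algebraMap _ L p)⁻¹ * h1
      + algebraMap _ L (X ^ N / p) * xx⁻¹ ^ N * h2
  rw [e, map_mul, map_mul, map_pow, map_inv₀, map_inv₀, h.vX, h.vp p hp]
  have h1 : vi (algebraMap _ L (X ^ N % p)) ≤ exp (p.natDegree : ℤ) := by
    apply h.vle
    have := Polynomial.degree_mod_lt (X ^ N) hp
    exact_mod_cast Polynomial.natDegree_le_natDegree this.le
  calc _ ≤ exp (p.natDegree : ℤ) * (exp (p.natDegree : ℤ))⁻¹ * (exp 1)⁻¹ ^ N := by gcongr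
    _ = exp (-N : ℤ) := by
      rw [mul_inv_cancel₀ exp_ne_zero, one_mul, ← exp_neg, ← exp_nsmul]; simp
theorem duality {vi : VL} {P : KXX} {y : F}
    {b : BdF} (h : CH d vi P y b) (I J : AddSubgroup F)
    (hI : ∀ (p : KX), ∀ f ∈ I, p • f ∈ I) (hIy : ∀ f ∈ I, y * f ∈ I)
    (hden : ∀ f : F, ∃ p : KX, p ≠ 0 ∧ p • f ∈ I)
    (hJ : ∀ z : L, vi z ≤ 1 → ∀ f ∈ J, z • f ∈ J)
    (hJy : ∀ f ∈ J, (aL X)⁻¹ • (y * f) ∈ J)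
    (hJden : ∀ f : F, ∃ N : ℕ, (aL X)⁻¹ ^ N • f ∈ J)
    (hIJ : I ⊔ J ≠ ⊤) :
    ∃ u : F, u ≠ 0 ∧ (∀ f ∈ I, u * f ∈ RR K b) ∧ (∀ f ∈ J, u * f ∈ RI b vi (d - 3)) := by
  have hX' : aL X ≠ 0 := by
    rw [Ne, FaithfulSMul.algebraMap_eq_zero_iff]; exact Polynomial.X_ne_zero
  set w : L := (aL X)⁻¹ with hw
  have vw : ∀ n : ℕ, vi (w ^ n) = exp (-n : ℤ) := by
    intro n; rw [map_pow, hw, map_inv₀, h.vX, ← exp_neg, ← exp_nsmul]; simp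
  have vKle : ∀ c : K, vi (aL (C c)) ≤ 1 := by
    intro c; rw [← exp_zero]; apply h.vle; simp
  have hKs : ∀ (c : K) (f : F), c • f = (C c : KX) • f := by
    intro c f; rw [← Polynomial.algebraMap_eq, algebraMap_smul]
  let M : Submodule K F := { (I ⊔ J) with
    smul_mem' := by
      intro c f hf
      obtain ⟨i, hi, j, hj, rfl⟩ := AddSubgroup.mem_sup.1 hf
      rw [hKs, smul_add]
      refine AddSubgroup.add_mem_sup (hI _ _ hi) ?_
      rw [← algebraMap_smul L]; exact hJ _ (vKle c) _ hj }
  have hM : M < ⊤ := by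
    rw [lt_top_iff_ne_top]
    intro hM
    apply hIJ
    rw [eq_top_iff]
    intro f _
    have : f ∈ M := by rw [hM]; trivial
    exact this
  obtain ⟨ψ, hψ0, hψ⟩ := Submodule.exists_le_ker_of_lt_top M hM
  have ψI : ∀ f ∈ I, ψ f = 0 := fun f hf => hψ (AddSubgroup.mem_sup_left hf : f ∈ I ⊔ J)
  have ψJ : ∀ f ∈ J, ψ f = 0 := fun f hf => hψ (AddSubgroup.mem_sup_right hf : f ∈ I ⊔ J)
  have hJm : ∀ f : F, ∃ N : ℕ, ∀ m, N ≤ m → w ^ m • f ∈ J := by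
    intro f
    obtain ⟨N, hN⟩ := hJden f
    refine ⟨N, fun m hm => ?_⟩
    obtain ⟨k, rfl⟩ := Nat.exists_eq_add_of_le hm
    rw [add_comm, pow_add, mul_smul]
    refine hJ _ ?_ _ hN
    rw [vw, ← exp_zero, exp_le_exp]; omega
  have hex : ∀ f : F, ∃ p : KX, ∀ m, p.coeff m = ψ (w ^ (m + 1) • f) := by
    intro f
    obtain ⟨N, hN⟩ := hJm f
    refine ⟨∑ m ∈ Finset.range N, Polynomial.monomial m (ψ (w ^ (m + 1) • f)), fun m => ?_⟩
    simp only [Polynomial.finset_sum_coeff, Polynomial.coeff_monomial, Finset.sum_ite_eq', Finset.mem_range]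
    split_ifs with hm
    · rfl
    · rw [ψJ _ (hN _ (by omega))]
  choose lam hlam using hex
  have ladd : ∀ f g, lam (f + g) = lam f + lam g := by
    intro f g; ext m; rw [Polynomial.coeff_add, hlam, hlam, hlam, smul_add, map_add]
  have lX : ∀ f ∈ I, lam ((X : KX) • f) = X * lam f := by
    intro f hf
    ext m
    rw [hlam, ← algebraMap_smul L (X : KX) f]
    rcases m with _ | m
    · rw [Polynomial.coeff_X_mul_zero, zero_add, pow_one, smul_smul, hw, inv_mul_cancel₀ hX', one_smul, ψI f hf]
    · rw [Polynomial.coeff_X_mul, hlam, smul_smul, pow_succ, mul_assoc, hw, inv_mul_cancel₀ hX', mul_one]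
  have lC : ∀ (c : K) f, lam ((C c : KX) • f) = C c * lam f := by
    intro c f
    ext m
    rw [hlam, Polynomial.coeff_C_mul, hlam, ← hKs, ← smul_eq_mul, ← map_smul]
    congr 1
    rw [hKs, hKs, smul_comm]
  have lp : ∀ (p : KX), ∀ f ∈ I, lam (p • f) = p * lam f := by
    intro p f hf
    induction p using Polynomial.induction_on with
    | C a => exact lC a f
    | add p q hp hq => rw [add_smul, ladd, hp, hq, add_mul]
    | monomial n a ih =>
      rw [pow_succ, ← mul_assoc, mul_comm, mul_smul, lX _ (hI _ _ hf), ih]; ring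
  have lJ : ∀ f ∈ J, ∀ p : KX, p ≠ 0 → vi (algebraMap _ L (lam (p • f))) ≤ exp (p.natDegree - 2 : ℤ) := by
    intro f hf p hp
    have hz : ∀ m : ℕ, p.natDegree ≤ m + 1 → (lam (p • f)).coeff m = 0 := by
      intro m hm
      rw [hlam, ← algebraMap_smul L p f, smul_smul]
      apply ψJ
      apply hJ _ _ _ hf
      rw [map_mul, vw, h.vp p hp, ← exp_add, ← exp_zero, exp_le_exp]; push_cast; omega
    by_cases h0 : lam (p • f) = 0
    · rw [h0, map_zero, map_zero]; exact zero_le'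
    · apply h.vle
      by_contra hcon
      have := hz (lam (p • f)).natDegree (by omega)
      rw [Polynomial.coeff_natDegree, Polynomial.leadingCoeff_eq_zero] at this
      exact h0 this
  obtain ⟨e, he, hey⟩ := exists_common I hI hden (fun j => y ^ j) d
  have he' : aL e ≠ 0 := by
    rw [Ne, FaithfulSMul.algebraMap_eq_zero_iff]; exact he
  let l : F →ₗ[L] L := b.constr L fun j : Fin d => algebraMap _ L (lam (e • y ^ (j : ℕ))) / algebraMap _ L e
  have lb : ∀ j, j < d → algebraMap _ L e * l (y ^ j) = algebraMap _ L (lam (e • y ^ j)) := by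
    intro j hj
    have : y ^ j = b ⟨j, hj⟩ := (h.hb ⟨j, hj⟩).symm
    rw [this]
    simp only [l, Module.Basis.constr_basis]
    rw [mul_div_cancel₀ _ he', h.hb]
  have lRR : ∀ f ∈ RR K b, algebraMap _ L e * l f = algebraMap _ L (lam (e • f)) := by
    intro f hf
    choose s hs using hf
    have h1 : f = ∑ i ∈ Finset.range d, s i • y ^ i := by
      conv_lhs => rw [co_sum h.hb f]
      apply Finset.sum_congr rfl
      intro i _
      rw [← hs, algebraMap_smul]
    have lsum : ∀ (t : Finset ℕ) (g : ℕ → F), lam (∑ i ∈ t, g i) = ∑ i ∈ t, lam (g i) := by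
      intro t g
      exact map_sum (AddMonoidHom.mk' lam ladd) g t
    rw [h1, map_sum, Finset.smul_sum, lsum, map_sum, Finset.mul_sum]
    apply Finset.sum_congr rfl
    intro i hi
    have hi' := Finset.mem_range.1 hi
    rw [smul_comm, lp _ _ (hey i hi'), ← algebraMap_smul L (s i) (y ^ i), map_smul, smul_eq_mul, map_mul, ← lb i hi']
    ring
  have lI : ∀ f ∈ I, l f = algebraMap _ L (lam f) := by
    intro f hf
    obtain ⟨p, hp, hpf⟩ := RR_den (K := K) (b := b) f
    have h1 := lRR _ hpf
    have hp' : aL p ≠ 0 := by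
      rw [Ne, FaithfulSMul.algebraMap_eq_zero_iff]; exact hp
    rw [smul_smul, lp _ _ hf, ← algebraMap_smul L p f, map_smul, smul_eq_mul, map_mul, map_mul, ← mul_assoc] at h1
    exact mul_left_cancel₀ (mul_ne_zero he' hp') h1
  have lJv : ∀ f ∈ J, vi (l f) ≤ exp (-2) := by
    intro f hf
    obtain ⟨p, hp, hpf⟩ := hden f
    have h1 := lJ f hf p hp
    rw [← lI _ hpf, ← algebraMap_smul L p f, map_smul, smul_eq_mul, map_mul, h.vp p hp] at h1
    rw [show (p.natDegree - 2 : ℤ) = p.natDegree + (-2) by ring, exp_add] at h1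
    exact le_of_mul_le_mul_left h1 exp_pos
  have hl0 : l ≠ 0 := by
    intro hl
    apply hψ0
    ext g
    obtain ⟨p, hp, hpg⟩ := hden g
    have hp' : aL p ≠ 0 := by
      rw [Ne, FaithfulSMul.algebraMap_eq_zero_iff]; exact hp
    obtain ⟨N, hN⟩ := hJm (p • g)
    obtain ⟨s, hs⟩ := approx h p hp (N + 1)
    rw [← hw] at hs
    have hg : g = ((algebraMap _ L p)⁻¹ - algebraMap _ L s * w ^ (N + 1)) • (p • g) + w ^ (N + 1) • (s • p • g) := by
      rw [sub_smul, mul_smul, smul_comm (algebraMap _ L s), algebraMap_smul, sub_add_cancel, ← algebraMap_smul L p g, smul_smul,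
        inv_mul_cancel₀ hp', one_smul]
    rw [hg, map_add]
    have h1 : ψ (w ^ (N + 1) • (s • p • g)) = 0 := by
      rw [← hlam]
      have : aL (lam (s • p • g)) = 0 := by rw [← lI _ (hI _ _ hpg), hl]; rfl
      rw [FaithfulSMul.algebraMap_eq_zero_iff] at this
      rw [this, Polynomial.coeff_zero]
    rw [h1, add_zero]
    set z := (algebraMap _ L p)⁻¹ - algebraMap _ L s * w ^ (N + 1)
    have h2 : z • p • g = (z * (aL X) ^ (N + 1)) • (w ^ (N + 1) • p • g) := by
      rw [smul_smul, mul_assoc, ← mul_pow, hw, mul_inv_cancel₀ hX', one_pow, mul_one]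
    rw [h2]
    apply ψJ
    apply hJ _ _ _ (hN _ (by omega))
    rw [map_mul, map_pow, h.vX]
    calc _ ≤ exp (-(N + 1 : ℕ) : ℤ) * exp 1 ^ (N + 1) := by gcongr
      _ = 1 := by rw [← exp_nsmul, ← exp_add]; simp
  obtain ⟨hp1, hp2, hp3⟩ := h.pL
  obtain ⟨u, hu⟩ := tau_surj h.hb hp1 hp2 hp3 l
  refine ⟨u, ?_, ?_, ?_⟩
  · rintro rfl
    apply hl0
    ext f; rw [hu]; simp
  · intro f hf j
    by_cases hj : j < d
    · have := co_tri h.hb hp1 hp2 hp3 (fun _ => (aL).range.toAddSubgroup) (by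
        intro i _ c z hz
        rw [Polynomial.coeff_map]
        exact Subring.mul_mem _ ⟨_, rfl⟩ hz) (d - 1 - j) (by omega) 0 (u * f) (by
          intro i _
          rw [mul_assoc, ← hu]
          have : f * y ^ i ∈ I := by
            clear * - hf hIy
            induction i with
            | zero => simpa using hf
            | succ i ih => rw [pow_succ, ← mul_assoc, mul_comm]; exact hIy _ ih
          rw [lI _ this]
          exact ⟨_, rfl⟩)
      rw [show d - 1 - (d - 1 - j) = j by omega] at this
      exact this
    · have : co b j (u * f) = 0 := by simp [co, hj]
      rw [this]; exact Subring.zero_mem _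
  · intro f hf j
    by_cases hj : j < d
    · have := co_tri h.hb hp1 hp2 hp3 (BV vi) (by
        intro i hi c z hz
        rw [Polynomial.coeff_map, mem_BV, map_mul, add_comm, exp_add]
        rw [mem_BV] at hz
        have h1 : vi (algebraMap _ L (P.coeff i)) ≤ exp ((d - i : ℕ) : ℤ) := by
          apply h.vle; have := h.hc i hi; omega
        gcongr) (d - 1 - j) (by omega) (-2) (u * f) (by
          intro i _
          rw [mul_assoc, ← hu]
          have : w ^ i • (f * y ^ i) ∈ J := by
            clear * - hf hJy
            induction i with
            | zero => simpa using hf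
            | succ i ih =>
              have := hJy _ ih
              convert this using 1
              rw [pow_succ', mul_smul, mul_smul_comm, pow_succ]; ring_nf
          have h1 := lJv _ this
          rw [map_smul, smul_eq_mul, map_mul, vw] at h1
          rw [mem_BV]
          have h2 : exp (i : ℤ) * (exp (-i : ℤ) * vi (l (f * y ^ i))) ≤ exp (i : ℤ) * exp (-2) := by gcongr
          rw [← mul_assoc, ← exp_add, add_neg_cancel, exp_zero, one_mul, ← exp_add] at h2
          rwa [add_comm])
      rw [show d - 1 - (d - 1 - j) = j by omega] at this
      convert this using 2
      omega
    · have : co b j (u * f) = 0 := by simp [co, hj]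
      rw [this]; exact AddSubgroup.zero_mem _
end dua
open Polynomial (X C)
section latt
variable {B F : Type*} [CommRing B] [IsDedekindDomain B] [Field F] [Algebra B F] [IsFractionRing B F]
theorem mem_Mlat_zero {f : F} : f ∈ Mlat (dval B F) (0 : HOS B →₀ ℤ) ↔ f ∈ (algebraMap B F).range := by
  constructor
  · intro h
    refine HeightOneSpectrum.mem_integers_of_valuation_le_one F f fun P => ?_
    have := h P
    simpa [dval] using this
  · rintro ⟨z, rfl⟩ P
    simpa [dval] using HeightOneSpectrum.valuation_le_one P z
theorem smul_Mlat {D : HOS B → ℤ} {f z : F} (hz : z ∈ (algebraMap B F).range)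
    (hf : f ∈ Mlat (dval B F) D) : z * f ∈ Mlat (dval B F) D := by
  intro P
  rw [map_mul]
  have h1 := mem_Mlat_zero.2 hz P
  calc _ ≤ exp 0 * exp (D P) := mul_le_mul' h1 (hf P)
    _ = _ := by simp
theorem Mlat_inf (D D' : HOS B →₀ ℤ) :
    Mlat (dval B F) (D ⊓ D' : HOS B →₀ ℤ) = Mlat (dval B F) D ⊓ Mlat (dval B F) D' := by
  ext f
  rw [AddSubgroup.mem_inf, mem_Mlat, mem_Mlat, mem_Mlat, ← forall_and]
  refine forall_congr' fun P => ?_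
  rw [Finsupp.inf_apply]
  rcases le_total (D P) (D' P) with h | h
  · rw [inf_eq_left.2 h]; exact ⟨fun h1 => ⟨h1, h1.trans (exp_le_exp.2 h)⟩, fun h1 => h1.1⟩
  · rw [inf_eq_right.2 h]; exact ⟨fun h1 => ⟨h1.trans (exp_le_exp.2 h), h1⟩, fun h1 => h1.2⟩
theorem deg_le {Q : ℕ} (hQ : 1 < Q) {dg : HOS B → ℕ}
    (hdg : ∀ P : HOS B, Nat.card (B ⧸ P.asIdeal) = Q ^ dg P)
    (D : HOS B →₀ ℤ) (H : AddSubgroup F) (h1 : Mlat (dval B F) D ≤ H)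
    (h2 : H ≤ Mlat (dval B F) (0 : HOS B →₀ ℤ)) (δ : ℕ)
    (hδ : Q ^ δ ≤ H.relIndex (Mlat (dval B F) (0 : HOS B →₀ ℤ))) :
    dgr dg D + δ ≤ 0 := by
  have e : Mlat (dval B F) (D ⊓ 0 : HOS B →₀ ℤ) = Mlat (dval B F) D := by
    rw [Mlat_inf, inf_eq_left]; exact h1.trans h2
  have i1 := lat_index (F := F) hdg (D ⊓ 0) D inf_le_left
  rw [e, AddSubgroup.relIndex_self] at i1
  have i2 := lat_index (F := F) hdg (D ⊓ 0) 0 inf_le_right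
  rw [e, ← AddSubgroup.relIndex_mul_relIndex _ _ _ h1 h2] at i2
  have m1 := dgr_mono dg (inf_le_left : D ⊓ 0 ≤ D)
  have j1 : (dgr dg D - dgr dg (D ⊓ 0)).toNat = 0 := by
    by_contra hne
    have := Nat.one_lt_pow hne hQ
    omega
  have hpos : 0 < Q ^ (dgr dg 0 - dgr dg (D ⊓ 0)).toNat := by positivity
  have hne : (Mlat (dval B F) D).relIndex H ≠ 0 := by
    intro h0; rw [h0, zero_mul] at i2; omega
  have : Q ^ δ ≤ Q ^ (dgr dg 0 - dgr dg (D ⊓ 0)).toNat := by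
    rw [← i2]; exact hδ.trans (Nat.le_mul_of_pos_left _ (Nat.pos_of_ne_zero hne))
  have := (Nat.pow_le_pow_iff_right hQ).1 this
  have m2 := dgr_mono dg (inf_le_right : D ⊓ 0 ≤ 0)
  rw [dgr_zero] at *
  omega
end latt
section main7
variable {K L F O O' : Type*} [Field K] [Field L] [Algebra KX L] [IsFractionRing KX L]
  [Field F] [Algebra L F] [Algebra KX F] [IsScalarTower KX L F]
  [Algebra K F] [IsScalarTower K KX F] {d : ℕ}
  [CommRing O] [IsDedekindDomain O] [Algebra O F] [IsFractionRing O F]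
  [CommRing O'] [IsDedekindDomain O'] [Algebra O' F] [IsFractionRing O' F]
structure GH (Q d : ℕ) (vi : VL) (P : KXX) (y : F)
    (b : BdF) (O O' : Type*) [CommRing O] [IsDedekindDomain O] [Algebra O F] [IsFractionRing O F]
    [CommRing O'] [IsDedekindDomain O'] [Algebra O' F] [IsFractionRing O' F]
    (d₁ : HOS O → ℕ) (d₂ : HOS O' → ℕ) (w' : O') : Prop where
  ch : CH d vi P y b
  hQ : 1 < Q
  hd₁ : ∀ P : HOS O, cOP = Q ^ d₁ P
  hd₂ : ∀ P : HOS O', Nat.card (O' ⧸ P.asIdeal) = Q ^ d₂ P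
  o1 : ∀ p : KX, algebraMap _ F p ∈ (algebraMap O F).range
  oy : y ∈ (algebraMap O F).range
  p1 : ∀ z : L, vi z ≤ 1 → algebraMap L F z ∈ (algebraMap O' F).range
  py : (aF X)⁻¹ * y ∈ (algebraMap O' F).range
  int0 : ∀ f ∈ (algebraMap O F).range, aF X * f ∈ (algebraMap O' F).range → f = 0
  e1 : ∃ e : KX, e ≠ 0 ∧ ∀ f ∈ (algebraMap O F).range, e • f ∈ RR K b
  e2 : ∃ N : ℕ, ∀ f ∈ (algebraMap O' F).range, (aF X)⁻¹ ^ N * f ∈ RI b vi 0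
  hw : algebraMap O' F w' = (aF X)⁻¹
  cw : Nat.card (O' ⧸ Ideal.span {w'}) = Q ^ d
variable {Q : ℕ} {vi : VL} {P : KXX} {y : F}
    {b : BdF} {d₁ : HOS O → ℕ} {d₂ : HOS O' → ℕ} {w' : O'}
theorem GH.hX (_h : GHw) : aF X ≠ 0 := by
  rw [IsScalarTower.algebraMap_apply KX L F, Ne, map_eq_zero, FaithfulSMul.algebraMap_eq_zero_iff]
  exact Polynomial.X_ne_zero
theorem GH.RRo (h : GHw) : RR K b ≤ Mlat (dval O F) (0 : HOS O →₀ ℤ) := by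
  intro f hf
  rw [mem_Mlat_zero, co_sum h.ch.hb f]
  refine Subring.sum_mem _ fun i _ => ?_
  obtain ⟨s, hs⟩ := hf i
  rw [← hs, algebraMap_smul, Algebra.smul_def]
  exact Subring.mul_mem _ (h.o1 _) (Subring.pow_mem _ h.oy _)
theorem GH.RIo (h : GHw) : RI b vi 0 ≤ Mlat (dval O' F) (0 : HOS O' →₀ ℤ) := by
  intro f hf
  have hX := h.hX
  rw [mem_Mlat_zero, co_sum h.ch.hb f]
  refine Subring.sum_mem _ fun i _ => ?_
  have e : co b i f • y ^ i = algebraMap L F (aL X ^ i * co b i f) * ((aF X)⁻¹ * y) ^ i := by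
    rw [Algebra.smul_def, map_mul, map_pow, mul_pow, ← IsScalarTower.algebraMap_apply]
    have : aF X ^ i * (aF X)⁻¹ ^ i = 1 := by
      rw [← mul_pow, mul_inv_cancel₀ hX, one_pow]
    linear_combination (- algebraMap L F (co b i f) * y ^ i) * this
  rw [e]
  refine Subring.mul_mem _ (h.p1 _ ?_) (Subring.pow_mem _ h.py _)
  rw [map_mul, map_pow, h.ch.vX, ← exp_nsmul]
  calc _ ≤ exp (i • 1) * exp (0 - i : ℤ) := mul_le_mul' le_rfl (hf i)
    _ = 1 := by rw [← exp_add]; simp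
theorem RI_smul (h : CH d vi P y b) (c m : ℤ) (f : F) : (aF X) ^ m * f ∈ RI b vi (c + m) ↔ f ∈ RI b vi c := by
  rw [mem_RI, mem_RI]
  refine forall_congr' fun j => ?_
  have : aF X ^ m * f = (aL X ^ m) • f := by
    rw [Algebra.smul_def, map_zpow₀, ← IsScalarTower.algebraMap_apply]
  rw [this, map_smul, smul_eq_mul, mem_BV, mem_BV, map_mul, map_zpow₀, h.vX, ← exp_zsmul,
    show c + m - j = m • 1 + (c - j) by simp; ring, exp_add]
  exact mul_le_mul_iff_right₀ exp_pos
theorem RI_den (h : CH d vi P y b) (f : F) : ∃ N : ℕ, (aF X)⁻¹ ^ N * f ∈ RI b vi 0 := by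
  have : ∀ m : ℕ, ∃ N : ℕ, ∀ j : ℕ, j < m → co b j f ∈ BV vi (N - j) := by
    intro m
    induction m with
    | zero => exact ⟨0, by simp⟩
    | succ m ih =>
      obtain ⟨N, hN⟩ := ih
      refine ⟨max N (m + (log (vi (co b m f))).toNat), fun j hj => ?_⟩
      rcases Nat.lt_succ_iff_lt_or_eq.1 hj with hj | rfl
      · refine (hN j hj).trans (exp_le_exp.2 ?_)
        push_cast; have := le_max_left (N : ℤ) (m + ↑(log (vi (co b m f))).toNat); omega
      · rw [mem_BV]
        by_cases h0 : co b j f = 0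
        · simp [h0]
        · refine (exp_log ((Valuation.ne_zero_iff vi).2 h0)).ge.trans (exp_le_exp.2 ?_)
          push_cast; have := le_max_right (N : ℤ) (j + ↑(log (vi (co b j f))).toNat)
          have h2 := Int.self_le_toNat (log (vi (co b j f)))
          push_cast at *
          omega
  obtain ⟨N, hN⟩ := this d
  refine ⟨N, ?_⟩
  have e : (aF X)⁻¹ ^ N = (aF X) ^ (-N : ℤ) := by simp
  rw [e, show (0 : ℤ) = N + (-N) by ring, RI_smul h]
  intro j
  by_cases hj : j < d
  · exact hN j hj
  · have : co b j f = 0 := by simp [co, hj]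
    rw [this]; exact AddSubgroup.zero_mem _
theorem GH.dua (h : GHw) (D : HOS O ⊕ HOS O' →₀ ℤ)
    (hD : ¬ Van O O' F D) : ∃ u : F, u ≠ 0 ∧ (∀ f ∈ Mlat (dval O F) (dl D), u * f ∈ RR K b) ∧
      (∀ f ∈ Mlat (dval O' F) (drt D), u * f ∈ RI b vi (d - 3)) := by
  have eX : (algebraMap L F) ((aL) X)⁻¹ = (aF X)⁻¹ := by
    rw [map_inv₀, ← IsScalarTower.algebraMap_apply]
  refine duality h.ch _ _ ?_ ?_ ?_ ?_ ?_ ?_ hD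
  · intro p f hf
    rw [Algebra.smul_def]; exact smul_Mlat (h.o1 p) hf
  · intro f hf; exact smul_Mlat h.oy hf
  · intro f
    obtain ⟨c, hc, hcD⟩ := exists_small (F := F) (dl D)
    obtain ⟨p, hp, hpf⟩ := RR_den (K := K) (b := b) (f / c)
    refine ⟨p, hp, ?_⟩
    have := smul_Mlat (mem_Mlat_zero.1 (h.RRo hpf)) (mem_Mlat.2 hcD)
    rwa [smul_mul_assoc, div_mul_cancel₀ _ hc] at this
  · intro z hz f hf
    rw [Algebra.smul_def]; exact smul_Mlat (h.p1 z hz) hf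
  · intro f hf
    rw [Algebra.smul_def, eX, ← mul_assoc]
    exact smul_Mlat h.py hf
  · intro f
    obtain ⟨c, hc, hcD⟩ := exists_small (F := F) (drt D)
    obtain ⟨N, hN⟩ := RI_den h.ch (f / c)
    refine ⟨N, ?_⟩
    have := smul_Mlat (mem_Mlat_zero.1 (h.RIo hN)) (mem_Mlat.2 hcD)
    rwa [mul_assoc, div_mul_cancel₀ _ hc, ← eX, ← map_pow, ← Algebra.smul_def] at this
theorem GH.xE (h : GHw) (m : ℤ) (D : HOS O' →₀ ℤ) (f : F) :
    aF X ^ m * f ∈ Mlat (dval O' F) (D + m • dv (dval O' F) (aF X) : HOS O' →₀ ℤ) ↔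
      f ∈ Mlat (dval O' F) D := by
  rw [mem_Mlat, mem_Mlat]
  refine forall_congr' fun P => ?_
  rw [map_mul, map_zpow₀, ← exp_dv (finSup_dval O' F) h.hX, ← exp_zsmul, Finsupp.add_apply, add_comm, exp_add]
  exact mul_le_mul_iff_right₀ exp_pos
theorem GH.degE (h : GHw) : dgr d₂ (dv (dval O' F) (aF X)) = d := by
  set E := dv (dval O' F) (aF X) with hE
  have hX := h.hX
  have hmem : (aF X)⁻¹ ∈ Mlat (dval O' F) (0 : HOS O' →₀ ℤ) :=
    mem_Mlat_zero.2 ⟨w', h.hw⟩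
  rw [mem_Mlat_dv (finSup_dval O' F) (inv_ne_zero hX), dv_inv (finSup_dval O' F) hX, ← hE] at hmem
  have i1 := lat_index (F := F) h.hd₂ (-E) 0 hmem
  have hinj : Function.Injective (algebraMap O' F) := FaithfulSMul.algebraMap_injective O' F
  have e1 : (Ideal.span {w'}).toAddSubgroup = (Mlat (dval O' F) (-E : HOS O' →₀ ℤ)).comap (algebraMap O' F).toAddMonoidHom := by
    ext z
    change z ∈ Ideal.span {w'} ↔ algebraMap O' F z ∈ Mlat (dval O' F) (-E : HOS O' →₀ ℤ)
    have := h.xE (-1) 0 (aF X * algebraMap O' F z)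
    rw [← mul_assoc, zpow_neg_one, inv_mul_cancel₀ hX, one_mul, zero_add, ← hE, neg_one_zsmul] at this
    rw [this, mem_Mlat_zero, Ideal.mem_span_singleton]
    constructor
    · rintro ⟨c, rfl⟩
      refine ⟨c, ?_⟩
      rw [map_mul, h.hw, ← mul_assoc, mul_inv_cancel₀ hX, one_mul]
    · rintro ⟨c, hc⟩
      refine ⟨c, hinj ?_⟩
      rw [map_mul, h.hw, hc, ← mul_assoc, inv_mul_cancel₀ hX, one_mul]
  have e2 : Mlat (dval O' F) (0 : HOS O' →₀ ℤ) = (algebraMap O' F).toAddMonoidHom.range := by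
    ext z; rw [mem_Mlat_zero]; rfl
  have e3 : (Ideal.span {w'}).toAddSubgroup.index = Q ^ d := h.cw
  rw [e2, ← AddSubgroup.index_comap, ← e1, e3, dgr_zero, dgr_neg] at i1
  have := Nat.pow_right_injective h.hQ i1
  have m := dgr_mono d₂ hmem
  rw [dgr_zero, dgr_neg] at m
  omega
theorem GH.exVan (h : GHw) : ∃ D, Van O O' F D := by
  set E := dv (dval O' F) (aF X) with hE
  refine ⟨Finsupp.mapDomain Sum.inr ((d - 2 : ℤ) • E), ?_⟩
  set D := Finsupp.mapDomain Sum.inr ((d - 2 : ℤ) • E) with hD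
  have h1 : dl D = (0 : HOS O →₀ ℤ) := by
    ext P; rw [dl_apply, hD, Finsupp.mapDomain_notin_range _ _ (by simp)]; rfl
  have h2 : drt D = (d - 2 : ℤ) • E := by
    ext P; rw [drt_apply, hD, Finsupp.mapDomain_apply Sum.inr_injective]
  by_contra hV
  obtain ⟨u, hu, hu1, hu2⟩ := h.dua D hV
  have a1 := hu1 1 (by rw [h1, mem_Mlat_zero]; exact Subring.one_mem _)
  rw [mul_one] at a1
  have a2 := hu2 (aF X ^ (d - 2 : ℤ)) (by
    have := (h.xE (d - 2) 0 1).2 (mem_Mlat_zero.2 (Subring.one_mem _))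
    rwa [mul_one, zero_add, ← hE, ← h2] at this)
  rw [show (d : ℤ) - 2 = 1 + (d - 3) by ring, zpow_add₀ h.hX, zpow_one, ← mul_assoc, mul_comm] at a2
  replace a2 := (RI_smul h.ch 0 (d - 3) _).1 (by rw [zero_add]; exact a2)
  rw [mul_comm] at a2
  apply hu
  exact h.int0 u (mem_Mlat_zero.1 (h.RRo a1)) (mem_Mlat_zero.1 (h.RIo a2))
theorem GH.fin0 (h : GHw) : Finite (Mlat (tval O O' F) (0 : _ →₀ ℤ)) := by
  set E := dv (dval O' F) (aF X) with hE
  have hX := h.hX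
  have e1 : Mlat (tval O O' F) (0 : _ →₀ ℤ) = Mlat (dval O F) (0 : HOS O →₀ ℤ) ⊓ Mlat (dval O' F) (0 : HOS O' →₀ ℤ) :=
    Mlat_tval 0
  have hmem : (aF X)⁻¹ ∈ Mlat (dval O' F) (0 : HOS O' →₀ ℤ) :=
    mem_Mlat_zero.2 ⟨w', h.hw⟩
  rw [mem_Mlat_dv (finSup_dval O' F) (inv_ne_zero hX), dv_inv (finSup_dval O' F) hX, ← hE] at hmem
  have i1 := lat_index (F := F) h.hd₂ (-E) 0 hmem
  have hne : (Mlat (dval O' F) (-E : HOS O' →₀ ℤ)).relIndex (Mlat (dval O' F) (0 : HOS O' →₀ ℤ)) ≠ 0 := by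
    rw [i1]; have := h.hQ; positivity
  have hne2 : (Mlat (dval O' F) (-E : HOS O' →₀ ℤ)).relIndex (Mlat (tval O O' F) (0 : _ →₀ ℤ)) ≠ 0 := by
    intro h0
    exact hne (AddSubgroup.relIndex_eq_zero_of_le_right (by rw [e1]; exact inf_le_right) h0)
  have hbot : (Mlat (dval O' F) (-E : HOS O' →₀ ℤ)) ⊓ (Mlat (tval O O' F) (0 : _ →₀ ℤ)) = ⊥ := by
    rw [eq_bot_iff]
    rintro f ⟨h1, h2⟩
    rw [e1] at h2
    refine h.int0 f (mem_Mlat_zero.1 h2.1) (mem_Mlat_zero.1 ?_)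
    have := h.xE 1 (-E) f
    rw [← hE, one_zsmul, neg_add_cancel, zpow_one] at this
    exact this.2 h1
  rw [← AddSubgroup.inf_relIndex_right, hbot, AddSubgroup.relIndex_bot_left] at hne2
  exact Nat.finite_of_card_ne_zero hne2
theorem GH.prod (h : GHw) (u : F) (hu : u ≠ 0) :
    dgr sdd (dv (tval O O' F) u) = 0 :=
  prodFormula h.hQ h.hd₁ h.hd₂ h.fin0 h.exVan u hu
noncomputable def del1 (K : Type*) {L F : Type*} [Field K] [Field L] [Algebra KX L] [Field F] [Algebra L F] {d : ℕ}
    (b : BdF) (O : Type*) [CommRing O] [IsDedekindDomain O] [Algebra O F] [IsFractionRing O F] (Q : ℕ) : ℕ :=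
  Nat.log Q ((RR K b).relIndex (Mlat (dval O F) (0 : HOS O →₀ ℤ)))
noncomputable def del2 {L F : Type*} [Field L] [Field F] [Algebra L F] {d : ℕ}
    (b : BdF) (vi : VL) (O : Type*) [CommRing O] [IsDedekindDomain O] [Algebra O F] [IsFractionRing O F] (Q : ℕ) : ℕ :=
  Nat.log Q ((RI b vi 0).relIndex (Mlat (dval O F) (0 : HOS O →₀ ℤ)))
theorem GH.idx1 (h : GHw) : (RR K b).relIndex (Mlat (dval O F) (0 : HOS O →₀ ℤ)) ≠ 0 := by
  obtain ⟨e, he, h1⟩ := h.e1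
  have he' : aF e ≠ 0 := by
    rw [IsScalarTower.algebraMap_apply KX L F, Ne, map_eq_zero, FaithfulSMul.algebraMap_eq_zero_iff]
    exact he
  set E := dv (dval O F) (aF e)
  have hle : E ≤ 0 := by
    rw [← mem_Mlat_dv (finSup_dval O F) he', mem_Mlat_zero]; exact h.o1 e
  have i1 := lat_index (F := F) h.hd₁ E 0 hle
  have hs : Mlat (dval O F) E ≤ RR K b := by
    intro f hf
    have := mul_mem_Mlat (finSup_dval O F) he' 0 ((aF e)⁻¹ * f)
    rw [zero_add, mul_inv_cancel_left₀ he'] at this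
    have := h1 _ (mem_Mlat_zero.1 (this.1 hf))
    rwa [Algebra.smul_def, mul_inv_cancel_left₀ he'] at this
  intro h0
  have := AddSubgroup.relIndex_mul_relIndex _ _ _ hs h.RRo
  rw [h0, mul_zero, i1] at this
  have hQ := h.hQ
  have : 0 < Q ^ (dgr d₁ 0 - dgr d₁ E).toNat := by positivity
  omega
theorem GH.idx2 (h : GHw) : (RI b vi 0).relIndex (Mlat (dval O' F) (0 : HOS O' →₀ ℤ)) ≠ 0 := by
  obtain ⟨N, h1⟩ := h.e2
  have hX := h.hX
  have he' : (aF X)⁻¹ ^ N ≠ 0 := pow_ne_zero _ (inv_ne_zero hX)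
  set E := dv (dval O' F) ((aF X)⁻¹ ^ N)
  have hle : E ≤ 0 := by
    rw [← mem_Mlat_dv (finSup_dval O' F) he', mem_Mlat_zero, ← h.hw]; exact ⟨w' ^ N, map_pow _ _ _⟩
  have i1 := lat_index (F := F) h.hd₂ E 0 hle
  have hs : Mlat (dval O' F) E ≤ RI b vi 0 := by
    intro f hf
    have := mul_mem_Mlat (finSup_dval O' F) he' 0 (((aF X)⁻¹ ^ N)⁻¹ * f)
    rw [zero_add, mul_inv_cancel_left₀ he'] at this
    have := h1 _ (mem_Mlat_zero.1 (this.1 hf))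
    rwa [mul_inv_cancel_left₀ he'] at this
  intro h0
  have := AddSubgroup.relIndex_mul_relIndex _ _ _ hs h.RIo
  rw [h0, mul_zero, i1] at this
  have hQ := h.hQ
  have : 0 < Q ^ (dgr d₂ 0 - dgr d₂ E).toNat := by positivity
  omega
theorem GH.hdual (h : GHw) (D : HOS O ⊕ HOS O' →₀ ℤ)
    (hD : ¬ Van O O' F D) :
    dgr sdd D < (d : ℤ) * (d - 3) - (del1 K b O Q + del2 b vi O' Q : ℕ) + 1 := by
  obtain ⟨u, hu, hu1, hu2⟩ := h.dua D hD
  set E := dv (dval O' F) (aF X) with hE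
  set D' := D + dv (tval O O' F) u with hD'
  have hdeg : dgr sdd D = dgr sdd D' := by
    rw [hD', dgr_add, h.prod u hu, add_zero]
  have l1 : ∀ f ∈ Mlat (dval O F) (dl D'), f ∈ RR K b := by
    intro f hf
    have := hu1 (u⁻¹ * f) (by
      intro P
      have h1 := hf P
      rw [dl_apply, hD', Finsupp.add_apply, exp_add, exp_dv finSup_tval hu] at h1
      rw [map_mul, map_inv₀, dl_apply]
      have h0 : dval O F P u ≠ 0 := (Valuation.ne_zero_iff _).2 hu
      rw [inv_mul_le_iff₀ (zero_lt_iff.2 h0), mul_comm]; exact h1)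
    rwa [mul_inv_cancel_left₀ hu] at this
  have l2 : ∀ f ∈ Mlat (dval O' F) (drt D'), f ∈ RI b vi (d - 3) := by
    intro f hf
    have := hu2 (u⁻¹ * f) (by
      intro P
      have h1 := hf P
      rw [drt_apply, hD', Finsupp.add_apply, exp_add, exp_dv finSup_tval hu] at h1
      rw [map_mul, map_inv₀, drt_apply]
      have h0 : dval O' F P u ≠ 0 := (Valuation.ne_zero_iff _).2 hu
      rw [inv_mul_le_iff₀ (zero_lt_iff.2 h0), mul_comm]; exact h1)
    rwa [mul_inv_cancel_left₀ hu] at this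
  have d1 := deg_le h.hQ h.hd₁ (dl D') (RR K b) l1 h.RRo (del1 K b O Q) (Nat.pow_log_le_self _ h.idx1)
  have d2 := deg_le h.hQ h.hd₂ (drt D' - (d - 3 : ℤ) • E) (RI b vi 0) (by
    intro f hf
    rw [← h.xE (d - 3), ← hE, sub_add_cancel] at hf
    have := l2 _ hf
    exact (RI_smul h.ch 0 (d - 3) _).1 (by rw [zero_add]; exact this)) h.RIo (del2 b vi O' Q) (Nat.pow_log_le_self _ h.idx2)
  have hs : ∀ m : ℤ, dgr d₂ (m • E) = m * d := by
    intro m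
    rw [← h.degE, ← hE]
    exact (map_zsmul (AddMonoidHom.mk' (dgr d₂) (dgr_add d₂)) m E).trans (by simp)
  rw [dgr_sub, hs] at d2
  rw [hdeg, dgr_split]
  push_cast
  nlinarith
theorem GH.rr (h : GHw) :
    ∃ κ : ℝ, 0 < κ ∧ ∀ D : HOS O ⊕ HOS O' →₀ ℤ,
      (d : ℤ) * (d - 3) - (del1 K b O Q + del2 b vi O' Q : ℕ) + 1 ≤ dgr sdd D →
      (Nat.card (Mlat (tval O O' F) D) : ℝ) = κ * Qr ^ dgr sdd D :=
  riemannRoch h.hQ h.hd₁ h.hd₂ h.fin0 _ h.exVan h.hdual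
end main7
open Polynomial (X C)
theorem card_pow_log {K S : Type*} [Field K] [Finite K] [CommRing S] [Finite S] (g : K →+* S) :
    Nat.card S = Nat.card K ^ Nat.log cK (Nat.card S) := by
  letI := g.toAlgebra
  have := Module.natCard_eq_pow_finrank (K := K) (V := S)
  rw [this, Nat.log_pow Finite.one_lt_card]
theorem finQ_poly (K : Type*) [Field K] [Finite K] : Ring.HasFiniteQuotients KX where
  finiteQuotient := by
    intro I hI
    obtain ⟨p, hp, hp0⟩ := Submodule.exists_mem_ne_zero_of_ne_bot hI
    have hm : (p * C p.leadingCoeff⁻¹).Monic := Polynomial.monic_mul_leadingCoeff_inv hp0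
    have hmI : p * C p.leadingCoeff⁻¹ ∈ I := I.mul_mem_right _ hp
    have h1 : Module.Finite K (KX ⧸ Ideal.span {p * C p.leadingCoeff⁻¹}) := hm.finite_quotient
    have h2 : Finite (KX ⧸ Ideal.span {p * C p.leadingCoeff⁻¹}) := Module.finite_of_finite K
    exact Finite.of_surjective _ (Ideal.Quotient.factor_surjective
      (S := Ideal.span {p * C p.leadingCoeff⁻¹}) (T := I) ((Ideal.span_singleton_le_iff_mem I).2 hmI))
section inst8
variable {K L A F O O' : Type*} [Field K] [Finite K] [Field L] [Algebra KX L] [IsFractionRing KX L]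
  [CommRing A] [IsDomain A] [IsPrincipalIdealRing A] [Algebra A L] [IsFractionRing A L]
  [Field F] [Algebra L F] [Algebra KX F] [IsScalarTower KX L F]
  [Algebra A F] [IsScalarTower A L F]
  [Algebra K F] [IsScalarTower K KX F] {d : ℕ}
  [CommRing O] [IsDedekindDomain O] [Algebra O F] [IsFractionRing O F]
  [Algebra KX O] [IsScalarTower KX O F] [IsIntegralClosure O KX F] [Module.Finite KX O]
  [CommRing O'] [IsDedekindDomain O'] [Algebra O' F] [IsFractionRing O' F]
  [Algebra A O'] [IsScalarTower A O' F] [IsIntegralClosure O' A F] [Module.Finite A O']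
  {vi : VL} {P : KXX} {y : F} {b : BdF}
theorem resid (vp : ∀ p : KX, p ≠ 0 → vi (algebraMap _ L p) = exp (p.natDegree : ℤ)) (z : L) (hz : vi z ≤ 1) :
    ∃ c : K, vi (z - aL (C c)) ≤ exp (-1) := by
  have hinj : ∀ p : KX, p ≠ 0 → aL p ≠ 0 := by
    intro p hp; rw [Ne, FaithfulSMul.algebraMap_eq_zero_iff]; exact hp
  obtain ⟨p, s, hs, rfl⟩ := IsFractionRing.div_surjective (A := KX) z
  have hs0 : s ≠ 0 := nonZeroDivisors.ne_zero hs
  by_cases hp0 : p = 0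
  · exact ⟨0, by simp [hp0]⟩
  rw [map_div₀, vp p hp0, vp s hs0, div_le_one₀ exp_pos, exp_le_exp] at hz
  have hz' : p.natDegree ≤ s.natDegree := by exact_mod_cast hz
  refine ⟨p.coeff s.natDegree / s.leadingCoeff, ?_⟩
  set c := p.coeff s.natDegree / s.leadingCoeff with hc
  have e : aL p / aL s - aL (C c) =
    aL (p - C c * s) / aL s := by
    have := hinj s hs0
    rw [map_sub, map_mul]; field_simp
  rw [e]
  by_cases h0 : p - C c * s = 0
  · simp [h0]
  rw [map_div₀, vp _ h0, vp s hs0, div_eq_mul_inv, ← exp_neg, ← exp_add, exp_le_exp]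
  have hl : s.leadingCoeff ≠ 0 := Polynomial.leadingCoeff_ne_zero.2 hs0
  have h1 : (p - C c * s).natDegree ≤ s.natDegree := by
    refine (Polynomial.natDegree_sub_le _ _).trans (max_le hz' (Polynomial.natDegree_C_mul_le _ _))
  have h2 : (p - C c * s).coeff s.natDegree = 0 := by
    rw [Polynomial.coeff_sub, Polynomial.coeff_C_mul, Polynomial.coeff_natDegree, hc]; field_simp; ring
  have h3 : (p - C c * s).natDegree ≠ s.natDegree := by
    intro h3
    rw [← h3, Polynomial.coeff_natDegree, Polynomial.leadingCoeff_eq_zero] at h2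
    exact h0 h2
  omega
theorem finQ_inf (h : CH d vi P y b) (hA : ∀ z : L, vi z ≤ 1 ↔ z ∈ (algebraMap A L).range) :
    ∃ w : A, algebraMap A L w = (aL X)⁻¹ ∧ Nat.card (A ⧸ Ideal.span {w}) = Nat.card K ∧
      (Ideal.span {w}).IsMaximal ∧ Ring.HasFiniteQuotients A := by
  have hinj : Function.Injective (algebraMap A L) := FaithfulSMul.algebraMap_injective A L
  have hX' : aL X ≠ 0 := by
    rw [Ne, FaithfulSMul.algebraMap_eq_zero_iff]; exact Polynomial.X_ne_zero
  obtain ⟨w, hw⟩ := (hA (aL X)⁻¹).1 (by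
    rw [map_inv₀, h.vX, ← exp_neg, ← exp_zero, exp_le_exp]; norm_num)
  have hdvd : ∀ z : A, ∀ n : ℕ, vi (algebraMap A L z) ≤ exp (-n : ℤ) ↔ w ^ n ∣ z := by
    intro z n
    have vw : vi (algebraMap A L w ^ n) = exp (-n : ℤ) := by
      rw [hw, map_pow, map_inv₀, h.vX, ← exp_neg, ← exp_nsmul]; simp
    constructor
    · intro hz
      obtain ⟨g, hg⟩ := (hA (algebraMap A L z / (algebraMap A L w ^ n))).1 (by
        rw [map_div₀, vw, div_le_one₀ exp_pos]; exact hz)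
      refine ⟨g, hinj ?_⟩
      rw [map_mul, hg, map_pow, mul_div_cancel₀]
      rw [hw]; exact pow_ne_zero _ (inv_ne_zero hX')
    · rintro ⟨g, rfl⟩
      rw [map_mul, map_mul, map_pow, vw]
      exact mul_le_of_le_one_right' ((hA _).2 ⟨g, rfl⟩)
  have hC : ∀ c : K, ∃ z : A, algebraMap A L z = aL (C c) := by
    intro c
    apply (hA _).1
    rw [← exp_zero]; apply h.vle; simp
  choose j hj using hC
  have hcard : Function.Bijective (fun c => Ideal.Quotient.mk (Ideal.span {w}) (j c)) := by
    constructor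
    · intro c c' hcc
      rw [Ideal.Quotient.eq, Ideal.mem_span_singleton, ← pow_one w, ← hdvd, map_sub, hj, hj, ← map_sub, ← Polynomial.C_sub] at hcc
      by_contra hne
      rw [h.vp _ (Polynomial.C_ne_zero.2 (sub_ne_zero.2 hne)), exp_le_exp] at hcc
      simp at hcc
    · intro z
      obtain ⟨z, rfl⟩ := Ideal.Quotient.mk_surjective z
      obtain ⟨c, hc⟩ := resid h.vp (algebraMap A L z) ((hA _).2 ⟨z, rfl⟩)
      refine ⟨c, ?_⟩
      have : (-1 : ℤ) = -((1 : ℕ) : ℤ) := by simp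
      rw [← hj, ← map_sub, this, hdvd, pow_one] at hc
      exact ((Ideal.Quotient.eq).2 (Ideal.mem_span_singleton.2 hc)).symm
  have hcard' : Nat.card (A ⧸ Ideal.span {w}) = Nat.card K := (Nat.card_eq_of_bijective _ hcard).symm
  have hfin : Finite (A ⧸ Ideal.span {w}) := Finite.of_surjective _ hcard.2
  refine ⟨w, hw, hcard', ?_, ⟨?_⟩⟩
  · rw [Ideal.isMaximal_iff]
    constructor
    · rw [Ideal.mem_span_singleton, ← pow_one w, ← hdvd, map_one, map_one, ← exp_zero, exp_le_exp]; norm_num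
    · intro I z _ hz hzI
      rw [Ideal.mem_span_singleton, ← pow_one w, ← hdvd] at hz
      have hz0 : algebraMap A L z ≠ 0 := by rintro h0; simp [h0] at hz
      have : vi (algebraMap A L z)⁻¹ ≤ 1 := by
        rw [map_inv₀]
        have hv0 := (Valuation.ne_zero_iff vi).2 hz0
        rw [← exp_log hv0, exp_le_exp] at hz
        rw [← exp_log hv0, ← exp_neg, ← exp_zero, exp_le_exp]
        push_cast at hz
        omega
      obtain ⟨g, hg⟩ := (hA _).1 this
      have : z * g = 1 := hinj (by rw [map_mul, hg, map_one, mul_inv_cancel₀ hz0])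
      rw [← this]; exact I.mul_mem_right _ hzI
  · intro I hI
    obtain ⟨z, hz, hz0⟩ := Submodule.exists_mem_ne_zero_of_ne_bot hI
    have hz0' : algebraMap A L z ≠ 0 := by rwa [Ne, FaithfulSMul.algebraMap_eq_zero_iff]
    have hv0 := (Valuation.ne_zero_iff vi).2 hz0'
    set n := (-log (vi (algebraMap A L z))).toNat
    have h1 : z ∣ w ^ n := by
      obtain ⟨g, hg⟩ := (hA (algebraMap A L w ^ n / algebraMap A L z)).1 (by
        rw [hw, map_div₀, map_pow, map_inv₀, h.vX, ← exp_neg, ← exp_nsmul, div_le_one₀ (zero_lt_iff.2 hv0)]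
        refine le_trans ?_ (exp_log hv0).le
        rw [exp_le_exp]
        simp only [nsmul_eq_mul, n]
        have := Int.self_le_toNat (-log (vi (algebraMap A L z)))
        omega)
      exact ⟨g, hinj (by rw [map_mul, hg, map_pow, mul_div_cancel₀ _ hz0'])⟩
    have h2 : Ideal.span {w} ^ n ≤ I := by
      rw [Ideal.span_singleton_pow, Ideal.span_singleton_le_iff_mem]
      exact I.mem_of_dvd h1 hz
    have : Finite (A ⧸ Ideal.span {w} ^ n) := Ideal.finite_quotient_pow (IsNoetherian.noetherian _) n
    exact Finite.of_surjective _ (Ideal.Quotient.factor_surjective h2)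
theorem RR_smul (p : KX) (f : F) (hf : f ∈ RR K b) : p • f ∈ RR K b := by
  intro j
  rw [← algebraMap_smul L p f, map_smul, smul_eq_mul]
  exact Subring.mul_mem _ ⟨_, rfl⟩ (hf j)
theorem RI_smul1 (c : ℤ) (z : L) (hz : vi z ≤ 1) (f : F) (hf : f ∈ RI b vi c) : z • f ∈ RI b vi c := by
  intro j
  rw [map_smul, smul_eq_mul, mem_BV, map_mul]
  exact (mul_le_mul' hz (hf j)).trans (by simp)
theorem mkGH [Algebra.IsSeparable L F] (h : CH d vi P y b) (hA : ∀ z : L, vi z ≤ 1 ↔ z ∈ (algebraMap A L).range) :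
    Ring.HasFiniteQuotients O ∧ Ring.HasFiniteQuotients O' ∧
    ∃ w', GH cK d vi P y b O O' (fun P => Nat.log cK cOP)
      (fun P => Nat.log cK (Nat.card (O' ⧸ P.asIdeal))) w' := by
  obtain ⟨w, hw, hwc, hwm, hfA⟩ := finQ_inf h hA
  have hfK := finQ_poly K
  have hfd : FiniteDimensional L F := Module.Finite.of_basis b
  have hfr : Module.finrank L F = d := by rw [Module.finrank_eq_card_basis b, Fintype.card_fin]
  have hfO : Ring.HasFiniteQuotients O := Ring.HasFiniteQuotients.of_module_finite (R := KX) O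
  have hfO' : Ring.HasFiniteQuotients O' := Ring.HasFiniteQuotients.of_module_finite (R := A) O'
  have hX' : aL X ≠ 0 := by
    rw [Ne, FaithfulSMul.algebraMap_eq_zero_iff]; exact Polynomial.X_ne_zero
  have eX : (algebraMap L F) ((aL) X) = (aF X) := by
    rw [← IsScalarTower.algebraMap_apply]
  have hwF : algebraMap O' F (algebraMap A O' w) = (aF X)⁻¹ := by
    rw [← IsScalarTower.algebraMap_apply A O' F, IsScalarTower.algebraMap_apply A L F, hw, map_inv₀, eX]
  have hC : ∀ c : K, vi (aL (C c)) ≤ 1 := by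
    intro c
    rw [← exp_zero]; apply h.vle; simp
  have hp1 : ∀ z : L, vi z ≤ 1 → algebraMap L F z ∈ (algebraMap O' F).range := by
    intro z hz
    obtain ⟨g, rfl⟩ := (hA z).1 hz
    exact ⟨algebraMap A O' g, by rw [← IsScalarTower.algebraMap_apply A O' F, IsScalarTower.algebraMap_apply A L F]⟩
  refine ⟨hfO, hfO', algebraMap A O' w, ?_⟩
  constructor
  · exact h
  · exact Finite.one_lt_card
  · intro P
    have : Finite (O ⧸ P.asIdeal) := hfO.finiteQuotient P.ne_bot
    exact card_pow_log (((Ideal.Quotient.mk P.asIdeal).comp (algebraMap KX O)).comp C)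
  · intro P
    have : Finite (O' ⧸ P.asIdeal) := hfO'.finiteQuotient P.ne_bot
    let S : Subring F := (algebraMap O' F).range
    let g : K →+* S := ((aF).comp C).codRestrict S (by
      intro c
      have := hp1 _ (hC c)
      rwa [← IsScalarTower.algebraMap_apply] at this)
    let e : O' ≃+* S := RingEquiv.ofBijective (algebraMap O' F).rangeRestrict
      ⟨fun a b hab => FaithfulSMul.algebraMap_injective O' F (congrArg Subtype.val hab), RingHom.rangeRestrict_surjective _⟩
    exact card_pow_log ((Ideal.Quotient.mk P.asIdeal).comp (e.symm.toRingHom.comp g))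
  · intro p
    exact ⟨algebraMap _ O p, (IsScalarTower.algebraMap_apply _ _ _ _).symm⟩
  · have : IsIntegral KX y := ⟨P, h.hm, h.hy⟩
    exact (IsIntegralClosure.isIntegral_iff (A := O)).1 this
  · exact hp1
  · have : IsIntegral A ((aF X)⁻¹ * y) := by
      obtain ⟨hp1, hp2, hp3⟩ := h.pL
      set p := P.map (aL) with hp
      have hl : Polynomial.scaleRoots p (aL X)⁻¹ ∈ Polynomial.lifts (algebraMap A L) := by
        rw [Polynomial.lifts_iff_coeff_lifts]
        intro i
        by_cases hi : i ≤ d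
        · rw [Polynomial.coeff_scaleRoots, hp2, hp, Polynomial.coeff_map]
          apply (hA _).1
          rw [map_mul, map_pow, map_inv₀, h.vX, ← exp_neg, ← exp_nsmul]
          calc _ ≤ exp ((d - i : ℕ) : ℤ) * exp ((d - i) • -1 : ℤ) := by
                gcongr; apply h.vle; have := h.hc i hi; omega
            _ = 1 := by rw [← exp_add]; simp
        · rw [Polynomial.coeff_scaleRoots, Polynomial.coeff_eq_zero_of_natDegree_lt (by omega), zero_mul]
          exact ⟨0, map_zero _⟩
      obtain ⟨q, hq1, -, hq3⟩ := Polynomial.lifts_and_natDegree_eq_and_monic hl ((Polynomial.monic_scaleRoots_iff _).2 hp1)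
      refine ⟨q, hq3, ?_⟩
      have := Polynomial.scaleRoots_aeval_eq_zero (r := (aL X)⁻¹) hp3
      rw [← hq1, Polynomial.aeval_map_algebraMap, map_inv₀, eX] at this
      exact this
    exact (IsIntegralClosure.isIntegral_iff (A := O')).1 this
  · intro f hf hf'
    by_contra hne
    have hN : Algebra.norm L f ≠ 0 := Algebra.norm_ne_zero_iff.2 hne
    have i1 : IsIntegral KX f := (IsIntegralClosure.isIntegral_iff (A := O)).2 hf
    have i2 : IsIntegral A (aF X * f) := (IsIntegralClosure.isIntegral_iff (A := O')).2 hf'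
    obtain ⟨p, hp⟩ := IsIntegrallyClosed.isIntegral_iff.1 (Algebra.isIntegral_norm L i1)
    have j2 := (hA _).2 (IsIntegrallyClosed.isIntegral_iff.1 (Algebra.isIntegral_norm L i2))
    rw [map_mul, ← eX, Algebra.norm_algebraMap, hfr, map_mul, map_pow, h.vX, ← hp, h.vp p (by
      rintro rfl; rw [map_zero] at hp; exact hN hp.symm), ← exp_nsmul, ← exp_add, ← exp_zero, exp_le_exp] at j2
    have := h.d1
    simp at j2
    omega
  · obtain ⟨s, hs⟩ := (Module.Finite.fg_top : (⊤ : Submodule KX O).FG)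
    have : ∃ e : KX, e ≠ 0 ∧ ∀ g ∈ s, e • algebraMap O F g ∈ RR K b := by
      classical
      clear hs
      induction s using Finset.induction_on with
      | empty => exact ⟨1, one_ne_zero, by simp⟩
      | insert a s ha ih =>
        obtain ⟨e, he, h1⟩ := ih
        obtain ⟨e', he', h2⟩ := RR_den (K := K) (b := b) (algebraMap O F a)
        refine ⟨e * e', mul_ne_zero he he', fun g hg => ?_⟩
        rcases Finset.mem_insert.1 hg with rfl | hg
        · rw [mul_smul]; exact RR_smul _ _ h2
        · rw [mul_comm, mul_smul]; exact RR_smul _ _ (h1 g hg)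
    obtain ⟨e, he, h1⟩ := this
    refine ⟨e, he, ?_⟩
    rintro _ ⟨g, rfl⟩
    have hg : g ∈ Submodule.span KX (s : Set O) := by rw [hs]; trivial
    induction hg using Submodule.span_induction with
    | mem x hx => exact h1 x hx
    | zero => rw [map_zero, smul_zero]; exact AddSubgroup.zero_mem _
    | add x y _ _ hx hy => rw [map_add, smul_add]; exact AddSubgroup.add_mem _ hx hy
    | smul a x _ hx => rw [show algebraMap O F (a • x) = a • algebraMap O F x by rw [Algebra.smul_def, map_mul, ← IsScalarTower.algebraMap_apply, ← Algebra.smul_def], smul_comm]; exact RR_smul _ _ hx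
  · obtain ⟨s, hs⟩ := (Module.Finite.fg_top : (⊤ : Submodule A O').FG)
    have hst : ∀ (n : ℕ) f, f ∈ RI b vi 0 → (aF X)⁻¹ ^ n * f ∈ RI b vi 0 := by
      intro n f hf
      rw [← eX, ← map_inv₀, ← map_pow, ← Algebra.smul_def]
      apply RI_smul1 _ _ _ _ hf
      rw [map_pow, map_inv₀, h.vX, ← exp_neg, ← exp_nsmul, ← exp_zero, exp_le_exp]; simp
    have : ∃ N : ℕ, ∀ g ∈ s, (aF X)⁻¹ ^ N * algebraMap O' F g ∈ RI b vi 0 := by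
      classical
      clear hs
      induction s using Finset.induction_on with
      | empty => exact ⟨1, by simp⟩
      | insert a s ha ih =>
        obtain ⟨e, h1⟩ := ih
        obtain ⟨e', h2⟩ := RI_den h (algebraMap O' F a)
        refine ⟨e + e', fun g hg => ?_⟩
        rcases Finset.mem_insert.1 hg with rfl | hg
        · rw [pow_add, mul_assoc]; exact hst _ _ h2
        · rw [add_comm, pow_add, mul_assoc]; exact hst _ _ (h1 g hg)
    obtain ⟨e, h1⟩ := this
    refine ⟨e, ?_⟩
    rintro _ ⟨g, rfl⟩
    have hg : g ∈ Submodule.span A (s : Set O') := by rw [hs]; trivial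
    induction hg using Submodule.span_induction with
    | mem x hx => exact h1 x hx
    | zero => rw [map_zero, mul_zero]; exact AddSubgroup.zero_mem _
    | add x y _ _ hx hy => rw [map_add, mul_add]; exact AddSubgroup.add_mem _ hx hy
    | smul a x _ hx =>
      rw [Algebra.smul_def, map_mul, ← IsScalarTower.algebraMap_apply, IsScalarTower.algebraMap_apply A L F, mul_left_comm, ← Algebra.smul_def]
      exact RI_smul1 _ _ ((hA _).2 ⟨a, rfl⟩) _ hx
  · exact hwF
  · have h1 := Ideal.finrank_quotient_map (S := O') (p := Ideal.span {w}) L F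
    have hf1 : Finite (A ⧸ Ideal.span {w}) := Nat.finite_of_card_ne_zero (by rw [hwc]; exact Nat.card_pos.ne')
    letI := Ideal.Quotient.field (Ideal.span {w})
    have : Module.Finite (A ⧸ Ideal.span {w}) (O' ⧸ Ideal.map (algebraMap A O') (Ideal.span {w})) :=
      Module.finite_of_finrank_pos (by rw [h1, hfr]; exact h.d1)
    have h2 := Module.natCard_eq_pow_finrank (K := A ⧸ Ideal.span {w}) (V := O' ⧸ Ideal.map (algebraMap A O') (Ideal.span {w}))
    rw [h1, hfr, hwc] at h2
    rw [← h2, Ideal.map_span, Set.image_singleton]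
end inst8
open Polynomial (X C)
section step1
variable {K R : Type*} [Field K] [CommRing R] [IsDomain R] [Algebra K R] [Algebra KX R]
  [IsScalarTower K KX R] {d : ℕ}
def Cm (b : Module.Basis (Fin d) KX R) (m : ℕ) : AddSubgroup R where
  carrier := {f | ∀ (j : Fin d) i, m < i + (j : ℕ) → (b.repr f j).coeff i = 0}
  zero_mem' := by intro j i _; simp
  add_mem' := by intro f g hf hg j i h; simp [hf j i h, hg j i h]
  neg_mem' := by intro f hf j i h; simp [hf j i h]
variable {b : Module.Basis (Fin d) KX R} {y : R} {P : KXX}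
structure AH (b : Module.Basis (Fin d) KX R) (y : R) (P : KXX) : Prop where
  d1 : 1 ≤ d
  hb : ∀ i, b i = y ^ (i : ℕ)
  hm : P.Monic
  hd : P.natDegree = d
  hc : ∀ i, i ≤ d → (P.coeff i).natDegree + i ≤ d
  hy : Polynomial.aeval y P = 0
theorem mem_Cm {m : ℕ} {f : R} : f ∈ Cm b m ↔ ∀ (j : Fin d) i, m < i + (j : ℕ) → (b.repr f j).coeff i = 0 := Iff.rfl
theorem mem_Cm' {m : ℕ} {f : R} : f ∈ Cm b m ↔ ∀ j : Fin d, b.repr f j = 0 ∨ (b.repr f j).natDegree + (j : ℕ) ≤ m := by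
  rw [mem_Cm]
  refine forall_congr' fun j => ⟨fun h => ?_, fun h i hi => ?_⟩
  · by_contra! hh
    have := h _ hh.2
    exact hh.1 (by rwa [Polynomial.coeff_natDegree, Polynomial.leadingCoeff_eq_zero] at this)
  · rcases h with h | h
    · simp [h]
    · exact Polynomial.coeff_eq_zero_of_natDegree_lt (by omega)
theorem Cm_mono {m m' : ℕ} (h : m ≤ m') : Cm b m ≤ Cm b m' := fun _ hf j i hi => hf j i (by omega)
theorem Cm_poly {m k : ℕ} {p : KX} (hp : p.natDegree ≤ k) {f : R} (hf : f ∈ Cm b m) : p • f ∈ Cm b (m + k) := by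
  rw [mem_Cm'] at hf ⊢
  intro j
  rw [map_smul, Finsupp.smul_apply, smul_eq_mul]
  rcases hf j with h | h
  · left; rw [h, mul_zero]
  · right
    have := Polynomial.natDegree_mul_le (p := p) (q := b.repr f j)
    omega
theorem Cm_b (j : Fin d) : b j ∈ Cm b j := by
  rw [mem_Cm']
  intro i
  rw [Module.Basis.repr_self, Finsupp.single_apply]
  split_ifs with h
  · right; simp [h]
  · left; rfl
theorem Cm_yd (H : AHb) : y ^ d ∈ Cm b d := by
  have hy := H.hy
  rw [Polynomial.aeval_eq_sum_range, H.hd, Finset.sum_range_succ, ← H.hd, H.hm.coeff_natDegree, one_smul, H.hd] at hy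
  rw [eq_neg_of_add_eq_zero_right hy]
  refine neg_mem (sum_mem fun i hi => ?_)
  have hi' := Finset.mem_range.1 hi
  have h1 := Cm_b (b := b) ⟨i, hi'⟩
  rw [H.hb] at h1
  exact Cm_mono (by have := H.hc i hi'.le; simp only; omega) (Cm_poly le_rfl h1)
theorem Cm_y (H : AHb) {m : ℕ} {f : R} (hf : f ∈ Cm b m) :
    y * f ∈ Cm b (m + 1) := by
  rw [mem_Cm'] at hf
  rw [← b.sum_repr f, Finset.mul_sum]
  refine sum_mem fun j _ => ?_
  rw [mul_smul_comm, H.hb, ← pow_succ']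
  rcases hf j with h | h
  · rw [h, zero_smul]; exact zero_mem _
  · have : y ^ ((j : ℕ) + 1) ∈ Cm b (j + 1) := by
      by_cases hj : (j : ℕ) + 1 < d
      · have := Cm_b (b := b) ⟨j + 1, hj⟩
        rwa [H.hb] at this
      · have e : (j : ℕ) + 1 = d := by omega
        rw [e]; exact Cm_yd H
    exact Cm_mono (by omega) (Cm_poly le_rfl this)
theorem Cm_ypow (H : AHb) {m : ℕ} {f : R} (hf : f ∈ Cm b m) (n : ℕ) :
    y ^ n * f ∈ Cm b (m + n) := by
  induction n with
  | zero => simpa using hf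
  | succ n ih => rw [pow_succ', mul_assoc]; exact Cm_y H ih
theorem Cm_mul (H : AHb) {m m' : ℕ} {f g : R}
    (hf : f ∈ Cm b m) (hg : g ∈ Cm b m') : f * g ∈ Cm b (m + m') := by
  rw [mem_Cm'] at hf
  rw [← b.sum_repr f, Finset.sum_mul]
  refine sum_mem fun j _ => ?_
  rcases hf j with h | h
  · rw [h, zero_smul, zero_mul]; exact zero_mem _
  · rw [smul_mul_assoc, H.hb]
    exact Cm_mono (by omega) (Cm_poly le_rfl (Cm_ypow H hg j))
theorem Cm_one (H : AHb) : (1 : R) ∈ Cm b 0 := by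
  have := Cm_b (b := b) ⟨0, H.d1⟩
  rwa [H.hb, pow_zero] at this
theorem Cm_pow (H : AHb) {m : ℕ} {f : R}
    (hf : f ∈ Cm b m) (n : ℕ) : f ^ n ∈ Cm b (m * n) := by
  induction n with
  | zero => simpa using Cm_one H
  | succ n ih => rw [pow_succ, mul_add, mul_one]; exact Cm_mul H ih hf
theorem Cm_norm (H : AHb) {m : ℕ} {f : R}
    (hf : f ∈ Cm b m) : (Algebra.norm KX f).natDegree ≤ d * m := by
  rw [Algebra.norm_eq_matrix_det b, Matrix.det_apply]
  apply Polynomial.natDegree_sum_le_of_forall_le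
  intro σ _
  by_cases h0 : ∏ i, Algebra.leftMulMatrix b f (σ i) i = 0
  · rw [h0]; simp
  rw [← Ne, Finset.prod_ne_zero_iff] at h0
  refine (Polynomial.natDegree_smul_le _ _).trans ((Polynomial.natDegree_prod_le _ _).trans ?_)
  have h1 : ∀ i, (Algebra.leftMulMatrix b f (σ i) i).natDegree + (σ i : ℕ) ≤ m + (i : ℕ) := by
    intro i
    have h2 := Cm_mul H hf (Cm_b i)
    rw [mem_Cm'] at h2
    have h3 := h0 i (Finset.mem_univ _)
    rw [Algebra.leftMulMatrix_eq_repr_mul] at h3 ⊢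
    exact (h2 (σ i)).resolve_left h3
  have h4 := Finset.sum_le_sum (fun i (_ : i ∈ Finset.univ) => h1 i)
  rw [Finset.sum_add_distrib, Finset.sum_add_distrib, Equiv.sum_comp σ (fun i => (i : ℕ))] at h4
  simp at h4
  simpa using h4
theorem dim_quot [Finite K] (H : AHb) {m : ℕ} {f : R}
    (hf : f ∈ Cm b m) (h0 : f ≠ 0) : Finite (R ⧸ Ideal.span {f}) ∧ Module.finrank K (R ⧸ Ideal.span {f}) ≤ d * m := by
  constructor
  · have := finQ_poly K
    have : Module.Finite KX R := Module.Finite.of_basis b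
    have : Ring.HasFiniteQuotients R := Ring.HasFiniteQuotients.of_module_finite (R := KX) R
    exact this.finiteQuotient (by simpa using h0)
  · rw [finrank_quotient_span_eq_natDegree_norm b h0]
    exact Cm_norm H hf
end step1
open Polynomial (X C)
noncomputable def fro (K S : Type*) [Field K] [Fintype K] [CommRing S] [Algebra K S] (m : ℕ) : S →ₐ[K] S :=
  (FiniteField.frobeniusAlgHom K S) ^ m
theorem fro_apply {K S : Type*} [Field K] [Fintype K] [CommRing S] [Algebra K S] (m : ℕ) (s : S) :
    fro K S m s = s ^ (Fintype.card K ^ m) := by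
  induction m generalizing s with
  | zero => simp [fro]
  | succ m ih =>
    have : fro K S (m + 1) s = fro K S m (FiniteField.frobeniusAlgHom K S s) := by
      simp only [fro, pow_succ]; rfl
    rw [this, ih, FiniteField.coe_frobeniusAlgHom, ← pow_mul, pow_succ']
section step2
variable {K R : Type*} [Field K] [Fintype K] [CommRing R] [IsDomain R] [Algebra K R] [Algebra KX R]
  [IsScalarTower K KX R] {d : ℕ}
variable {b : Module.Basis (Fin d) KX R} {y : R} {P : KXX}
theorem algMap_eq {S : Type*} [CommRing S] [Algebra K S] [Algebra KX S]
  [IsScalarTower K KX S] (p : KX) : algebraMap KX S p = Polynomial.aeval (algebraMap KX S X) p := by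
  rw [Polynomial.aeval_algebraMap_apply, Polynomial.aeval_X_left_apply]
theorem ord_bound (H : AHb) (φ : R →ₐ[K] PK) (hφ : Function.Injective φ) :
    ∃ e : ℕ, 1 ≤ e ∧ ∀ m f, f ∈ Cm b m → f ≠ 0 → ∀ N, PowerSeries.X ^ N ∣ φ f → N ≤ e * (d * m) := by
  have hbi : Function.Injective (aR) := by
    have : Nonempty (Fin d) := ⟨⟨0, H.d1⟩⟩
    intro p q hpq
    have := congrArg (fun f => b.repr f ⟨0, H.d1⟩) (show p • b ⟨0, H.d1⟩ = q • b ⟨0, H.d1⟩ by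
      rw [Algebra.smul_def, Algebra.smul_def, hpq])
    simpa using this
  set x0 := PowerSeries.constantCoeff (φ (aR X)) with hx0
  set z := φ (aR (X - C x0)) with hz
  have hz0 : z ≠ 0 := by
    rw [hz, Ne, map_eq_zero_iff φ hφ, map_eq_zero_iff _ hbi]
    exact Polynomial.X_sub_C_ne_zero _
  have hC : ∀ c : K, φ (aR (C c)) = PowerSeries.C c := by
    intro c
    have : aR (C c) = algebraMap K R c := by
      rw [IsScalarTower.algebraMap_apply K KX R]; rfl
    rw [this, AlgHom.commutes]; rfl
  have hev : ∀ p : KX, PowerSeries.constantCoeff (φ (aR p)) = p.eval x0 := by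
    intro p
    induction p using Polynomial.induction_on' with
    | add p q hp hq => simp only [map_add, hp, hq, Polynomial.eval_add]
    | monomial n c => rw [← Polynomial.C_mul_X_pow_eq_monomial, map_mul, map_mul, map_mul, hC, map_pow, map_pow, map_pow]; simp [hx0]
  have hze : z.order ≠ ⊤ := by rwa [Ne, PowerSeries.order_eq_top]
  obtain ⟨e, he⟩ := ENat.ne_top_iff_exists.1 hze
  refine ⟨e, ?_, ?_⟩
  · have : PowerSeries.constantCoeff z = 0 := by rw [hz, hev]; simp
    rw [← PowerSeries.X_dvd_iff, ← pow_one (PowerSeries.X (R := K)), PowerSeries.X_pow_dvd_iff] at this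
    have := PowerSeries.le_order z 1 (by intro i hi; exact this i (by exact_mod_cast hi))
    rw [← he] at this; exact_mod_cast this
  intro m f hf h0 N hN
  obtain ⟨hfin, hdim⟩ := dim_quot H hf h0
  set V := R ⧸ Ideal.span {f}
  have : FiniteDimensional K V := Module.Finite.of_finite
  set χ := (Algebra.lmul K V (Ideal.Quotient.mk _ (aR X))).charpoly with hχ
  have h1 : Polynomial.aeval (Algebra.lmul K V (Ideal.Quotient.mk _ (aR X))) χ = 0 := LinearMap.aeval_self_charpoly _
  have h1' : Polynomial.aeval (Ideal.Quotient.mk (Ideal.span {f}) (aR X)) χ = 0 := by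
    rw [Polynomial.aeval_algHom_apply] at h1
    have := congrArg (fun g : Module.End K V => g 1) h1
    simpa using this
  have h2 : f ∣ aR χ := by
    rw [← Ideal.mem_span_singleton, ← Ideal.Quotient.eq_zero_iff_mem, ← h1', algMap_eq]
    exact (Polynomial.aeval_algHom_apply (Ideal.Quotient.mkₐ K (Ideal.span {f})) _ _).symm
  have hχ0 : χ ≠ 0 := (LinearMap.charpoly_monic _).ne_zero
  have hdχ : χ.natDegree ≤ d * m := by rw [hχ, LinearMap.charpoly_natDegree]; exact hdim
  obtain ⟨r, hr, hr'⟩ := Polynomial.exists_eq_pow_rootMultiplicity_mul_and_not_dvd χ hχ0 x0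
  have h3 : PowerSeries.X ^ N ∣ φ (aR χ) := hN.trans (map_dvd φ h2)
  rw [hr, map_mul, map_mul, map_pow, map_pow, ← hz] at h3
  have h4 : (φ (aR r)).order = 0 := by
    rw [Polynomial.dvd_iff_isRoot] at hr'
    refine le_antisymm (PowerSeries.order_le 0 ?_) bot_le
    rw [PowerSeries.coeff_zero_eq_constantCoeff, hev]
    exact hr'
  have h5 := PowerSeries.X_pow_dvd_iff.1 h3
  have h6 := PowerSeries.nat_le_order _ N h5
  rw [PowerSeries.order_mul, PowerSeries.order_pow, h4, add_zero, ← he, nsmul_eq_mul] at h6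
  have h7 : N ≤ χ.rootMultiplicity x0 * e := by exact_mod_cast h6
  have h8 : χ.rootMultiplicity x0 ≤ χ.natDegree := by
    have := Polynomial.natDegree_le_of_dvd (Polynomial.pow_rootMultiplicity_dvd χ x0) hχ0
    simpa using this
  calc N ≤ χ.rootMultiplicity x0 * e := h7
    _ ≤ (d * m) * e := by gcongr; omega
    _ = _ := mul_comm _ _
theorem theta_ne {ι : Type*} [Fintype ι] (φ : R →ₐ[K] PK) (hφ : Function.Injective φ) (m : ℕ) (f g : ι → R)
    (hf : ∀ c : ι → K, c ≠ 0 → ¬ PowerSeries.X ^ (Fintype.card K ^ m) ∣ φ (∑ i, c i • f i)) (hg : g ≠ 0) :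
    ∑ i, f i * g i ^ (Fintype.card K ^ m) ≠ 0 := by
  classical
  set M := Fintype.card K ^ m with hM
  intro h0
  have hex : ∃ l, ∃ i, PowerSeries.coeff l (φ (g i)) ≠ 0 := by
    obtain ⟨i, hi⟩ := Function.ne_iff.1 hg
    have : φ (g i) ≠ 0 := by rw [Ne, map_eq_zero_iff φ hφ]; exact hi
    obtain ⟨l, hl⟩ := PowerSeries.exists_coeff_ne_zero_iff_ne_zero.2 this
    exact ⟨l, i, hl⟩
  set l := Nat.find hex with hl
  obtain ⟨i0, hi0⟩ := Nat.find_spec hex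
  have hw : ∀ i, ∃ w, φ (g i) = PowerSeries.X ^ l * w := by
    intro i
    have : PowerSeries.X ^ l ∣ φ (g i) := by
      rw [PowerSeries.X_pow_dvd_iff]
      intro k hk
      by_contra hh
      exact Nat.find_min hex hk ⟨i, hh⟩
    exact this
  choose w hw using hw
  set c : ι → K := fun i => PowerSeries.constantCoeff (w i) with hc
  have hc0 : c ≠ 0 := by
    intro h
    apply hi0
    rw [← hl, hw i0]
    have : PowerSeries.coeff (0 + l) (PowerSeries.X ^ l * w i0) = _ := PowerSeries.coeff_X_pow_mul _ _ _
    rw [zero_add] at this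
    rw [this, PowerSeries.coeff_zero_eq_constantCoeff]
    exact congrFun h i0
  apply hf c hc0
  have h1 : ∑ i, φ (f i) * w i ^ M = 0 := by
    have := congrArg φ h0
    rw [map_sum, map_zero] at this
    have h2 : (PowerSeries.X (R := K) ^ l) ^ M * ∑ i, φ (f i) * w i ^ M = 0 := by
      rw [← this, Finset.mul_sum]
      refine Finset.sum_congr rfl fun i _ => ?_
      rw [map_mul, map_pow, hw i, mul_pow]; ring
    exact (mul_eq_zero.1 h2).resolve_left (pow_ne_zero _ (pow_ne_zero _ PowerSeries.X_ne_zero))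
  have h3 : φ (∑ i, c i • f i) = -∑ i, φ (f i) * (w i - algebraMap K _ (c i)) ^ M := by
    rw [map_sum, ← sub_eq_zero, sub_neg_eq_add, ← Finset.sum_add_distrib, ← h1]
    refine Finset.sum_congr rfl fun i _ => ?_
    rw [← fro_apply, map_sub, fro_apply, AlgHom.commutes, map_smul, Algebra.smul_def]; ring
  rw [h3, dvd_neg]
  refine Finset.dvd_sum fun i _ => Dvd.dvd.mul_left (pow_dvd_pow_of_dvd ?_ _) _
  rw [PowerSeries.X_dvd_iff, map_sub, sub_eq_zero]
  simp [hc, PowerSeries.algebraMap_apply]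
noncomputable def cjj (P : KXX) (y : R) (j : ℕ) : R :=
  ∑ i ∈ Finset.range (P.natDegree + 1), if j < i then P.coeff i • y ^ (i - 1 - j) else 0
theorem cjj_mem (H : AHb) (j : ℕ) : cjj P y j ∈ Cm b d := by
  refine sum_mem fun i hi => ?_
  split_ifs with h
  · rw [H.hd, Finset.mem_range] at hi
    have h1 := Cm_ypow H (Cm_one H) (i - 1 - j)
    rw [mul_one] at h1
    have := H.hc i (by omega)
    exact Cm_mono (by omega) (Cm_poly le_rfl h1)
  · exact zero_mem _
theorem cjj_last (H : AHb) : cjj P y (d - 1) = 1 := by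
  have hd1 := H.d1
  rw [cjj, H.hd, Finset.sum_range_succ, Finset.sum_eq_zero, if_pos (by omega), ← H.hd, H.hm.coeff_natDegree]
  · simp
  · intro i hi
    rw [Finset.mem_range] at hi
    rw [if_neg (by omega)]
theorem cjj_eval {Ω : Type*} [Field Ω] [Algebra K Ω] (H : AHb) (π : R →ₐ[K] Ω) (Y : Ω)
    (hY : ∑ i ∈ Finset.range (d + 1), π (algebraMap _ R (P.coeff i)) * Y ^ i = 0) (hne : Y ≠ π y) :
    ∑ j ∈ Finset.range d, π (cjj P y j) * Y ^ j = 0 := by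
  have h1 : ∑ j ∈ Finset.range d, π (cjj P y j) * Y ^ j =
      ∑ i ∈ Finset.range (d + 1), π (algebraMap _ R (P.coeff i)) * ∑ j ∈ Finset.range i, Y ^ j * π y ^ (i - 1 - j) := by
    simp only [cjj, map_sum, Finset.sum_mul, H.hd]
    rw [Finset.sum_comm]
    refine Finset.sum_congr rfl fun i hi => ?_
    rw [Finset.mem_range] at hi
    have : Finset.range i = (Finset.range d).filter (· < i) := by
      ext j; simp only [Finset.mem_range, Finset.mem_filter]; omega
    rw [this, Finset.sum_filter, Finset.mul_sum]
    refine Finset.sum_congr rfl fun j _ => ?_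
    split_ifs
    · rw [Algebra.smul_def, map_mul, map_pow]; ring
    · simp
  have h2 : (∑ j ∈ Finset.range d, π (cjj P y j) * Y ^ j) * (Y - π y) = 0 := by
    rw [h1, Finset.sum_mul]
    have h3 : ∑ i ∈ Finset.range (d + 1), π (algebraMap _ R (P.coeff i)) * π y ^ i = 0 := by
      have := congrArg π H.hy
      rw [Polynomial.aeval_eq_sum_range, map_sum, map_zero, H.hd] at this
      rw [← this]
      refine Finset.sum_congr rfl fun i _ => ?_
      rw [Algebra.smul_def, map_mul, map_pow]
    rw [← sub_zero (0 : Ω)]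
    nth_rewrite 1 [← hY]
    rw [← h3, ← Finset.sum_sub_distrib]
    refine Finset.sum_congr rfl fun i _ => ?_
    rw [mul_assoc, (Commute.all _ _).geom_sum₂_mul]; ring
  exact (mul_eq_zero.1 h2).resolve_right (sub_ne_zero.2 hne)
end step2
open Polynomial (X C)
section step3
variable {K R : Type*} [Field K] [Fintype K] [CommRing R] [IsDomain R] [Algebra K R] [Algebra KX R]
  [IsScalarTower K KX R] {d : ℕ}
variable {b : Module.Basis (Fin d) KX R} {y : R} {P : KXX}
noncomputable def ff (y : R) (a : ℕ) (i : Fin d × Fin (a + 1)) : R := (X ^ (i.2 : ℕ) : KX) • y ^ (i.1 : ℕ)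
theorem ff_mem (H : AHb) (a : ℕ) (i : Fin d × Fin (a + 1)) : ff (K := K) y a i ∈ Cm b (a + d) := by
  have h1 := Cm_b (b := b) i.1
  rw [H.hb] at h1
  have h2 := Cm_poly (p := (X ^ (i.2 : ℕ) : KX)) (k := a) (by rw [Polynomial.natDegree_X_pow]; omega) h1
  exact Cm_mono (by omega) h2
theorem ff_indep (H : AHb) (a : ℕ) (c : Fin d × Fin (a + 1) → K) (hc : c ≠ 0) :
    ∑ i, c i • ff (K := K) y a i ≠ 0 := by
  classical
  intro h0
  apply hc
  funext ⟨j, i⟩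
  have h1 := congrArg (fun f => (b.repr f j).coeff i) h0
  simp only [map_zero, Finsupp.zero_apply, Polynomial.coeff_zero] at h1
  rw [Fintype.sum_prod_type, map_sum, Finsupp.finsetSum_apply, Polynomial.finsetSum_coeff] at h1
  rw [Finset.sum_eq_single j] at h1
  · rw [map_sum, Finsupp.finsetSum_apply, Polynomial.finsetSum_coeff, Finset.sum_eq_single i] at h1
    · simp only [ff, ← H.hb] at h1
      rw [← algebraMap_smul KX (c (j, i)), map_smul, map_smul] at h1
      simpa using h1
    · intro i' _ hi
      simp only [ff, ← H.hb]
      rw [← algebraMap_smul KX (c (j, i')), map_smul, map_smul]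
      have : (i : ℕ) ≠ i' := fun h => hi (Fin.ext h.symm)
      simp [Polynomial.coeff_X_pow, this]
    · simp
  · intro j' _ hj
    rw [map_sum, Finsupp.finsetSum_apply, Polynomial.finsetSum_coeff]
    refine Finset.sum_eq_zero fun i' _ => ?_
    simp only [ff, ← H.hb]
    rw [← algebraMap_smul KX (c (j', i')), map_smul, map_smul]
    simp [Finsupp.single_apply, hj]
  · simp
noncomputable def hj (y : R) (a B M : ℕ) (j : Fin d) :
    (Fin d × Fin (a + 1) → Fin d → Polynomial.degreeLT K B) →ₗ[K] R where
  toFun g := ∑ i, (g i j : KX) • ff (K := K) y a i ^ M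
  map_add' := by intro g g'; simp [add_smul, Finset.sum_add_distrib]
  map_smul' := by intro c g; simp [Finset.smul_sum]
noncomputable def Teq (b : Module.Basis (Fin d) KX R) (P : KXX) (y : R) (hd1 : 1 ≤ d) (a B M m' : ℕ) :
    (Fin d × Fin (a + 1) → Fin d → Polynomial.degreeLT K B) →ₗ[K] (Fin (d - 1) → Fin d → Fin (m' + 1) → K) where
  toFun g j k n := (b.repr (hj y a B M ⟨j, by omega⟩ g - hj y a B M ⟨d - 1, by omega⟩ g * cjj P y j) k).coeff n
  map_add' := by intro g g'; funext j k n; simp only [map_add, add_mul, map_sub, Finsupp.sub_apply, Finsupp.add_apply, Polynomial.coeff_sub, Polynomial.coeff_add, Pi.add_apply]; ring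
  map_smul' := by
    intro c g; funext j k n
    simp only [map_smul, smul_mul_assoc, ← smul_sub, RingHom.id_apply, Pi.smul_apply]
    rw [← algebraMap_smul KX c, map_smul]
    simp
theorem hj_mem (H : AHb) (a B M : ℕ) (j : Fin d) (g) : hj (K := K) y a B M j g ∈ Cm b ((a + d) * M + B) := by
  refine sum_mem fun i _ => Cm_poly ?_ (Cm_pow H (ff_mem H a i) M)
  have := (g i j).2
  rw [Polynomial.mem_degreeLT] at this
  exact Polynomial.natDegree_le_of_degree_le this.le
theorem exists_theta (H : AHb) (φ : R →ₐ[K] PK) (hφ : Function.Injective φ) (e : ℕ)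
    (he : ∀ m f, f ∈ Cm b m → f ≠ 0 → ∀ N, PowerSeries.X ^ N ∣ φ f → N ≤ e * (d * m)) (m a B M : ℕ) (hM : M = Fintype.card K ^ m)
    (h1 : e * (d * (a + d)) < M) (h2 : (d - 1) * (d * ((a + d) * M + B + d + 1)) < d * (a + 1) * (d * B)) :
    ∃ Θ : R, Θ ≠ 0 ∧ Θ ∈ Cm b (a + d + (B + d) * M) ∧ ∀ {Ω : Type} [Field Ω] [Algebra K Ω] (π : R →ₐ[K] Ω),
      π (aR X) ^ (M * M) = π (aR X) → π y ^ (M * M) ≠ π y → π Θ = 0 := by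
  set m' := (a + d) * M + B + d with hm'
  have hfr : Module.finrank K (Polynomial.degreeLT K B) = B := by
    rw [(Polynomial.degreeLTEquiv K B).finrank_eq]; simp
  have : FiniteDimensional K (Polynomial.degreeLT K B) := Module.Finite.equiv (Polynomial.degreeLTEquiv K B).symm
  have hker : LinearMap.ker (Teq b P y H.d1 a B M m') ≠ ⊥ := by
    apply LinearMap.ker_ne_bot_of_finrank_lt
    simp only [Module.finrank_pi_fintype, hfr, Module.finrank_self]
    simp
    simpa [mul_assoc] using h2
  obtain ⟨g, hg, hg0⟩ := Submodule.exists_mem_ne_zero_of_ne_bot hker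
  rw [LinearMap.mem_ker] at hg
  have hmem : ∀ j : Fin (d - 1), hj (K := K) y a B M ⟨j, by omega⟩ g - hj y a B M ⟨d - 1, by have := H.d1; omega⟩ g * cjj P y j ∈ Cm b m' := by
    intro j
    refine sub_mem (Cm_mono (by omega) (hj_mem H a B M _ g)) (Cm_mul H (hj_mem H a B M _ g) (cjj_mem H _))
  have heq : ∀ j : Fin d, hj (K := K) y a B M j g = hj y a B M ⟨d - 1, by have := H.d1; omega⟩ g * cjj P y j := by
    intro j
    by_cases hjd : (j : ℕ) < d - 1
    · rw [← sub_eq_zero, ← b.repr.map_eq_zero_iff]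
      ext k n
      by_cases hn : n < m' + 1
      · exact congrFun (congrFun (congrFun hg ⟨j, hjd⟩) k) ⟨n, hn⟩
      · exact hmem ⟨j, hjd⟩ k n (by omega)
    · have : (j : ℕ) = d - 1 := by omega
      rw [this, cjj_last H, mul_one]
      have e : j = ⟨d - 1, by have := H.d1; omega⟩ := Fin.ext this
      rw [← e]
  set gg : Fin d × Fin (a + 1) → R := fun i => ∑ j : Fin d, (g i j : KX) • b j with hgg
  refine ⟨∑ i, ff (K := K) y a i * gg i ^ M, ?_, ?_, ?_⟩
  · subst hM
    apply theta_ne φ hφ m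
    · intro c hc hdv
      have := he (a + d) _ (sum_mem fun i _ => ?_) (ff_indep H a c hc) _ hdv
      · exact absurd this (not_le.2 h1)
      · have := Cm_poly (p := C (c i)) (k := 0) (by simp) (ff_mem H a i)
        rw [← algebraMap_smul KX (c i)]
        exact this
    · intro h
      apply hg0
      funext i j
      have := congrFun h i
      have := congrArg (fun f => b.repr f j) this
      simp only [hgg, b.repr_sum_self] at this
      simpa using this
  · refine sum_mem fun i _ => Cm_mul H (ff_mem H a i) (Cm_pow H (sum_mem fun j _ => ?_) M)
    have h3 := (g i j).2
    rw [Polynomial.mem_degreeLT] at h3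
    exact Cm_mono (by omega) (Cm_poly (Polynomial.natDegree_le_of_degree_le h3.le) (Cm_b (b := b) j))
  · intro Ω _ _ π hx hy'
    have hMM : M * M = Fintype.card K ^ (m + m) := by rw [pow_add, hM]
    have hpol : ∀ p : KX, π (aR p) ^ (M * M) = π (aR p) := by
      intro p
      rw [algMap_eq, ← Polynomial.aeval_algHom_apply, hMM, ← fro_apply, ← Polynomial.aeval_algHom_apply, fro_apply, ← hMM, hx]
    have hY := cjj_eval H π (π y ^ (M * M)) (by
      have h3 := congrArg (fun z => (π z) ^ (M * M)) H.hy
      simp only [map_zero] at h3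
      rw [zero_pow (by rw [hMM]; positivity), Polynomial.aeval_eq_sum_range, map_sum, H.hd, hMM, ← fro_apply, map_sum] at h3
      rw [← h3]
      refine Finset.sum_congr rfl fun i _ => ?_
      rw [fro_apply, ← hMM, Algebra.smul_def, map_mul, mul_pow, hpol, map_pow, ← pow_mul, ← pow_mul, mul_comm i]) hy'
    have key : π (∑ i, ff (K := K) y a i * gg i ^ M) ^ M = 0 := by
      have e1 : π (∑ i, ff (K := K) y a i * gg i ^ M) ^ M = ∑ j : Fin d, π (hj (K := K) y a B M j g) * (π y ^ (M * M)) ^ (j : ℕ) := by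
        simp only [hj, LinearMap.coe_mk, AddHom.coe_mk, map_sum, Finset.sum_mul]
        rw [Finset.sum_comm, hM, ← fro_apply, map_sum]
        refine Finset.sum_congr rfl fun i _ => ?_
        rw [fro_apply, ← hM, map_mul, map_pow, mul_pow, ← pow_mul, hgg, map_sum, hMM, ← fro_apply, map_sum, Finset.mul_sum]
        refine Finset.sum_congr rfl fun j _ => ?_
        rw [fro_apply, ← hMM, Algebra.smul_def, map_mul, mul_pow, hpol, Algebra.smul_def, map_mul, map_pow, H.hb, map_pow, ← pow_mul, ← pow_mul, mul_comm (j : ℕ)]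
        ring
      rw [e1]
      have e2 : ∀ j : Fin d, π (hj (K := K) y a B M j g) * (π y ^ (M * M)) ^ (j : ℕ) =
        π (hj (K := K) y a B M ⟨d - 1, by have := H.d1; omega⟩ g) * (π (cjj P y j) * (π y ^ (M * M)) ^ (j : ℕ)) := by
        intro j; rw [heq j, map_mul, mul_assoc]
      rw [Finset.sum_congr rfl (fun j _ => e2 j), ← Finset.mul_sum, Fin.sum_univ_eq_sum_range (fun j => π (cjj P y j) * (π y ^ (M * M)) ^ j), hY, mul_zero]
    exact pow_eq_zero_iff (by rw [hM]; positivity) |>.1 key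
end step3
open Polynomial (X C)
theorem param_ineq (E d c M : ℕ) (hE : 1 ≤ E) (hd : 1 ≤ d) (hc : c = 2 * d ^ 2 * E * (d + 1) + 1) (hM1 : E * d + 1 ≤ M) (hM2 : c + d ≤ M) :
    ∃ a B, E * (a + d) < M ∧ (d - 1) * (d * ((a + d) * M + B + d + 1)) < d * (a + 1) * (d * B) ∧
      d * (a + d + (B + d) * M) ≤ (d - 1) * (M * M) + (2 * d + c + d ^ 2) * M := by
  obtain ⟨a, ha⟩ : ∃ a, (M - 1) / E = a + d := by
    have : d ≤ (M - 1) / E := by rw [Nat.le_div_iff_mul_le (by omega)]; rw [mul_comm]; omega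
    exact ⟨(M - 1) / E - d, by omega⟩
  have h1 : E * (a + d) ≤ M - 1 := by rw [← ha]; exact Nat.mul_div_le _ _
  have h2 : M - 1 < E * (a + d + 1) := by rw [← ha]; exact Nat.lt_mul_div_succ _ (by omega)
  set B := ((d - 1) * M + c) / d + 1 with hB
  have h3 : (d - 1) * M + c < d * B := Nat.lt_mul_div_succ _ (by omega)
  have h4 : d * B ≤ (d - 1) * M + c + d := by
    rw [hB, mul_add, mul_one]; have := Nat.mul_div_le ((d - 1) * M + c) d; omega
  obtain ⟨D, rfl⟩ : ∃ D, d = D + 1 := ⟨d - 1, by omega⟩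
  simp only [Nat.add_sub_cancel] at *
  have h5 : B ≤ M := by
    have : (D + 1) * B ≤ (D + 1) * M := by nlinarith
    exact Nat.le_of_mul_le_mul_left this (by omega)
  have h6 : a + (D + 1) ≤ M := by
    have := Nat.le_mul_of_pos_left (a + (D + 1)) hE
    omega
  refine ⟨a, B, by omega, ?_, ?_⟩
  · have h7 : M ≤ E * ((D + 2) * (a + 1)) := by
      have e1 : a + (D + 1) + 1 ≤ (D + 2) * (a + 1) := by
        have : (D + 2) * (a + 1) = a + (D + 1) + 1 + D * a + a := by ring
        omega
      have := Nat.mul_le_mul_left E e1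
      omega
    have h8 : D * (D * M + B + (D + 1) + 1) ≤ 2 * (D + 1) ^ 2 * M := by
      have e1 : D * (D * M + B + (D + 1) + 1) ≤ D * (D * M + 3 * M) := Nat.mul_le_mul_left _ (by omega)
      have e2 : 2 * (D + 1) ^ 2 * M = D * (D * M + 3 * M) + (D * D * M + D * M + 2 * M) := by ring
      omega
    have h9 : 2 * (D + 1) ^ 2 * M < c * (a + 1) := by
      have := Nat.mul_le_mul_left (2 * (D + 1) ^ 2) h7
      have e2 : c * (a + 1) = 2 * (D + 1) ^ 2 * (E * ((D + 2) * (a + 1))) + (a + 1) := by rw [hc]; ring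
      omega
    have h10 : D * ((a + (D + 1)) * M + B + (D + 1) + 1) < (a + 1) * ((D + 1) * B) := by
      have := Nat.mul_le_mul_left (a + 1) h3.le
      have e2 : D * ((a + (D + 1)) * M + B + (D + 1) + 1) = (a + 1) * (D * M) + D * (D * M + B + (D + 1) + 1) := by ring
      have e3 : (a + 1) * (D * M + c) = (a + 1) * (D * M) + c * (a + 1) := by ring
      omega
    have := Nat.mul_lt_mul_of_pos_left h10 (show 0 < D + 1 by omega)
    calc _ = (D + 1) * (D * ((a + (D + 1)) * M + B + (D + 1) + 1)) := by ring
      _ < _ := this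
      _ = _ := by ring
  · have := Nat.mul_le_mul_right M h4
    have e1 := Nat.mul_le_mul_left (D + 1) h6
    calc (D + 1) * (a + (D + 1) + (B + (D + 1)) * M) = (D + 1) * (a + (D + 1)) + (D + 1) * B * M + (D + 1) ^ 2 * M := by ring
      _ ≤ (D + 1) * M + (D * M + c + (D + 1)) * M + (D + 1) ^ 2 * M := by omega
      _ = _ := by ring
section step4
variable {K R : Type*} [Field K] [Fintype K] [CommRing R] [IsDomain R] [Algebra K R] [Algebra KX R]
  [IsScalarTower K KX R] {d : ℕ}
variable {b : Module.Basis (Fin d) KX R} {y : R} {P : KXX}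
theorem homs_le {Ω : Type} [Field Ω] [Algebra K Ω] (H : AHb) {m : ℕ} {f : R} (hf : f ∈ Cm b m) (h0 : f ≠ 0) :
    {π : R →ₐ[K] Ω | π f = 0}.Finite ∧ {π : R →ₐ[K] Ω | π f = 0}.ncard ≤ d * m := by
  obtain ⟨hfin, hdim⟩ := dim_quot H hf h0
  have : FiniteDimensional K (R ⧸ Ideal.span {f}) := Module.Finite.of_finite
  have hF : Finite ((R ⧸ Ideal.span {f}) →ₐ[K] Ω) := inferInstance
  let g : {π : R →ₐ[K] Ω | π f = 0} → ((R ⧸ Ideal.span {f}) →ₐ[K] Ω) := fun π =>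
    Ideal.Quotient.liftₐ (Ideal.span {f}) π.1 (by
      intro a ha
      obtain ⟨c, rfl⟩ := Ideal.mem_span_singleton.1 ha
      have := π.2
      simp only [Set.mem_setOf_eq] at this
      rw [map_mul, this, zero_mul])
  have hg : Function.Injective g := by
    intro π π' h
    ext r
    have := congrArg (fun h => h (Ideal.Quotient.mk _ r)) h
    exact this
  constructor
  · exact (Finite.of_injective g hg : Finite _)
  · rw [← Nat.card_coe_set_eq]
    exact (Nat.card_le_card_of_injective g hg).trans ((card_algHom_le_finrank K _ Ω).trans hdim)
theorem Cm_alg (H : AHb) (p : KX) : aR p ∈ Cm b p.natDegree := by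
  have := Cm_poly (p := p) le_rfl (Cm_one H)
  rwa [Algebra.smul_def, mul_one, zero_add] at this
theorem alg_inj (H : AHb) : Function.Injective (aR) := by
  intro p q hpq
  have := congrArg (fun f => b.repr f ⟨0, H.d1⟩) (show p • b ⟨0, H.d1⟩ = q • b ⟨0, H.d1⟩ by
    rw [Algebra.smul_def, Algebra.smul_def, hpq])
  simpa using this
theorem total_ge {Ω : Type} [Field Ω] [IsAlgClosed Ω] [Algebra K Ω] (H : AHb)
    (hlift : ∀ x0 y0 : Ω, (P.map (Polynomial.aeval x0 : KX →ₐ[K] Ω).toRingHom).eval y0 = 0 →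
      ∃ π : R →ₐ[K] Ω, π (aR X) = x0 ∧ π y = y0)
    (ε : KX) (u v : KXX) (hε : ε ≠ 0) (huv : u * P + v * P.derivative = C ε) (N : ℕ) (s : ℕ) (hs : s ≠ 0)
    (hN : N = Fintype.card K ^ s) :
    d * N ≤ {π : R →ₐ[K] Ω | π (aR X) ^ N = π (aR X)}.ncard + d * ε.natDegree := by
  classical
  have hN1 : 1 < N := by rw [hN]; exact Nat.one_lt_pow hs Fintype.one_lt_card
  have hN0 : (N : Ω) = 0 := by
    have := congrArg (algebraMap K Ω) (FiniteField.cast_card_eq_zero K)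
    rw [map_natCast, map_zero] at this
    rw [hN]; push_cast; rw [this, zero_pow hs]
  set w : Polynomial Ω := X ^ N - X with hw
  have hwd : w.natDegree = N := FiniteField.X_pow_card_sub_X_natDegree_eq Ω hN1
  have hw0 : w ≠ 0 := by intro h; rw [h] at hwd; simp at hwd; omega
  have hws : w.Separable := by
    obtain ⟨p, hp⟩ := CharP.exists Ω
    exact galois_poly_separable p N ((CharP.cast_eq_zero_iff Ω p N).1 hN0)
  have hwc : w.roots.toFinset.card = N := by
    rw [Multiset.toFinset_card_of_nodup (Polynomial.nodup_roots hws), ← hwd]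
    exact (IsAlgClosed.splits w).natDegree_eq_card_roots.symm
  set ε' := ε.map (algebraMap K Ω) with hε'
  have hε'0 : ε' ≠ 0 := (Polynomial.map_ne_zero_iff (algebraMap K Ω).injective).2 hε
  set S0 := w.roots.toFinset \ ε'.roots.toFinset with hS0
  have hS0c : N ≤ S0.card + ε.natDegree := by
    have h1 : w.roots.toFinset.card - ε'.roots.toFinset.card ≤ S0.card := Finset.le_card_sdiff _ _
    have h2 : ε'.roots.toFinset.card ≤ ε.natDegree := by
      refine (Multiset.toFinset_card_le _).trans ((Polynomial.card_roots' _).trans ?_)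
      exact Polynomial.natDegree_map_le
    omega
  let Px : Ω → Polynomial Ω := fun x0 => P.map (Polynomial.aeval x0 : KX →ₐ[K] Ω).toRingHom
  have hPx : ∀ x0 ∈ S0, (Px x0).roots.toFinset.card = d := by
    intro x0 hx0
    have hne : ε'.eval x0 ≠ 0 := by
      intro h
      rw [hS0, Finset.mem_sdiff] at hx0
      exact hx0.2 (by rw [Multiset.mem_toFinset, Polynomial.mem_roots hε'0]; exact h)
    have hm : (Px x0).Monic := H.hm.map _
    have hsep : (Px x0).Separable := by
      have h1 := congrArg (Polynomial.map (Polynomial.aeval x0 : KX →ₐ[K] Ω).toRingHom) huv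
      rw [Polynomial.map_add, Polynomial.map_mul, Polynomial.map_mul, ← Polynomial.derivative_map, Polynomial.map_C] at h1
      have h2 : (Polynomial.aeval x0 : KX →ₐ[K] Ω).toRingHom ε = ε'.eval x0 := by
        rw [hε', Polynomial.eval_map]; rfl
      rw [h2] at h1
      refine ⟨C (ε'.eval x0)⁻¹ * u.map (Polynomial.aeval x0 : KX →ₐ[K] Ω).toRingHom, C (ε'.eval x0)⁻¹ * v.map (Polynomial.aeval x0 : KX →ₐ[K] Ω).toRingHom, ?_⟩
      rw [mul_assoc, mul_assoc, ← mul_add, h1, ← Polynomial.C_mul, inv_mul_cancel₀ hne, Polynomial.C_1]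
    rw [Multiset.toFinset_card_of_nodup (Polynomial.nodup_roots hsep), ← (IsAlgClosed.splits (Px x0)).natDegree_eq_card_roots, ← H.hd]
    exact H.hm.natDegree_map _
  set T := S0.sigma (fun x0 => (Px x0).roots.toFinset) with hT
  have hTc : T.card = S0.card * d := by
    rw [hT, Finset.card_sigma, Finset.sum_congr rfl hPx, Finset.sum_const, smul_eq_mul]
  have hex : ∀ z : T, ∃ π : R →ₐ[K] Ω, π (aR X) = z.1.1 ∧ π y = z.1.2 := by
    intro z
    have hz := Finset.mem_sigma.1 z.2
    exact hlift _ _ (Polynomial.isRoot_of_mem_roots (Multiset.mem_toFinset.1 hz.2))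
  choose g hg using hex
  set tot := {π : R →ₐ[K] Ω | π (aR X) ^ N = π (aR X)} with htot
  have hfin : tot.Finite := by
    have h0 : aR (X ^ N - X) ≠ 0 := by
      rw [Ne, map_eq_zero_iff _ (alg_inj H)]
      exact FiniteField.X_pow_card_sub_X_ne_zero K hN1
    refine (homs_le H (Ω := Ω) (Cm_alg H _) h0).1.subset ?_
    intro π hπ
    simp only [htot, Set.mem_setOf_eq] at hπ ⊢
    rw [map_sub, map_pow, map_sub, map_pow, hπ, sub_self]
  have hinj : Function.Injective (fun z : T => (⟨g z, by
      have hz := (Finset.mem_sdiff.1 (Finset.mem_sigma.1 z.2).1).1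
      have := Polynomial.isRoot_of_mem_roots (Multiset.mem_toFinset.1 hz)
      simp only [htot, Set.mem_setOf_eq, (hg z).1]
      rw [hw, Polynomial.IsRoot, Polynomial.eval_sub, Polynomial.eval_pow, Polynomial.eval_X, sub_eq_zero] at this
      exact this⟩ : tot)) := by
    intro z z' h
    have h1 : g z = g z' := congrArg Subtype.val h
    apply Subtype.ext
    apply Sigma.ext
    · rw [← (hg z).1, ← (hg z').1, h1]
    · rw [heq_eq_eq, ← (hg z).2, ← (hg z').2, h1]
  have : Finite tot := hfin
  have h3 := Nat.card_le_card_of_injective _ hinj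
  rw [Nat.card_coe_set_eq, Nat.card_eq_fintype_card, Fintype.card_coe, hTc] at h3
  nlinarith
theorem stepanov {Ω : Type} [Field Ω] [IsAlgClosed Ω] [Algebra K Ω] (H : AHb)
    (hlift : ∀ x0 y0 : Ω, (P.map (Polynomial.aeval x0 : KX →ₐ[K] Ω).toRingHom).eval y0 = 0 →
      ∃ π : R →ₐ[K] Ω, π (aR X) = x0 ∧ π y = y0)
    (φ : R →ₐ[K] PK) (hφ : Function.Injective φ)
    (ε : KX) (u v : KXX) (hε : ε ≠ 0) (huv : u * P + v * P.derivative = C ε)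
    (ex : KX) (hex : ex ≠ 0) :
    ∃ c : ℕ, ∀ m, 1 ≤ m → ∀ M, M = Fintype.card K ^ m →
      M * M ≤ {π : R →ₐ[K] Ω | π (aR X) ^ (M * M) = π (aR X) ∧
        π y ^ (M * M) = π y ∧ π (aR ex) ≠ 0}.ncard + c * M := by
  obtain ⟨e, he1, he⟩ := ord_bound H φ hφ
  have hd1 := H.d1
  set E := e * d with hE
  have hE1 : 1 ≤ E := Nat.mul_pos he1 hd1
  set c := 2 * d ^ 2 * E * (d + 1) + 1 with hc
  refine ⟨d * ε.natDegree + (2 * d + c + d ^ 2) + d * ex.natDegree + (E * d + 1 + c + d), ?_⟩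
  intro m hm M hM
  have hM1 : 1 ≤ M := by rw [hM]; exact Nat.one_le_pow _ _ Fintype.card_pos
  by_cases hbig : E * d + 1 ≤ M ∧ c + d ≤ M
  swap
  · have : M ≤ E * d + 1 + c + d := by
      by_contra! hh
      exact hbig ⟨by omega, by omega⟩
    have := Nat.mul_le_mul_right M this
    rw [add_mul _ (E * d + 1 + c + d) M]
    omega
  obtain ⟨a, B, p1, p2, p3⟩ := param_ineq E d c M hE1 hd1 hc hbig.1 hbig.2
  obtain ⟨Θ, t1, t2, t3⟩ := exists_theta H φ hφ e he m a B M hM (by rw [← mul_assoc]; exact p1) p2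
  have htot := total_ge H hlift ε u v hε huv (M * M) (m + m) (by omega) (by rw [pow_add, hM])
  obtain ⟨b1, b2⟩ := homs_le (Ω := Ω) H t2 t1
  obtain ⟨k1, k2⟩ := homs_le (Ω := Ω) H (Cm_alg H ex) (by rwa [Ne, map_eq_zero_iff _ (alg_inj H)])
  set tot := {π : R →ₐ[K] Ω | π (aR X) ^ (M * M) = π (aR X)} with htot'
  set good := {π : R →ₐ[K] Ω | π (aR X) ^ (M * M) = π (aR X) ∧
        π y ^ (M * M) = π y ∧ π (aR ex) ≠ 0} with hgood
  have hfin : tot.Finite := by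
    have h2 : 1 < M * M := by
      rw [hM, ← pow_add]; exact Nat.one_lt_pow (by omega) Fintype.one_lt_card
    have h0 : aR (X ^ (M * M) - X) ≠ 0 := by
      rw [Ne, map_eq_zero_iff _ (alg_inj H)]
      exact FiniteField.X_pow_card_sub_X_ne_zero K h2
    refine (homs_le H (Ω := Ω) (Cm_alg H _) h0).1.subset ?_
    intro π hπ
    simp only [htot', Set.mem_setOf_eq] at hπ ⊢
    rw [map_sub, map_pow, map_sub, map_pow, hπ, sub_self]
  have hgf : good.Finite := hfin.subset fun π hπ => hπ.1
  have hsub : tot ⊆ good ∪ ({π : R →ₐ[K] Ω | π Θ = 0} ∪ {π : R →ₐ[K] Ω | π (aR ex) = 0}) := by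
    intro π hπ
    by_cases h1 : π (aR ex) = 0
    · right; right; exact h1
    by_cases h2 : π y ^ (M * M) = π y
    · left; exact ⟨hπ, h2, h1⟩
    · right; left; exact t3 π hπ h2
  have h1 := Set.ncard_le_ncard hsub (hgf.union (b1.union k1))
  have h2 := Set.ncard_union_le good ({π : R →ₐ[K] Ω | π Θ = 0} ∪ {π : R →ₐ[K] Ω | π (aR ex) = 0})
  have h3 := Set.ncard_union_le {π : R →ₐ[K] Ω | π Θ = 0} {π : R →ₐ[K] Ω | π (aR ex) = 0}
  have h4 : d * (M * M) ≤ good.ncard + ((d - 1) * (M * M) + (2 * d + c + d ^ 2) * M) + d * ex.natDegree + d * ε.natDegree := by omega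
  have h5 : d * (M * M) = (d - 1) * (M * M) + M * M := by
    obtain ⟨D, rfl⟩ : ∃ D, d = D + 1 := ⟨d - 1, by omega⟩
    simp only [Nat.add_sub_cancel]; ring
  have h6 : d * ε.natDegree ≤ d * ε.natDegree * M := Nat.le_mul_of_pos_right _ hM1
  have h7 : d * ex.natDegree ≤ d * ex.natDegree * M := Nat.le_mul_of_pos_right _ hM1
  have h8 : M * M ≤ good.ncard + (2 * d + c + d ^ 2) * M + d * ex.natDegree + d * ε.natDegree := by omega
  rw [add_mul _ (E * d + 1 + c + d) M, add_mul _ (d * ex.natDegree) M, add_mul (d * ε.natDegree)]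
  omega
end step4
open Polynomial (X C)
section conn
theorem ext_hom {K R O Ω : Type*} [Field K] [CommRing R] [CommRing O] [IsDomain O] [Algebra K R] [Algebra K O] (j : R →ₐ[K] O)
    (hj : Function.Injective j) (e : R) (he : ∀ o, ∃ r, j r = j e * o) [Field Ω] [Algebra K Ω] (π : R →ₐ[K] Ω) (h0 : π e ≠ 0) :
    ∃ π' : O →ₐ[K] Ω, ∀ r, π' (j r) = π r := by
  choose s hs using he
  have key : ∀ o r, j r = j e * o → π r / π e = π (s o) / π e := by
    intro o r h
    rw [← hs o] at h; rw [hj h]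
  have k2 : ∀ r, π (s (j r)) / π e = π r := by
    intro r
    rw [← key (j r) (e * r) (map_mul _ _ _), map_mul, mul_div_cancel_left₀ _ h0]
  refine ⟨{ toFun := fun o => π (s o) / π e, map_one' := ?_, map_zero' := ?_, map_mul' := ?_, map_add' := ?_, commutes' := ?_ }, k2⟩
  · have := k2 1; rwa [map_one, map_one] at this
  · intro o o'
    have h1 : e * s (o * o') = s o * s o' := by
      apply hj; rw [map_mul, map_mul, hs, hs, hs]; ring
    have := congrArg π h1
    rw [map_mul, map_mul] at this
    field_simp
    rw [mul_comm]; exact this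
  · have := k2 0; rwa [map_zero, map_zero] at this
  · intro o o'
    rw [← add_div, ← map_add]
    exact (key _ _ (by rw [map_add, hs, hs, mul_add])).symm
  · intro c
    have := k2 (algebraMap K R c); rwa [AlgHom.commutes, AlgHom.commutes] at this
theorem hom_count {K O Ω : Type*} [Field K] [Fintype K] [CommRing O] [IsDedekindDomain O] [Algebra K O] [Ring.HasFiniteQuotients O]
    [Field Ω] [Algebra K Ω] (s : ℕ) (hs : s ≠ 0) (S : Set (O →ₐ[K] Ω))
    (hS : ∀ π ∈ S, RingHom.ker π ≠ ⊥ ∧ ∀ o, π o ^ (Fintype.card K ^ s) = π o)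
    (T : Finset (HOS O)) (hT : ∀ P : HOS O, Nat.log cK cOP ≤ s → P ∈ T) :
    S.ncard ≤ ∑ P ∈ T.filter (fun P => Nat.log cK cOP ∣ s), Nat.log cK cOP := by
  classical
  have hfin : ∀ P : HOS O, Finite (O ⧸ P.asIdeal) := fun P => Ring.HasFiniteQuotients.finiteQuotient P.ne_bot
  have hlog : ∀ P : HOS O, Nat.log cK cOP = Module.finrank K (O ⧸ P.asIdeal) := by
    intro P
    have := Module.natCard_eq_pow_finrank (K := K) (V := O ⧸ P.asIdeal)
    rw [this, Nat.log_pow Finite.one_lt_card]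
  have hfd : ∀ P : HOS O, FiniteDimensional K (O ⧸ P.asIdeal) := fun P => Module.Finite.of_finite
  set T' := T.filter (fun P => Nat.log cK cOP ∣ s)
  have hker : ∀ π ∈ S, ∃ P ∈ T', P.asIdeal = RingHom.ker π := by
    intro π hπ
    obtain ⟨h1, h2⟩ := hS π hπ
    let P : HOS O := ⟨RingHom.ker π, RingHom.ker_isPrime _, h1⟩
    have hdv : Nat.log cK cOP ∣ s := by
      rw [hlog]
      haveI : P.asIdeal.IsMaximal := P.isMaximal
      letI : Field (O ⧸ P.asIdeal) := Ideal.Quotient.field _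
      rw [← FiniteField.orderOf_frobeniusAlgHom K (O ⧸ P.asIdeal), orderOf_dvd_iff_pow_eq_one]
      ext z
      have h3 := fro_apply (K := K) s z
      change fro K _ s z = z
      rw [h3]
      obtain ⟨o, rfl⟩ := Ideal.Quotient.mk_surjective z
      rw [← map_pow, Ideal.Quotient.eq, RingHom.mem_ker, map_sub, map_pow, h2, sub_self]
    exact ⟨P, Finset.mem_filter.2 ⟨hT P (Nat.le_of_dvd (by omega) hdv), hdv⟩, rfl⟩
  choose p hp1 hp2 using hker
  let g : S → Σ P : T', ((O ⧸ P.1.asIdeal) →ₐ[K] Ω) := fun π =>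
    ⟨⟨p π.1 π.2, hp1 _ π.2⟩, Ideal.Quotient.liftₐ _ π.1 (fun a ha => by rw [hp2 _ π.2] at ha; exact ha)⟩
  have hg : Function.Injective g := by
    intro π π' h
    have h3 : ∀ o : O, (g π).2 (Ideal.Quotient.mk _ o) = (g π').2 (Ideal.Quotient.mk _ o) := by
      intro o; rw [h]
    apply Subtype.ext
    ext o
    exact h3 o
  rw [← Nat.card_coe_set_eq]
  refine (Nat.card_le_card_of_injective g hg).trans ?_
  rw [Nat.card_sigma, ← Finset.sum_coe_sort T']
  refine Finset.sum_le_sum fun P _ => ?_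
  rw [hlog]
  exact card_algHom_le_finrank K _ Ω
theorem low_bound {K R O : Type} [Field K] [Fintype K] [CommRing R] [IsDomain R] [Algebra K R] [Algebra KX R]
    [IsScalarTower K KX R] {d : ℕ} {b : Module.Basis (Fin d) KX R} {y : R} {P : KXX}
    (H : AHb)
    (hlift : ∀ x0 y0 : AlgebraicClosure K, (P.map (Polynomial.aeval x0 : KX →ₐ[K] AlgebraicClosure K).toRingHom).eval y0 = 0 →
      ∃ π : R →ₐ[K] AlgebraicClosure K, π (aR X) = x0 ∧ π y = y0)
    (φ : R →ₐ[K] PK) (hφ : Function.Injective φ)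
    (ε : KX) (u v : KXX) (hε : ε ≠ 0) (huv : u * P + v * P.derivative = C ε)
    [CommRing O] [IsDedekindDomain O] [Algebra K O] [Ring.HasFiniteQuotients O] (j : R →ₐ[K] O) (hj : Function.Injective j)
    (ex : KX) (hex : ex ≠ 0) (he : ∀ o, ∃ r, j r = j (aR ex) * o)
    (T : ℕ → Finset (HOS O)) (hT : ∀ s, ∀ P : HOS O, Nat.log cK cOP ≤ s → P ∈ T s) :
    ∃ c : ℕ, ∀ m, 1 ≤ m → Fintype.card K ^ (2 * m) ≤
      (∑ P ∈ (T (2 * m)).filter (fun P => Nat.log cK cOP ∣ (2 * m)), Nat.log cK cOP)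
      + c * Fintype.card K ^ m := by
  obtain ⟨c, hc⟩ := stepanov H hlift φ hφ ε u v hε huv ex hex
  refine ⟨c, fun m hm => ?_⟩
  have h1 := hc m hm _ rfl
  set M := Fintype.card K ^ m
  have hMM : M * M = Fintype.card K ^ (2 * m) := by rw [two_mul, pow_add]
  rw [hMM] at h1
  set good := {π : R →ₐ[K] AlgebraicClosure K | π (aR X) ^ (Fintype.card K ^ (2 * m)) = π (aR X) ∧
        π y ^ (Fintype.card K ^ (2 * m)) = π y ∧ π (aR ex) ≠ 0} with hgood
  have hext : ∀ π ∈ good, ∃ π' : O →ₐ[K] AlgebraicClosure K, ∀ r, π' (j r) = π r := fun π hπ => ext_hom j hj _ he π hπ.2.2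
  choose E hE using fun π : good => hext π.1 π.2
  have hEinj : Function.Injective E := by
    intro π π' h
    apply Subtype.ext
    ext r
    rw [← hE π, ← hE π', h]
  have h2 := hom_count (K := K) (2 * m) (by omega) (Set.range E) (by
    rintro _ ⟨⟨π, hπ⟩, rfl⟩
    have hpol : ∀ p : KX, π (aR p) ^ (Fintype.card K ^ (2 * m)) = π (aR p) := by
      intro p
      rw [algMap_eq, ← Polynomial.aeval_algHom_apply, ← fro_apply, ← Polynomial.aeval_algHom_apply, fro_apply, hπ.1]
    have hR : ∀ r : R, π r ^ (Fintype.card K ^ (2 * m)) = π r := by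
      intro r
      rw [← b.sum_repr r, map_sum, ← fro_apply, map_sum]
      refine Finset.sum_congr rfl fun i _ => ?_
      rw [fro_apply, Algebra.smul_def, map_mul, mul_pow, hpol, H.hb, map_pow, ← pow_mul, mul_comm (i : ℕ), pow_mul, hπ.2.1]
    constructor
    · intro hbot
      have : j (aR (X ^ (Fintype.card K ^ (2 * m)) - X)) ∈ RingHom.ker (E ⟨π, hπ⟩) := by
        rw [RingHom.mem_ker, hE ⟨π, hπ⟩, map_sub, map_pow, map_sub, map_pow, hπ.1, sub_self]
      rw [hbot, Ideal.mem_bot, map_eq_zero_iff j hj, map_eq_zero_iff _ (alg_inj H)] at this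
      exact FiniteField.X_pow_card_sub_X_ne_zero K (Nat.one_lt_pow (by omega) Fintype.one_lt_card) this
    · intro o
      obtain ⟨r, hr⟩ := he o
      have h3 := congrArg (E ⟨π, hπ⟩) hr
      rw [map_mul, hE ⟨π, hπ⟩, hE ⟨π, hπ⟩] at h3
      have h4 := hR r
      rw [h3, mul_pow, hpol] at h4
      exact mul_left_cancel₀ hπ.2.2 h4) (T (2 * m)) (hT (2 * m))
  rw [← Nat.card_coe_set_eq, Nat.card_range_of_injective hEinj, Nat.card_coe_set_eq] at h2
  omega
end conn
open Polynomial (X C)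
section pla
theorem rat_place {K R O : Type} [Field K] [Fintype K] [CommRing R] [IsDomain R] [Algebra K R] [Algebra KX R]
    (hinj : Function.Injective (aR))
    (φ : R →ₐ[K] PK) (hφ : Function.Injective φ)
    [CommRing O] [IsDedekindDomain O] [Algebra K O] [Algebra KX O] [Algebra.IsIntegral KX O]
    (j : R →ₐ[K] O) (hj : Function.Injective j)
    (hjp : ∀ p, j (aR p) = algebraMap KX O p)
    (ex : KX) (hex : ex ≠ 0) (he : ∀ o, ∃ r, j r = j (aR ex) * o) :
    ∃ P : HOS O, cOP = Nat.card K := by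
  let Ω := FractionRing PK
  let ι : PK →ₐ[K] Ω := IsScalarTower.toAlgHom K PK Ω
  have hι : Function.Injective (algebraMap PK Ω) := IsFractionRing.injective _ _
  have hιφ : Function.Injective (ι.comp φ) := hι.comp hφ
  obtain ⟨π, hπ⟩ := ext_hom j hj _ he (ι.comp φ) (by
    rw [Ne, map_eq_zero_iff _ hιφ, map_eq_zero_iff _ hinj]; exact hex)
  have hint : ∀ o, ∃ s : PK, algebraMap PK Ω s = π o := by
    intro o
    apply IsIntegrallyClosed.isIntegral_iff.1
    obtain ⟨p, hp, h0⟩ := Algebra.IsIntegral.isIntegral (R := KX) o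
    refine ⟨p.map (φ.toRingHom.comp (aR)), hp.map _, ?_⟩
    have h1 := congrArg π h0
    rw [map_zero, ← AlgHom.coe_toRingHom, Polynomial.hom_eval₂] at h1
    rw [Polynomial.eval₂_map]
    have h2 : (algebraMap PK Ω).comp (φ.toRingHom.comp (aR)) =
        π.toRingHom.comp (algebraMap KX O) := by
      refine RingHom.ext fun p => ?_
      have := hπ (aR p)
      rw [hjp] at this
      exact this.symm
    rw [h2]
    exact h1
  choose ψ hψ using hint
  let ψ' : O →ₐ[K] PK :=
    { toFun := ψ
      map_one' := hι (by rw [hψ, map_one, map_one])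
      map_zero' := hι (by rw [hψ, map_zero, map_zero])
      map_mul' := fun a b => hι (by rw [hψ, map_mul, map_mul, hψ, hψ])
      map_add' := fun a b => hι (by rw [hψ, map_add, map_add, hψ, hψ])
      commutes' := fun c => hι (by rw [hψ, AlgHom.commutes]; exact (IsScalarTower.algebraMap_apply K PK Ω c)) }
  let ρ : O →+* K := (PowerSeries.constantCoeff (R := K)).comp ψ'.toRingHom
  have hρc : ∀ c : K, ρ (algebraMap K O c) = c := by
    intro c
    have h1 : ψ' (algebraMap K O c) = algebraMap K PK c := ψ'.commutes c
    change PowerSeries.constantCoeff (ψ' (algebraMap K O c)) = c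
    rw [h1]; simp [PowerSeries.algebraMap_apply]
  have hsurj : Function.Surjective ρ := fun c => ⟨_, hρc c⟩
  have hker : RingHom.ker ρ ≠ ⊥ := by
    intro hb
    have hpw : ∀ z : K, z ^ Fintype.card K - z = 0 := fun z => by rw [FiniteField.pow_card, sub_self]
    have hm : j (aR (X ^ Fintype.card K - X)) ∈ RingHom.ker ρ := by
      rw [RingHom.mem_ker, map_sub, map_pow, map_sub, map_pow, map_sub, map_pow]
      exact hpw _
    rw [hb, Ideal.mem_bot, map_eq_zero_iff _ hj, map_eq_zero_iff _ hinj] at hm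
    exact FiniteField.X_pow_card_sub_X_ne_zero K Fintype.one_lt_card hm
  exact ⟨⟨RingHom.ker ρ, RingHom.ker_isPrime _, hker⟩, Nat.card_congr (RingHom.quotientKerEquivOfSurjective hsurj).toEquiv⟩
theorem stab {K F : Type*} [Field K] [Finite K] [Field F] [Module K F] (G H : AddSubgroup F)
    (hG : ∀ (c : K), ∀ h ∈ G, c • h ∈ G) (hH : ∀ (c : K), ∀ h ∈ H, c • h ∈ H)
    (h0 : G.relIndex H ≠ 0) (hl : Nat.log cK (G.relIndex H) = 0) : H ≤ G := by
  intro h hh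
  by_contra hn
  have hlt : G.relIndex H < Nat.card K := by
    rcases Nat.log_eq_zero_iff.1 hl with h | h
    · exact h
    · have := Finite.one_lt_card (α := K); omega
  have hfin : Finite (H ⧸ G.addSubgroupOf H) := Nat.finite_of_card_ne_zero h0
  have : Function.Injective (fun c : K => (QuotientAddGroup.mk ⟨c • h, hH c h hh⟩ : H ⧸ G.addSubgroupOf H)) := by
    intro c c' hcc
    rw [QuotientAddGroup.eq, AddSubgroup.mem_addSubgroupOf] at hcc
    have h1 : (-c + c') • h ∈ G := by rw [add_smul, neg_smul]; exact hcc
    by_contra hne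
    apply hn
    have h2 := hG (-c + c')⁻¹ _ h1
    rwa [smul_smul, inv_mul_cancel₀, one_smul] at h2
    intro h3; exact hne (neg_add_eq_zero.1 h3)
  have := Nat.card_le_card_of_injective _ this
  have e : Nat.card (H ⧸ G.addSubgroupOf H) = G.relIndex H := rfl
  omega
variable {K L F O O' : Type*} [Field K] [Field L] [Algebra KX L] [IsFractionRing KX L]
  [Field F] [Algebra L F] [Algebra KX F] [IsScalarTower KX L F]
  [Algebra K F] [IsScalarTower K KX F] {d : ℕ}
  [CommRing O] [IsDedekindDomain O] [Algebra O F] [IsFractionRing O F]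
  [CommRing O'] [IsDedekindDomain O'] [Algebra O' F] [IsFractionRing O' F]
  {Q : ℕ} {vi : VL} {P : KXX} {y : F}
    {b : BdF} {d₁ : HOS O → ℕ} {d₂ : HOS O' → ℕ} {w' : O'}
theorem GH.wmem (h : GHw) (p : HOS O') : w' ∈ p.asIdeal := by
  by_contra hn
  haveI : p.asIdeal.IsMaximal := p.isMaximal
  letI : Field (O' ⧸ p.asIdeal) := Ideal.Quotient.field _
  have hfin : Finite (O' ⧸ p.asIdeal) := by
    apply Nat.finite_of_card_ne_zero
    rw [h.hd₂]
    have := h.hQ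
    positivity
  letI := Fintype.ofFinite (O' ⧸ p.asIdeal)
  set k := Fintype.card (O' ⧸ p.asIdeal) - 1
  have hk : 1 ≤ k := by have := Fintype.one_lt_card (α := O' ⧸ p.asIdeal); omega
  have h1 : w' ^ k - 1 ∈ p.asIdeal := by
    rw [← Ideal.Quotient.eq, map_pow, map_one]
    apply FiniteField.pow_card_sub_one_eq_one
    rwa [Ne, Ideal.Quotient.eq_zero_iff_mem]
  have hX' : aL X ≠ 0 := by
    rw [Ne, FaithfulSMul.algebraMap_eq_zero_iff]; exact Polynomial.X_ne_zero
  set z : L := (aL X)⁻¹ ^ k - 1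
  have hz : vi z = 1 := by
    have hlt : vi ((aL X)⁻¹ ^ k) < vi 1 := by
      rw [map_pow, map_inv₀, h.ch.vX, ← exp_neg, ← exp_nsmul, map_one, ← exp_zero, exp_lt_exp]
      simp; omega
    rw [Valuation.map_sub_eq_of_lt_right vi hlt, map_one]
  have hz0 : z ≠ 0 := by intro h0; rw [h0, map_zero] at hz; exact zero_ne_one hz
  obtain ⟨g, hg⟩ := h.p1 z⁻¹ (by rw [map_inv₀, hz, inv_one])
  have hu : g * (w' ^ k - 1) = 1 := by
    apply FaithfulSMul.algebraMap_injective O' F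
    rw [map_mul, hg, map_sub, map_pow, h.hw, map_one, map_inv₀]
    have : algebraMap L F z = (aF X)⁻¹ ^ k - 1 := by
      simp only [z]
      rw [map_sub, map_pow, map_inv₀, map_one, ← IsScalarTower.algebraMap_apply]
    rw [← this]
    exact inv_mul_cancel₀ (by rwa [Ne, map_eq_zero])
  apply p.isPrime.ne_top
  rw [Ideal.eq_top_iff_one, ← hu]
  exact Ideal.mul_mem_left _ _ h1
theorem GH.inf_count (h : GHw) (S : Finset (HOS O')) (hS : ∀ p ∈ S, d₂ p = 1) :
    S.card ≤ d := by
  classical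
  have hE := h.degE
  set E := dv (dval O' F) (aF X) with hEd
  have hE1 : ∀ p, 1 ≤ E p := by
    intro p
    have h1 : p.valuation F (algebraMap O' F w') < 1 := by
      rw [HeightOneSpectrum.valuation_lt_one_iff_mem]; exact h.wmem p
    rw [h.hw, map_inv₀] at h1
    have h2 := exp_dv (finSup_dval O' F) h.hX p
    rw [← hEd] at h2
    have h3 : (exp (E p))⁻¹ < (1 : ℤᵐ⁰) := by rw [h2]; exact h1
    rw [← exp_neg, ← exp_zero, exp_lt_exp] at h3
    omega
  have h4 : (∑ p ∈ S, Finsupp.single p (1 : ℤ)) ≤ E := by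
    intro p
    rw [Finsupp.finset_sum_apply]
    have : ∑ i ∈ S, (Finsupp.single i (1 : ℤ)) p = if p ∈ S then 1 else 0 := by
      simp [Finsupp.single_apply]
    rw [this]
    have := hE1 p
    split_ifs <;> omega
  have h5 := dgr_mono d₂ h4
  have h6 : ∀ S : Finset (HOS O'), (∀ p ∈ S, d₂ p = 1) → dgr d₂ (∑ p ∈ S, Finsupp.single p (1 : ℤ)) = S.card := by
    intro S
    induction S using Finset.induction_on with
    | empty => intro _; simp [dgr_zero]
    | insert p S hp ih =>
      intro hS
      rw [Finset.sum_insert hp, dgr_add, dgr_single, ih (fun p hp => hS p (Finset.mem_insert_of_mem hp)), hS p (Finset.mem_insert_self _ _), Finset.card_insert_of_notMem hp]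
      push_cast; ring
  rw [hE, h6 S hS] at h5
  exact_mod_cast h5
end pla
open Polynomial (X C)
section finc
variable {K L F O O' : Type*} [Field K] [Fintype K] [Field L] [Algebra KX L] [IsFractionRing KX L]
  [Field F] [Algebra L F] [Algebra KX F] [IsScalarTower KX L F]
  [Algebra K F] [IsScalarTower K KX F] {d : ℕ}
  [CommRing O] [IsDedekindDomain O] [Algebra O F] [IsFractionRing O F]
  [CommRing O'] [IsDedekindDomain O'] [Algebra O' F] [IsFractionRing O' F]
  [Algebra KX O] [IsScalarTower KX O F] [Algebra K O] [IsScalarTower K KX O]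
  {vi : VL} {P : KXX} {y : F}
    {b : BdF} {d₁ : HOS O → ℕ} {d₂ : HOS O' → ℕ} {w' : O'}
theorem resid_hom (p : HOS O) (hp : Nat.card (O ⧸ p.asIdeal) = Nat.card K) :
    ∃ ρ : O →ₐ[K] K, ∀ o, ρ o = 0 ↔ o ∈ p.asIdeal := by
  haveI : p.asIdeal.IsMaximal := p.isMaximal
  letI : Field (O ⧸ p.asIdeal) := Ideal.Quotient.field _
  have hfin : Finite (O ⧸ p.asIdeal) := by
    apply Nat.finite_of_card_ne_zero
    rw [hp]; exact Nat.card_pos.ne'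
  have hb : Function.Bijective (algebraMap K (O ⧸ p.asIdeal)) :=
    (Nat.bijective_iff_injective_and_card _).2 ⟨(algebraMap K (O ⧸ p.asIdeal)).injective, hp.symm⟩
  let E : K ≃ₐ[K] (O ⧸ p.asIdeal) := AlgEquiv.ofBijective (Algebra.ofId K _) hb
  refine ⟨E.symm.toAlgHom.comp (Ideal.Quotient.mkₐ K p.asIdeal), fun o => ?_⟩
  change E.symm (Ideal.Quotient.mk p.asIdeal o) = 0 ↔ _
  rw [map_eq_zero_iff _ E.symm.injective, Ideal.Quotient.eq_zero_iff_mem]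
theorem GH.fin_count (h : GH cK d vi P y b O O' d₁ d₂ w') (S : Finset (HOS O))
    (hS : ∀ p ∈ S, Nat.card (O ⧸ p.asIdeal) = Nat.card K) :
    S.card ≤ NZP + del1 K b O cK := by
  classical
  have hinj : Function.Injective (algebraMap O F) := FaithfulSMul.algebraMap_injective O F
  obtain ⟨y', hy'⟩ := h.oy
  have hne : ∀ p : HOS O, ∃ ρ : O →+ K, p ∈ S → (∃ ρ' : O →ₐ[K] K, (∀ o, ρ o = ρ' o) ∧ ∀ o, ρ' o = 0 ↔ o ∈ p.asIdeal) := by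
    intro p
    by_cases hp : p ∈ S
    · obtain ⟨ρ, h1⟩ := resid_hom (K := K) p (hS p hp)
      exact ⟨ρ.toRingHom.toAddMonoidHom, fun _ => ⟨ρ, fun o => rfl, h1⟩⟩
    · exact ⟨0, fun hp' => absurd hp' hp⟩
  choose ρ hρ using hne
  let pt : HOS O → K × K := fun p => (ρ p (algebraMap KX O X), ρ p y')
  let Z : Set (K × K) := {z | (P.map (Polynomial.evalRingHom z.1)).eval z.2 = 0}
  have hev : ∀ p ∈ S, ∀ g : KX, ρ p (algebraMap KX O g) = g.eval (pt p).1 := by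
    intro p hp g
    obtain ⟨ρ', h1, h2⟩ := hρ p hp
    rw [h1, algMap_eq, ← Polynomial.aeval_algHom_apply, ← h1, Polynomial.coe_aeval_eq_eval]
  have hptZ : ∀ p ∈ S, pt p ∈ Z := by
    intro p hp
    obtain ⟨ρ', h1, h2⟩ := hρ p hp
    have e0 : Polynomial.aeval y' P = 0 := by
      apply hinj
      rw [map_zero, ← Polynomial.aeval_algebraMap_apply, hy']; exact h.ch.hy
    have e1 := congrArg ρ' e0
    rw [map_zero, Polynomial.aeval_def, ← AlgHom.coe_toRingHom, Polynomial.hom_eval₂] at e1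
    change (P.map (Polynomial.evalRingHom (pt p).1)).eval (pt p).2 = 0
    rw [Polynomial.eval_map]
    have e2 : Polynomial.evalRingHom (pt p).1 = (ρ' : O →+* K).comp (algebraMap KX O) := by
      refine RingHom.ext fun g => ?_
      rw [Polynomial.coe_evalRingHom, ← hev p hp g, h1]; rfl
    rw [e2]
    have e3 : (pt p).2 = (ρ' : O →+* K) y' := h1 y'
    rw [e3]; exact e1
  have hcardZ : NZP = Z.toFinset.card := by
    rw [Set.toFinset_card, ← Nat.card_eq_fintype_card]; rfl
  rw [hcardZ]
  rcases S.eq_empty_or_nonempty with rfl | ⟨p0, hp0⟩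
  · simp
  haveI : Nonempty (HOS O) := ⟨p0⟩
  let rep : HOS O → HOS O := fun p => Function.invFunOn pt (S : Set (HOS O)) (pt p)
  have hr1 : ∀ p ∈ S, rep p ∈ S := fun p hp => Function.invFunOn_mem ⟨p, hp, rfl⟩
  have hr2 : ∀ p ∈ S, pt (rep p) = pt p := fun p hp => Function.invFunOn_eq (s := (S : Set (HOS O))) ⟨p, hp, rfl⟩
  have hr3 : ∀ p ∈ S, rep (rep p) = rep p := fun p hp => by
    change Function.invFunOn pt _ (pt (rep p)) = _
    rw [hr2 p hp]
  set S1 := S.filter (fun p => rep p = p)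
  set S2 := S.filter (fun p => ¬ rep p = p)
  have hc1 : S1.card + S2.card = S.card := Finset.card_filter_add_card_filter_not _
  have hc2 : S1.card ≤ Z.toFinset.card := by
    apply Finset.card_le_card_of_injOn pt
    · intro p hp
      rw [Finset.mem_coe, Finset.mem_filter] at hp
      rw [Finset.mem_coe, Set.mem_toFinset]; exact hptZ p hp.1
    · intro p hp p' hp' he
      rw [Finset.mem_coe, Finset.mem_filter] at hp hp'
      rw [← hp.2, ← hp'.2]
      change Function.invFunOn pt _ (pt p) = Function.invFunOn pt _ (pt p')
      rw [he]
  let T : O →+ (S2 → K) := 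
    { toFun := fun o p => ρ p.1 o - ρ (rep p.1) o
      map_zero' := by ext p; simp
      map_add' := fun o o' => by ext p; simp; ring }
  have hTs : Function.Surjective T := by
    intro c
    obtain ⟨o, ho⟩ := IsDedekindDomain.exists_forall_sub_mem_ideal (s := S) (fun p : HOS O => p.asIdeal) (fun _ => 1)
      (fun p _ => p.prime) (fun p _ p' _ hpp h => hpp (HeightOneSpectrum.ext h))
      (fun p => if hp : p.1 ∈ S2 then algebraMap K O (c ⟨p.1, hp⟩) else 0)
    refine ⟨o, ?_⟩
    ext ⟨p, hp⟩
    have hp' := Finset.mem_filter.1 hp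
    have k1 : ∀ p (hp : p ∈ S), ρ p o = if hp : p ∈ S2 then c ⟨p, hp⟩ else 0 := by
      intro p hp
      have h1 := ho p hp
      rw [pow_one] at h1
      obtain ⟨ρ', h2, h3⟩ := hρ p hp
      rw [← h3, map_sub, sub_eq_zero] at h1
      rw [h2, h1]
      split_ifs
      · exact ρ'.commutes _
      · exact map_zero _
    change ρ p o - ρ (rep p) o = _
    rw [k1 p hp'.1, k1 (rep p) (hr1 p hp'.1), dif_pos hp, dif_neg, sub_zero]
    intro h4
    exact (Finset.mem_filter.1 h4).2 (hr3 p hp'.1)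
  have hker : (RR K b).comap (algebraMap O F).toAddMonoidHom ≤ T.ker := by
    intro o ho
    rw [AddSubgroup.mem_comap] at ho
    have ho' : algebraMap O F o ∈ RR K b := ho
    choose g hg using ho'
    have e1 : o = ∑ i ∈ Finset.range d, algebraMap KX O (g i) * y' ^ i := by
      apply hinj
      rw [co_sum h.ch.hb (algebraMap O F o), map_sum]
      refine Finset.sum_congr rfl fun i _ => ?_
      rw [← hg i, Algebra.smul_def, map_mul, map_pow, hy', ← IsScalarTower.algebraMap_apply, ← IsScalarTower.algebraMap_apply]
    have e2 : ∀ p ∈ S, ρ p o = ∑ i ∈ Finset.range d, (g i).eval (pt p).1 * (pt p).2 ^ i := by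
      intro p hp
      obtain ⟨ρ', h1, h2⟩ := hρ p hp
      rw [h1, e1, map_sum]
      refine Finset.sum_congr rfl fun i _ => ?_
      rw [map_mul, map_pow, ← h1, ← h1, hev p hp]
    rw [AddMonoidHom.mem_ker]
    ext ⟨p, hp⟩
    have hp' := Finset.mem_filter.1 hp
    change ρ p o - ρ (rep p) o = 0
    rw [e2 p hp'.1, e2 _ (hr1 p hp'.1), hr2 p hp'.1, sub_self]
  have hidx : ((RR K b).comap (algebraMap O F).toAddMonoidHom).index = (RR K b).relIndex (Mlat (dval O F) (0 : HOS O →₀ ℤ)) := by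
    rw [AddSubgroup.index_comap]
    congr 1
    ext f
    rw [mem_Mlat_zero]
    rfl
  have h5 : Nat.card K ^ S2.card ≤ (RR K b).relIndex (Mlat (dval O F) (0 : HOS O →₀ ℤ)) := by
    rw [← hidx]
    have h6 := AddSubgroup.index_dvd_of_le hker
    have h7 : T.ker.index = Nat.card K ^ S2.card := by
      rw [AddSubgroup.index_ker, AddMonoidHom.range_eq_top.2 hTs, Nat.card_congr (AddSubgroup.topEquiv).toEquiv, Nat.card_fun]
      simp
    rw [← h7]
    refine Nat.le_of_dvd (Nat.pos_of_ne_zero ?_) h6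
    rw [hidx]; exact h.idx1
  have h8 : S2.card ≤ del1 K b O cK := Nat.le_log_of_pow_le h.hQ h5
  omega
end finc
open Polynomial (X C)
section delta0
variable {K L F O O' : Type*} [Field K] [Fintype K] [Field L] [Algebra KX L] [IsFractionRing KX L]
  [Field F] [Algebra L F] [Algebra KX F] [IsScalarTower KX L F]
  [Algebra K F] [IsScalarTower K KX F] {d : ℕ}
  [CommRing O] [IsDedekindDomain O] [Algebra O F] [IsFractionRing O F]
  [CommRing O'] [IsDedekindDomain O'] [Algebra O' F] [IsFractionRing O' F]
  {vi : VL} {P : KXX} {y : F}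
    {b : BdF} {d₁ : HOS O → ℕ} {d₂ : HOS O' → ℕ} {w' : O'}
theorem int_root {B F : Type*} [CommRing B] [IsDedekindDomain B] [Field F] [Algebra B F] [IsFractionRing B F] (N : ℕ) (hN : 1 ≤ N) (u : F)
    (h : u ^ N ∈ (algebraMap B F).range) : u ∈ (algebraMap B F).range := by
  obtain ⟨c, hc⟩ := h
  have : IsIntegral B u := by
    refine IsIntegral.of_pow (n := N) (by omega) ?_
    rw [← hc]; exact isIntegral_algebraMap
  obtain ⟨z, hz⟩ := IsIntegrallyClosed.isIntegral_iff.1 this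
  exact ⟨z, hz⟩
theorem GH.del0 (h : GH cK d vi P y b O O' d₁ d₂ w') (hδ : del1 K b O cK + del2 b vi O' cK = 0)
    (N : ℕ) (hN : 1 ≤ N) (u : F) (hu : aF X * u ^ N = y) :
    ∃ α β γ : K, aF X * u = aF (C α + C β * X) + aF (C γ) * y := by
  have hX := h.hX
  have e1 : Mlat (dval O F) (0 : HOS O →₀ ℤ) ≤ RR K b := by
    refine stab (K := K) _ _ ?_ ?_ h.idx1 (by unfold del1 at hδ; omega)
    · intro c f hf
      have := RR_smul (C c) f hf
      rwa [← Polynomial.algebraMap_eq, algebraMap_smul] at this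
    · intro c f hf
      rw [← algebraMap_smul KX, Algebra.smul_def]
      exact smul_Mlat (h.o1 _) hf
  have e2 : Mlat (dval O' F) (0 : HOS O' →₀ ℤ) ≤ RI b vi 0 := by
    refine stab (K := K) _ _ ?_ ?_ h.idx2 (by unfold del2 at hδ; omega)
    · intro c f hf
      have := RI_smul1 (b := b) (vi := vi) 0 (aL (C c)) (by rw [← exp_zero]; apply h.ch.vle; simp) f hf
      rwa [algebraMap_smul, ← Polynomial.algebraMap_eq, algebraMap_smul] at this
    · intro c f hf
      rw [← algebraMap_smul KX, Algebra.smul_def]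
      refine smul_Mlat ?_ hf
      rw [IsScalarTower.algebraMap_apply KX L F]
      exact h.p1 _ (by rw [← exp_zero]; apply h.ch.vle; simp)
  have hu1 : u ∈ RI b vi 0 := by
    apply e2
    rw [mem_Mlat_zero]
    apply int_root N hN
    have : u ^ N = (aF X)⁻¹ * y := by rw [← hu]; field_simp
    rw [this]; exact h.py
  have hg1 : aF X * u ∈ RI b vi 1 := by
    have := (RI_smul h.ch 0 1 u).2 hu1
    simpa using this
  have hg2 : aF X * u ∈ RR K b := by
    apply e1
    rw [mem_Mlat_zero]
    apply int_root N hN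
    have : (aF X * u) ^ N = aF X ^ (N - 1) * y := by
      obtain ⟨M, rfl⟩ : ∃ M, N = M + 1 := ⟨N - 1, by omega⟩
      rw [← hu]; simp; ring
    rw [this]
    exact Subring.mul_mem _ (Subring.pow_mem _ (h.o1 _) _) h.oy
  set g := aF X * u
  choose p hp using hg2
  have hpd : ∀ j : ℕ, p j ≠ 0 → ((p j).natDegree : ℤ) ≤ 1 - j := by
    intro j hj
    have := hg1 j
    rw [mem_BV, ← hp j, h.ch.vp _ hj, exp_le_exp] at this
    exact this
  refine ⟨(p 0).coeff 0, (p 0).coeff 1, (p 1).coeff 0, ?_⟩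
  have h0 : p 0 = C ((p 0).coeff 0) + C ((p 0).coeff 1) * X := by
    by_cases h0 : p 0 = 0
    · rw [h0]; simp
    have := hpd 0 h0
    conv_lhs => rw [Polynomial.eq_X_add_C_of_natDegree_le_one (p := p 0) (by push_cast at this; omega)]
    ring
  have h1 : p 1 = C ((p 1).coeff 0) := by
    by_cases h0 : p 1 = 0
    · rw [h0]; simp
    have := hpd 1 h0
    exact Polynomial.eq_C_of_natDegree_eq_zero (by push_cast at this; omega)
  have h2 : ∀ j, 2 ≤ j → p j = 0 := by
    intro j hj
    by_contra h0
    have := hpd j h0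
    omega
  rw [← h0, ← h1]
  have hs := co_sum h.ch.hb g
  have hs' : g = ∑ i ∈ Finset.range d, aF (p i) * y ^ i := by
    rw [hs]
    refine Finset.sum_congr rfl fun i _ => ?_
    rw [← hp i, Algebra.smul_def, ← IsScalarTower.algebraMap_apply]
  have hbig : g = ∑ i ∈ Finset.range (d + 2), aF (p i) * y ^ i := by
    rw [hs']
    refine Finset.sum_subset (by intro i; simp; omega) fun i _ hi => ?_
    have hz : p i = 0 := by
      have h3 := hp i
      unfold co at h3
      rw [dif_neg (by simpa using hi), LinearMap.zero_apply, FaithfulSMul.algebraMap_eq_zero_iff] at h3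
      exact h3
    rw [hz]; simp
  rw [hbig, Finset.sum_subset (s₁ := Finset.range 2) (by intro i; simp; omega) (fun i _ hi => by rw [h2 i (by simp at hi; omega)]; simp) |>.symm]
  simp [Finset.sum_range_succ]
end delta0
section cor
variable {K L A F O R : Type} [Field K] [Fintype K] [Field L] [Algebra KX L] [IsFractionRing KX L]
  [CommRing A] [IsDomain A] [IsPrincipalIdealRing A] [Algebra A L] [IsFractionRing A L]
  [Field F] [Algebra L F] [Algebra KX F] [IsScalarTower KX L F]
  [Algebra A F] [IsScalarTower A L F]
  [Algebra K F] [IsScalarTower K KX F] {d : ℕ}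
  [CommRing O] [IsDedekindDomain O] [Algebra O F] [IsFractionRing O F]
  [Algebra KX O] [IsScalarTower KX O F] [IsIntegralClosure O KX F] [Module.Finite KX O]
  [Algebra K O] [IsScalarTower K KX O]
  {vi : VL} {P : KXX} {y : F} {b : BdF}
  [CommRing R] [IsDomain R] [Algebra K R] [Algebra KX R] [IsScalarTower K KX R]
  {bR : Module.Basis (Fin d) KX R} {yR : R}
theorem core_abs (O' : Type) [CommRing O'] [IsDedekindDomain O'] [Algebra O' F] [IsFractionRing O' F]
    [Algebra A O'] [IsScalarTower A O' F] [IsIntegralClosure O' A F] [Module.Finite A O'] [Algebra.IsSeparable L F] (hCH : CH d vi P y b) (hA : ∀ z : L, vi z ≤ 1 ↔ z ∈ (algebraMap A L).range)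
    (H : AH bR yR P)
    (hlift : ∀ x0 y0 : AlgebraicClosure K, (P.map (Polynomial.aeval x0 : KX →ₐ[K] AlgebraicClosure K).toRingHom).eval y0 = 0 →
      ∃ π : R →ₐ[K] AlgebraicClosure K, π (aR X) = x0 ∧ π yR = y0)
    (φ : R →ₐ[K] PK) (hφ : Function.Injective φ)
    (ε : KX) (u v : KXX) (hε : ε ≠ 0) (huv : u * P + v * P.derivative = C ε)
    (j : R →ₐ[K] O) (hj : Function.Injective j)
    (hjp : ∀ p, j (aR p) = algebraMap KX O p)
    (hjy : algebraMap O F (j yR) = y) :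
    ∃ δ : ℕ, (δ : ℤ) ≤ ((d : ℤ) - 1) * (d - 2) ∧
      (Nat.card K : ℝ) + 1 - (((d : ℝ) - 1) * (d - 2) - δ) * Real.sqrt cK ≤
        NZP + δ + d ∧
      (δ = 0 → ∀ N, 1 ≤ N → ∀ num den : R, den ≠ 0 → aR X * num ^ N = yR * den ^ N →
        ∃ α β γ : K, aR X * num =
          (aR (C α + C β * X) + aR (C γ) * yR) * den) := by
  classical
  obtain ⟨hfO, hfO', w', h⟩ := mkGH (A := A) (O := O) (O' := O') hCH hA
  have hOinj : Function.Injective (algebraMap O F) := FaithfulSMul.algebraMap_injective O F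
  set d₁ : HOS O → ℕ := fun P => Nat.log cK cOP with hd₁
  set d₂ : HOS O' → ℕ := fun P => Nat.log cK (Nat.card (O' ⧸ P.asIdeal)) with hd₂
  have hQ := h.hQ
  have hjp' : ∀ p, algebraMap O F (j (aR p)) = aF p := by
    intro p; rw [hjp, ← IsScalarTower.algebraMap_apply]
  obtain ⟨ex, hex, he0⟩ := h.e1
  have he : ∀ o, ∃ r, j r = j (aR ex) * o := by
    intro o
    have h1 := he0 _ ⟨o, rfl⟩
    choose g hg using h1
    refine ⟨∑ i ∈ Finset.range d, aR (g i) * yR ^ i, ?_⟩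
    apply hOinj
    rw [map_mul, hjp', ← Algebra.smul_def, co_sum h.ch.hb (ex • _), map_sum, map_sum]
    refine Finset.sum_congr rfl fun i _ => ?_
    rw [← hg i, Algebra.smul_def, map_mul, map_mul, hjp', map_pow, map_pow, hjy, ← IsScalarTower.algebraMap_apply]
  have hint : Algebra.IsIntegral KX O := Algebra.IsIntegral.of_finite _ _
  obtain ⟨p1, hp1⟩ := rat_place (alg_inj H) φ hφ j hj hjp ex hex he
  have hfin1 : ∀ n, {p : HOS O | d₁ p ≤ n}.Finite := by
    intro n
    refine (Ring.HasFiniteQuotients.finite_cardQuot_heightOneSpectrum_le (Nat.card K ^ n)).subset ?_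
    intro p hp
    change Nat.card (O ⧸ p.asIdeal) ≤ _
    rw [h.hd₁]; exact Nat.pow_le_pow_right (by omega) hp
  have hfin2 : ∀ n, {p : HOS O' | d₂ p ≤ n}.Finite := by
    intro n
    refine (Ring.HasFiniteQuotients.finite_cardQuot_heightOneSpectrum_le (Nat.card K ^ n)).subset ?_
    intro p hp
    change Nat.card (O' ⧸ p.asIdeal) ≤ _
    rw [h.hd₂]; exact Nat.pow_le_pow_right (by omega) hp
  let T1 : ℕ → Finset (HOS O) := fun n => (hfin1 n).toFinset
  let T2 : ℕ → Finset (HOS O') := fun n => (hfin2 n).toFinset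
  let T : ℕ → Finset (HOS O ⊕ HOS O') := fun n => (T1 n).disjSum (T2 n)
  have hT : ∀ n P, P ∈ T n ↔ Sum.elim d₁ d₂ P ≤ n := by
    rintro n (p | p)
    · simp [T, T1]
    · simp [T, T2]
  have hNpt : ∀ s, Npt sdd T s = (∑ p ∈ (T1 s).filter (fun p => d₁ p ∣ s), d₁ p) + ∑ p ∈ (T2 s).filter (fun p => d₂ p ∣ s), d₂ p := by
    intro s
    unfold Npt
    rw [Finset.sum_filter, Finset.sum_disjSum, Finset.sum_filter, Finset.sum_filter]
    rfl
  have hd1 : ∀ p, 1 ≤ d₁ p := by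
    intro p
    by_contra h0
    have h1 := h.hd₁ p
    rw [show d₁ p = 0 by omega, pow_zero, Nat.card_eq_one_iff_unique] at h1
    exact p.isPrime.ne_top ((Ideal.Quotient.subsingleton_iff).1 h1.1)
  have hd2 : ∀ p, 1 ≤ d₂ p := by
    intro p
    by_contra h0
    have h1 := h.hd₂ p
    rw [show d₂ p = 0 by omega, pow_zero, Nat.card_eq_one_iff_unique] at h1
    exact p.isPrime.ne_top ((Ideal.Quotient.subsingleton_iff).1 h1.1)
  obtain ⟨κ, hκ, hRR⟩ := h.rr
  obtain ⟨c, hc⟩ := low_bound H hlift φ hφ ε u v hε huv j hj ex hex he T1 (fun s p hp => (hfin1 s).mem_toFinset.2 hp)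
  have hw := weil_abs (v := tval O O' F) (dg := Sum.elim d₁ d₂) (T := T) finSup_tval
    (by rintro (p | p); exacts [hd1 p, hd2 p]) hT h.prod
    (finite_Mlat (by omega) h.hd₁ h.hd₂ h.fin0) hQ hκ hRR (Sum.inl p1)
    (by
      change Nat.log cK (Nat.card (O ⧸ p1.asIdeal)) = 1
      rw [hp1]
      simpa using Nat.log_pow hQ 1) (c : ℝ) (by
      intro m hm
      have h1 := hc m hm
      rw [hNpt]
      rw [← Nat.card_eq_fintype_card] at h1
      have h2 : ((Nat.card K ^ (2 * m) : ℕ) : ℝ) ≤ (((∑ p ∈ (T1 (2 * m)).filter (fun p => d₁ p ∣ 2 * m), d₁ p) + c * Nat.card K ^ m : ℕ) : ℝ) := by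
        exact_mod_cast h1
      push_cast at h2 ⊢
      have h3 : (0 : ℝ) ≤ ∑ p ∈ (T2 (2 * m)).filter (fun p => d₂ p ∣ 2 * m), (d₂ p : ℝ) := by positivity
      linarith)
  obtain ⟨hw1, hw2⟩ := hw
  set δ := del1 K b O cK + del2 b vi O' cK with hδ
  refine ⟨δ, by push_cast at hw1 ⊢; linarith, ?_, ?_⟩
  · have hone : Npt sdd T 1 ≤ NZP + δ + d := by
      rw [hNpt]
      have s1 : (∑ p ∈ (T1 1).filter (fun p => d₁ p ∣ 1), d₁ p) = ((T1 1).filter (fun p => d₁ p ∣ 1)).card := by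
        rw [Finset.card_eq_sum_ones]
        refine Finset.sum_congr rfl fun p hp => Nat.dvd_one.1 (Finset.mem_filter.1 hp).2
      have s2 : (∑ p ∈ (T2 1).filter (fun p => d₂ p ∣ 1), d₂ p) = ((T2 1).filter (fun p => d₂ p ∣ 1)).card := by
        rw [Finset.card_eq_sum_ones]
        refine Finset.sum_congr rfl fun p hp => Nat.dvd_one.1 (Finset.mem_filter.1 hp).2
      have c1 := h.fin_count ((T1 1).filter (fun p => d₁ p ∣ 1)) (by
        intro p hp
        have := Nat.dvd_one.1 (Finset.mem_filter.1 hp).2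
        rw [h.hd₁, this, pow_one])
      have c2 := h.inf_count ((T2 1).filter (fun p => d₂ p ∣ 1)) (by
        intro p hp
        exact Nat.dvd_one.1 (Finset.mem_filter.1 hp).2)
      omega
    have hone' : ((Npt sdd T 1 : ℕ) : ℝ) ≤ NZP + δ + d := by exact_mod_cast hone
    refine le_trans (le_of_eq ?_) (hw2.trans hone')
    push_cast; ring
  · intro hz N hN num den hden heq
    let θ : R →+* F := (algebraMap O F).comp j.toRingHom
    have hθ : Function.Injective θ := hOinj.comp hj
    have hθp : ∀ p, θ (aR p) = aF p := hjp'
    have hθy : θ yR = y := hjy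
    have hd0 : θ den ≠ 0 := by rwa [Ne, map_eq_zero_iff θ hθ]
    have h1 := congrArg θ heq
    rw [map_mul, map_mul, map_pow, map_pow, hθp, hθy] at h1
    obtain ⟨α, β, γ, h2⟩ := h.del0 hz N hN (θ num / θ den) (by rw [div_pow, ← mul_div_assoc, h1]; field_simp)
    refine ⟨α, β, γ, hθ ?_⟩
    rw [map_mul, map_mul, map_add, map_mul, hθp, hθp, hθp, hθy, ← h2]
    field_simp
end cor
open Polynomial (X C)
section mid
variable {K L A F : Type} [Field K] [Fintype K] [Field L] [Algebra KX L] [IsFractionRing KX L]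
  [CommRing A] [IsDomain A] [IsPrincipalIdealRing A] [Algebra A L] [IsFractionRing A L]
  [Field F] [Algebra L F] [Algebra KX F] [IsScalarTower KX L F]
  [Algebra A F] [IsScalarTower A L F]
  [Algebra K F] [IsScalarTower K KX F] {d : ℕ}
  {vi : VL} {P : KXX} {y : F} {b : BdF}
theorem core_mid [Algebra.IsSeparable L F] (hCH : CH d vi P y b) (hA : ∀ z : L, vi z ≤ 1 ↔ z ∈ (algebraMap A L).range)
    (hirr : Irreducible P)
    (φ : AdjoinRoot P →ₐ[K] PK) (hφ : Function.Injective φ)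
    (ε : KX) (u v : KXX) (hε : ε ≠ 0) (huv : u * P + v * P.derivative = C ε)
    (hker : ∀ g : KXX, Polynomial.aeval y g = 0 → P ∣ g) :
    ∃ δ : ℕ, (δ : ℤ) ≤ ((d : ℤ) - 1) * (d - 2) ∧
      (Nat.card K : ℝ) + 1 - (((d : ℝ) - 1) * (d - 2) - δ) * Real.sqrt cK ≤
        NZP + δ + d ∧
      (δ = 0 → ∀ N, 1 ≤ N → ∀ num den : AdjoinRoot P, den ≠ 0 →
        algebraMap KX (AdjoinRoot P) X * num ^ N = AdjoinRoot.root P * den ^ N →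
        ∃ α β γ : K, algebraMap KX (AdjoinRoot P) X * num =
          (algebraMap KX (AdjoinRoot P) (C α + C β * X) + algebraMap KX (AdjoinRoot P) (C γ) * AdjoinRoot.root P) * den) := by
  haveI : IsDomain (AdjoinRoot P) := AdjoinRoot.isDomain_of_prime hirr.prime
  haveI : FiniteDimensional L F := Module.Finite.of_basis b
  haveI : IsDedekindDomain (integralClosure KX F) := integralClosure.isDedekindDomain KX L F
  haveI : IsDedekindDomain (integralClosure A F) := integralClosure.isDedekindDomain A L F
  haveI : IsFractionRing (integralClosure KX F) F := integralClosure.isFractionRing_of_finite_extension L F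
  haveI : IsFractionRing (integralClosure A F) F := integralClosure.isFractionRing_of_finite_extension L F
  haveI : Module.Finite KX (integralClosure KX F) := IsIntegralClosure.finite KX L F _
  haveI : Module.Finite A (integralClosure A F) := IsIntegralClosure.finite A L F _
  have hfinR : Module.Finite KX (AdjoinRoot P) := hCH.hm.finite_adjoinRoot
  let θ : AdjoinRoot P →ₐ[KX] F := AdjoinRoot.liftAlgHom P (Algebra.ofId _ _) y hCH.hy
  have hθmk : ∀ g, θ (AdjoinRoot.mk P g) = Polynomial.aeval y g := by
    intro g
    exact AdjoinRoot.lift_mk (h := hCH.hy) g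
  have hθinj : Function.Injective θ := by
    rw [injective_iff_map_eq_zero]
    intro r hr
    obtain ⟨g, rfl⟩ := AdjoinRoot.mk_surjective r
    rw [hθmk] at hr
    exact AdjoinRoot.mk_eq_zero.2 (hker g hr)
  let j' : AdjoinRoot P →ₐ[KX] (integralClosure KX F) :=
    θ.codRestrict _ (fun r => (Algebra.IsIntegral.isIntegral (R := KX) r).map θ)
  let pb := AdjoinRoot.powerBasis' hCH.hm
  let bR : Module.Basis (Fin d) KX (AdjoinRoot P) := pb.basis.reindex (finCongr hCH.hd)
  have H : AH bR (AdjoinRoot.root P) P :=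
    { d1 := hCH.d1, hm := hCH.hm, hd := hCH.hd, hc := hCH.hc
      hb := fun i => by
        simp only [bR]
        rw [Module.Basis.reindex_apply, pb.basis_eq_pow]; rfl
      hy := by rw [Polynomial.aeval_def]; exact AdjoinRoot.eval₂_root P }
  refine core_abs (A := A) (O := integralClosure KX F) (integralClosure A F) hCH hA H ?_ φ hφ ε u v hε huv (j'.restrictScalars K) ?_ ?_ ?_
  · intro x0 y0 h0
    rw [Polynomial.eval_map] at h0
    refine ⟨AdjoinRoot.liftAlgHom P (Polynomial.aeval x0) y0 h0, ?_, ?_⟩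
    · rw [AdjoinRoot.algebraMap_eq]
      refine (AdjoinRoot.lift_of (h := h0)).trans ?_
      simp
    · exact AdjoinRoot.liftAlgHom_root ..
  · intro r r' h
    exact hθinj (congrArg Subtype.val h)
  · intro p
    exact j'.commutes p
  · change θ (AdjoinRoot.root P) = y
    exact AdjoinRoot.liftAlgHom_root ..
end mid
theorem core {K : Type} [Field K] [Fintype K] {P : KXX} {d : ℕ} (d1 : 1 ≤ d) (hm : P.Monic) (hd : P.natDegree = d)
    (hc : ∀ i, i ≤ d → (P.coeff i).natDegree + i ≤ d) (hirr : Irreducible P)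
    (φ : AdjoinRoot P →ₐ[K] PK) (hφ : Function.Injective φ)
    (ε : KX) (u v : KXX) (hε : ε ≠ 0) (huv : u * P + v * P.derivative = C ε) :
    ∃ δ : ℕ, (δ : ℤ) ≤ ((d : ℤ) - 1) * (d - 2) ∧
      (Nat.card K : ℝ) + 1 - (((d : ℝ) - 1) * (d - 2) - δ) * Real.sqrt cK ≤
        NZP + δ + d ∧
      (δ = 0 → ∀ N, 1 ≤ N → ∀ num den : AdjoinRoot P, den ≠ 0 →
        algebraMap KX (AdjoinRoot P) X * num ^ N = AdjoinRoot.root P * den ^ N →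
        ∃ α β γ : K, algebraMap KX (AdjoinRoot P) X * num =
          (algebraMap KX (AdjoinRoot P) (C α + C β * X) + algebraMap KX (AdjoinRoot P) (C γ) * AdjoinRoot.root P) * den) := by
  classical
  let L := RatFunc K
  let vi : VL := RatFunc.inftyValuation K
  let A := vi.valuationSubring
  let PL := P.map (aL)
  have hPLm : PL.Monic := hm.map _
  have hPLi : Irreducible PL := (hm.irreducible_iff_irreducible_map_fraction_map (K := L)).1 hirr
  haveI : Fact (Irreducible PL) := ⟨hPLi⟩
  have hPL0 : PL ≠ 0 := hPLm.ne_zero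
  let F := AdjoinRoot PL
  have hinjL : Function.Injective (aL) := FaithfulSMul.algebraMap_injective _ _
  let pb := AdjoinRoot.powerBasis' hPLm
  have hdim : pb.dim = d := by
    change PL.natDegree = d
    rw [← hd]; exact hm.natDegree_map _
  let b : BdF := pb.basis.reindex (finCongr hdim)
  have hev : ∀ g : KXX, Polynomial.aeval (AdjoinRoot.root PL) g = AdjoinRoot.mk PL (g.map (aL)) := by
    intro g
    rw [← AdjoinRoot.aeval_eq, Polynomial.aeval_map_algebraMap]
  have hCH : CH d vi P (AdjoinRoot.root PL : F) b :=
    { d1 := d1, hm := hm, hd := hd, hc := hc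
      vp := fun p hp => RatFunc.inftyValuation.polynomial (F := K) hp
      hb := fun i => by
        simp only [b]
        rw [Module.Basis.reindex_apply, pb.basis_eq_pow]; rfl
      hy := by rw [hev]; exact AdjoinRoot.mk_self }
  have hsep : PL.Separable := by
    have h1 := congrArg (Polynomial.map (aL)) huv
    rw [Polynomial.map_add, Polynomial.map_mul, Polynomial.map_mul, Polynomial.map_C, ← Polynomial.derivative_map] at h1
    have hε' : aL ε ≠ 0 := by rwa [Ne, map_eq_zero_iff _ hinjL]
    rw [Polynomial.separable_def]
    refine ⟨C (aL ε)⁻¹ * u.map (aL), C (aL ε)⁻¹ * v.map (aL), ?_⟩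
    rw [mul_assoc, mul_assoc, ← mul_add, h1, ← Polynomial.C_mul, inv_mul_cancel₀ hε', Polynomial.C_1]
  haveI : Algebra.IsSeparable L F := by
    have hr : IsSeparable L (AdjoinRoot.root PL) := by
      refine hsep.of_dvd (minpoly.dvd L _ ?_)
      rw [AdjoinRoot.aeval_eq, AdjoinRoot.mk_self]
    have h1 := (IntermediateField.isSeparable_adjoin_simple_iff_isSeparable L F).2 hr
    have h2 : IntermediateField.adjoin L {AdjoinRoot.root PL} = ⊤ := by
      rw [← IntermediateField.toSubalgebra_inj, IntermediateField.top_toSubalgebra, _root_.eq_top_iff, ← AdjoinRoot.adjoinRoot_eq_top]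
      exact IntermediateField.algebra_adjoin_le_adjoin L _
    rw [h2] at h1
    exact AlgEquiv.Algebra.isSeparable IntermediateField.topEquiv
  haveI : IsPrincipalIdealRing A := by
    rw [(Valuation.valuationSubring.integers vi).isPrincipalIdealRing_iff_not_denselyOrdered,
      WithZero.denselyOrdered_set_iff_subsingleton]
    simpa using vi.toMonoidWithZeroHom.range_nontrivial
  refine core_mid (L := L) (A := A) (F := F) (b := b) hCH ?_ hirr φ hφ ε u v hε huv ?_
  · intro z
    constructor
    · intro hz; exact ⟨⟨z, hz⟩, rfl⟩
    · rintro ⟨z, rfl⟩; exact z.2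
  · intro g hg
    rw [hev, AdjoinRoot.mk_eq_zero] at hg
    exact (Polynomial.map_dvd_map _ hinjL hm).1 hg
open Polynomial (X C)
theorem ps_hensel {K : Type} [Field K] (g : Polynomial PK) (hm : ∃ c : PK, IsUnit c ∧ (C c * g).Monic) (x0 : K)
    (h0 : PowerSeries.constantCoeff (g.eval (PowerSeries.C x0)) = 0)
    (h1 : PowerSeries.constantCoeff (g.derivative.eval (PowerSeries.C x0)) ≠ 0) :
    ∃ z : PK, g.eval z = 0 ∧ PowerSeries.constantCoeff z = x0 := by
  haveI : IsAdicComplete (Ideal.span {(PowerSeries.X : PK)}) PK :=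
    { haus' := by
        intro x hx
        ext n
        have := hx (n+1)
        rw [SModEq.zero, smul_eq_mul, Ideal.mul_top, Ideal.span_singleton_pow, Ideal.mem_span_singleton, PowerSeries.X_pow_dvd_iff] at this
        simpa using this n (Nat.lt_succ_self n)
      prec' := by
        intro f hf
        refine ⟨PowerSeries.mk fun i => PowerSeries.coeff i (f (i+1)), fun n => ?_⟩
        rw [SModEq.sub_mem, smul_eq_mul, Ideal.mul_top, Ideal.span_singleton_pow, Ideal.mem_span_singleton, PowerSeries.X_pow_dvd_iff]
        intro i hi
        have := hf (show i + 1 ≤ n from hi)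
        rw [SModEq.sub_mem, smul_eq_mul, Ideal.mul_top, Ideal.span_singleton_pow, Ideal.mem_span_singleton, PowerSeries.X_pow_dvd_iff] at this
        have := this i (Nat.lt_succ_self i)
        rw [map_sub, sub_eq_zero] at this
        rw [map_sub, PowerSeries.coeff_mk, this, sub_self] }
  obtain ⟨c, hc, hcm⟩ := hm
  have hH : HenselianRing PK (Ideal.span {(PowerSeries.X : PK)}) := inferInstance
  have hc' : PowerSeries.constantCoeff c ≠ 0 := (hc.map PowerSeries.constantCoeff).ne_zero
  obtain ⟨z, hz, hz'⟩ := hH.is_henselian _ hcm (PowerSeries.C x0)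
    (by rw [Ideal.mem_span_singleton, PowerSeries.X_dvd_iff]; simp [h0])
    (by
      apply IsUnit.map
      rw [PowerSeries.isUnit_iff_constantCoeff]
      simp [h1, hc'])
  refine ⟨z, ?_, ?_⟩
  · rw [Polynomial.IsRoot, Polynomial.eval_mul, Polynomial.eval_C, hc.mul_right_eq_zero] at hz
    exact hz
  · rw [Ideal.mem_span_singleton, PowerSeries.X_dvd_iff, map_sub, sub_eq_zero] at hz'
    simpa using hz'
noncomputable def ev2 {K S : Type} [Field K] [CommRing S] [Algebra K S] (a b : S) : KXX →ₐ[K] S :=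
  { Polynomial.eval₂RingHom (Polynomial.aeval a : KX →ₐ[K] S).toRingHom b with
    commutes' := fun c => by
      change Polynomial.eval₂ _ _ (C (C c)) = _
      simp }
theorem ev2_apply {K S : Type} [Field K] [CommRing S] [Algebra K S] (a b : S) (g : KXX) :
    ev2 a b g = (g.map (Polynomial.aeval a : KX →ₐ[K] S).toRingHom).eval b := by
  rw [Polynomial.eval_map]; rfl
noncomputable def psi (K : Type) [Field K] : KXX →ₐ[K] Polynomial KXX :=
  ev2 (K := K) (S := Polynomial KXX) (C (C X) * X) (C X * X)
theorem psi_C {K : Type} [Field K] (p : KX) : psi K (C p) = Polynomial.aeval (C (C X) * X) p := by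
  simp [psi, ev2_apply]
theorem psi_X {K : Type} [Field K] : psi K X = C X * X := by
  simp [psi, ev2_apply]
theorem psi_mono {K : Type} [Field K] (i j : ℕ) (c : K) : psi K (Polynomial.monomial i (Polynomial.monomial j c)) =
    Polynomial.monomial (i + j) (Polynomial.monomial i (Polynomial.monomial j c)) := by
  rw [← Polynomial.C_mul_X_pow_eq_monomial, map_mul, map_pow, psi_C, psi_X, Polynomial.aeval_monomial]
  simp only [← Polynomial.C_mul_X_pow_eq_monomial, mul_pow, map_mul, map_pow, pow_add, Polynomial.algebraMap_apply, Algebra.algebraMap_self, RingHom.id_apply]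
  ring
theorem psi_coeff {K : Type} [Field K] (g : KXX) (m i j : ℕ) :
    (((psi K g).coeff m).coeff i).coeff j = if m = i + j then (g.coeff i).coeff j else 0 := by
  induction g using Polynomial.induction_on' with
  | add p q hp hq => simp only [map_add, Polynomial.coeff_add, hp, hq]; split_ifs <;> simp
  | monomial i' p =>
    induction p using Polynomial.induction_on' with
    | add p q hp hq => simp only [map_add, Polynomial.coeff_add, hp, hq]; split_ifs <;> simp
    | monomial j' c =>
      rw [psi_mono]
      simp only [Polynomial.coeff_monomial]
      by_cases h1 : i' = i <;> by_cases h2 : j' = j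
      · subst h1 h2
        by_cases h3 : i' + j' = m
        · simp [h3]
        · simp [h3, Ne.symm h3]
      all_goals
        simp only [h1, h2, if_false, if_true]
        split_ifs <;> simp [h1, h2, Polynomial.coeff_monomial]
theorem psi_inj {K : Type} [Field K] (g : KXX) (h : psi K g = 0) : g = 0 := by
  ext i j
  have := psi_coeff g (i + j) i j
  rw [h] at this
  simpa using this.symm
theorem psi_le {K : Type} [Field K] (g : KXX) (d : ℕ) (h : (psi K g).natDegree ≤ d) (i : ℕ) (hi : i ≤ d) :
    (g.coeff i).natDegree + i ≤ d := by
  by_cases h0 : g.coeff i = 0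
  · simpa [h0]
  by_contra hlt
  have := psi_coeff g (i + (g.coeff i).natDegree) i (g.coeff i).natDegree
  rw [if_pos rfl, Polynomial.coeff_eq_zero_of_natDegree_lt (p := psi K g) (by omega)] at this
  simp at this
  exact h0 (Polynomial.leadingCoeff_eq_zero.1 this.symm)
theorem le_psi {K : Type} [Field K] (g : KXX) (h : g.Monic) : g.natDegree ≤ (psi K g).natDegree := by
  apply Polynomial.le_natDegree_of_ne_zero
  intro h0
  have := psi_coeff g g.natDegree g.natDegree 0
  rw [h0, h.coeff_natDegree] at this
  simp at this
theorem hc_of_dvd {K : Type} [Field K] {G P : KXX} (hG : G.Monic) (hT : (psi K G).natDegree ≤ G.natDegree)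
    (hP : P.Monic) (hd : P ∣ G) (i : ℕ) (hi : i ≤ P.natDegree) : (P.coeff i).natDegree + i ≤ P.natDegree := by
  obtain ⟨H, rfl⟩ := hd
  have hH : H.Monic := hP.of_mul_monic_left hG
  apply psi_le _ _ _ _ hi
  have hP0 : psi K P ≠ 0 := fun h => hP.ne_zero (psi_inj _ h)
  have hH0 : psi K H ≠ 0 := fun h => hH.ne_zero (psi_inj _ h)
  rw [map_mul, Polynomial.natDegree_mul hP0 hH0, hP.natDegree_mul hH] at hT
  have := le_psi H hH
  omega
theorem phi_inj {K : Type} [Field K] {P : KXX} (hm : P.Monic) (hirr : Irreducible P)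
    (φ : AdjoinRoot P →ₐ[K] PK) (z : AdjoinRoot P) (hz : φ z ≠ 0) (hz0 : PowerSeries.constantCoeff (φ z) = 0) :
    Function.Injective φ := by
  haveI : IsDomain (AdjoinRoot P) := AdjoinRoot.isDomain_of_prime hirr.prime
  have hfinR : Module.Finite KX (AdjoinRoot P) := hm.finite_adjoinRoot
  set I := RingHom.ker φ with hI
  haveI : I.IsPrime := RingHom.ker_isPrime _
  rw [← AlgHom.coe_toRingHom, RingHom.injective_iff_ker_eq_bot]
  change I = ⊥
  by_contra hne
  have h1 : I.comap (algebraMap KX (AdjoinRoot P)) ≠ ⊥ := fun h => hne (Ideal.eq_bot_of_comap_eq_bot h)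
  have h2 : (I.comap (algebraMap KX (AdjoinRoot P))).IsMaximal := Ideal.IsPrime.isMaximal inferInstance h1
  have h3 := Ideal.isMaximal_of_isIntegral_of_isMaximal_comap I h2
  obtain ⟨w, hw⟩ := h3.exists_inv (x := z) (by rwa [hI, RingHom.mem_ker])
  obtain ⟨i, hi, hw⟩ := hw
  have := congrArg (fun a => PowerSeries.constantCoeff (φ a)) hw
  rw [hI, RingHom.mem_ker] at hi
  simp [hi, hz0] at this
theorem ex_factor {R S : Type*} [CommRing R] [IsDomain R] [UniqueFactorizationMonoid R] [CommRing S] [IsDomain S] (φ : R →+* S) (G : R) (h0 : G ≠ 0) (h : φ G = 0) :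
    ∃ P, Irreducible P ∧ P ∣ G ∧ φ P = 0 := by
  revert h
  induction G using WfDvdMonoid.induction_on_irreducible with
  | zero => exact absurd rfl h0
  | unit u hu => intro h; exact absurd h (hu.map φ).ne_zero
  | mul a i ha hi ih =>
    intro h
    rw [map_mul, mul_eq_zero] at h
    rcases h with h | h
    · exact ⟨i, hi, dvd_mul_right _ _, h⟩
    · obtain ⟨P, h1, h2, h3⟩ := ih ha h
      exact ⟨P, h1, h2.mul_left _, h3⟩
theorem curve {K : Type} [Field K] [Fintype K] {G A : KXX} (hG : G.Monic) (hT : (psi K G).natDegree ≤ G.natDegree)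
    (φ : KXX →ₐ[K] PK) (hφ : φ G = 0) (z : KXX) (hz : φ z ≠ 0)
    (hz0 : PowerSeries.constantCoeff (φ z) = 0) (hGA : G ∣ A) (hA : φ A.derivative ≠ 0 ∨ ∃ ε : KX, ε ≠ 0 ∧ A.derivative = C ε) :
    ∃ (P : KXX) (d δ : ℕ), 1 ≤ d ∧ P.Monic ∧ P.natDegree = d ∧ P ∣ G ∧ (δ : ℤ) ≤ ((d : ℤ) - 1) * (d - 2) ∧
      (Nat.card K : ℝ) + 1 - (((d : ℝ) - 1) * (d - 2) - δ) * Real.sqrt cK ≤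
        NZP + δ + d ∧
      (δ = 0 → ∀ N, 1 ≤ N → ∀ num den : KXX, ¬ P ∣ den → P ∣ C X * num ^ N - X * den ^ N →
        ∃ α β γ : K, P ∣ C X * num - (C (C α + C β * X) + C (C γ) * X) * den) := by
  obtain ⟨P0, hi0, hP0, hφ0⟩ := ex_factor (φ : KXX →+* PK) G hG.ne_zero hφ
  obtain ⟨H0, hH0⟩ := hP0
  have hu : IsUnit P0.leadingCoeff := by
    have := hG
    rw [hH0, Polynomial.Monic, Polynomial.leadingCoeff_mul] at this
    exact IsUnit.of_mul_eq_one _ this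
  obtain ⟨w, hw⟩ := hu
  set P := C (↑w⁻¹ : KX) * P0 with hPdef
  have hwu : IsUnit (C (↑w⁻¹ : KX)) := (Units.isUnit w⁻¹).map C
  have hass : Associated P P0 := by
    rw [hPdef]; exact associated_unit_mul_left _ _ hwu
  have hPm : P.Monic := by
    rw [Polynomial.Monic, hPdef, Polynomial.leadingCoeff_mul, Polynomial.leadingCoeff_C, ← hw, Units.inv_mul]
  have hPi : Irreducible P := hass.symm.irreducible hi0
  have hPG : P ∣ G := hass.dvd.trans ⟨H0, hH0⟩
  have hφP : φ P = 0 := by rw [hPdef, map_mul]; exact mul_eq_zero_of_right _ hφ0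
  have hd1 : 1 ≤ P.natDegree := by
    by_contra h
    exact hPi.not_isUnit (by rw [hPm.natDegree_eq_zero.1 (by omega)]; exact isUnit_one)
  haveI : IsDomain (AdjoinRoot P) := AdjoinRoot.isDomain_of_prime hPi.prime
  have hfinR : Module.Finite KX (AdjoinRoot P) := hPm.finite_adjoinRoot
  obtain ⟨H, hH⟩ := hPG.trans hGA
  have hnd : ¬ P ∣ A.derivative := by
    rintro ⟨g, hg⟩
    rcases hA with hA | ⟨ε, hε, hA⟩
    · apply hA; rw [hg, map_mul, hφP, zero_mul]
    · rw [hA] at hg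
      have hg0 : g ≠ 0 := by rintro rfl; simp [hε] at hg
      have := congrArg Polynomial.natDegree hg
      rw [hPm.natDegree_mul' hg0, Polynomial.natDegree_C] at this
      omega
  have hne : AdjoinRoot.mk P A.derivative ≠ 0 := fun h => hnd (AdjoinRoot.mk_eq_zero.1 h)
  obtain ⟨ε, hε, hdv⟩ := (Algebra.IsIntegral.isIntegral (R := KX) (AdjoinRoot.mk P A.derivative)).isAlgebraic.exists_nonzero_dvd
    (mem_nonZeroDivisors_of_ne_zero hne)
  obtain ⟨g, hg⟩ := hdv
  obtain ⟨g, rfl⟩ := AdjoinRoot.mk_surjective g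
  rw [← map_mul, AdjoinRoot.algebraMap_eq, ← AdjoinRoot.mk_C, AdjoinRoot.mk_eq_mk] at hg
  obtain ⟨u, hu⟩ := hg
  let φ' : AdjoinRoot P →ₐ[K] PK := Ideal.Quotient.liftₐ _ φ (by
    intro a ha
    obtain ⟨b, rfl⟩ := Ideal.mem_span_singleton.1 ha
    rw [map_mul, hφP, zero_mul])
  have hφ' : ∀ a, φ' (AdjoinRoot.mk P a) = φ a := fun a => rfl
  obtain ⟨δ, h1, h2, h3⟩ := core hd1 hPm rfl (hc_of_dvd hG hT hPm hPG) hPi φ'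
    (phi_inj hPm hPi φ' (AdjoinRoot.mk P z) (by rwa [hφ']) (by rwa [hφ'])) ε (u + Polynomial.derivative H * g) (H * g) hε (by
      rw [hH, Polynomial.derivative_mul] at hu
      linear_combination -hu)
  refine ⟨P, _, δ, hd1, hPm, rfl, hPG, h1, h2, ?_⟩
  intro hδ N hN num den hden hrel
  obtain ⟨α, β, γ, h⟩ := h3 hδ N hN (AdjoinRoot.mk P num) (AdjoinRoot.mk P den) (fun h => hden (AdjoinRoot.mk_eq_zero.1 h)) (by
    rw [AdjoinRoot.algebraMap_eq, ← AdjoinRoot.mk_C, ← AdjoinRoot.mk_X, ← map_pow, ← map_pow, ← map_mul, ← map_mul]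
    exact AdjoinRoot.mk_eq_mk.2 hrel)
  refine ⟨α, β, γ, ?_⟩
  rw [AdjoinRoot.algebraMap_eq] at h
  simp only [← AdjoinRoot.mk_C, ← AdjoinRoot.mk_X, ← map_mul, ← map_add] at h
  exact AdjoinRoot.mk_eq_mk.1 h
open Polynomial (X C)
structure QF (p e q n : ℕ) (K : Type) [Field K] [Fintype K] : Prop where
  hp : p.Prime
  he : 1 ≤ e
  hq : q = p ^ e
  hn : 1 ≤ n
  card : Nat.card K = q ^ n
  ch : CharP K p
section QFs
variable {p e q n : ℕ} {K : Type} [Field K] [Fintype K]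
theorem QF.q2 (H : QK) : 2 ≤ q := by
  rw [H.hq]
  exact H.hp.two_le.trans (Nat.le_self_pow (by have := H.he; omega) p)
theorem QF.pow_add (H : QK) {S : Type} [CommRing S] [Algebra K S] (x y : S) (j : ℕ) : (x + y) ^ q ^ j = x ^ q ^ j + y ^ q ^ j := by
  nontriviality S
  haveI := H.ch
  haveI := Fact.mk H.hp
  haveI : CharP S p := charP_of_injective_algebraMap (algebraMap K S).injective p
  rw [H.hq, ← pow_mul]
  exact add_pow_char_pow ..
theorem QF.emb (H : QK) : ∃ (F : Type) (_ : Field F) (_ : Finite F) (_ : Algebra F K), Nat.card F = q := by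
  haveI := H.ch
  haveI := Fact.mk H.hp
  letI : Algebra (ZMod p) K := ZMod.algebra K p
  have h1 : Module.finrank (ZMod p) K = e * n := by
    have := Module.natCard_eq_pow_finrank (K := ZMod p) (V := K)
    rw [H.card, H.hq, ← pow_mul, Nat.card_zmod] at this
    exact (Nat.pow_right_injective H.hp.two_le this).symm
  have he := H.he
  have h2 : Module.finrank (ZMod p) (GaloisField p e) = e := GaloisField.finrank p (by omega)
  obtain ⟨g⟩ := FiniteField.nonempty_algHom_of_finrank_dvd (F := ZMod p) (K := GaloisField p e) (L := K) (by rw [h1, h2]; exact dvd_mul_right _ _)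
  exact ⟨GaloisField p e, inferInstance, inferInstance, g.toRingHom.toAlgebra, by rw [GaloisField.card p e (by omega), H.hq]⟩
theorem QF.fix (H : QK) : Nat.card {l : K // l ^ q = l} = q := by
  classical
  have hq := H.q2
  apply le_antisymm
  · have h0 : (X ^ q - X : KX) ≠ 0 := FiniteField.X_pow_card_sub_X_ne_zero K (by omega)
    rw [Nat.card_eq_fintype_card, Fintype.card_subtype]
    calc _ ≤ (X ^ q - X : KX).roots.toFinset.card := by
          apply Finset.card_le_card
          intro l hl
          simp only [Finset.mem_filter, Finset.mem_univ, true_and] at hl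
          simp [h0, hl]
      _ ≤ _ := (Multiset.toFinset_card_le _).trans ((Polynomial.card_roots' _).trans (by rw [FiniteField.X_pow_card_sub_X_natDegree_eq K (by omega)]))
  · obtain ⟨F, _, _, _, hF⟩ := H.emb
    have := Fintype.ofFinite F
    conv_lhs => rw [← hF]
    refine Nat.card_le_card_of_injective (fun l : F => ⟨algebraMap F K l, ?_⟩) ?_
    · rw [← map_pow, ← hF, Nat.card_eq_fintype_card, FiniteField.pow_card]
    · intro a b hab
      exact (algebraMap F K).injective (congrArg Subtype.val hab)
theorem QF.sub_card (H : QK) (V : AddSubgroup K) (hV : ∀ l x, l ^ q = l → x ∈ V → l * x ∈ V) :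
    Nat.card V = q ^ Nat.log q (Nat.card V) := by
  obtain ⟨F, _, _, _, hF⟩ := H.emb
  have := Fintype.ofFinite F
  let V' : Submodule F K := { V with
    smul_mem' := fun l x hx => by
      rw [Algebra.smul_def]
      refine hV _ _ ?_ hx
      rw [← map_pow, ← hF, Nat.card_eq_fintype_card, FiniteField.pow_card] }
  have h1 : Nat.card V = q ^ Module.finrank F V' := by
    rw [← hF]; exact Module.natCard_eq_pow_finrank (K := F) (V := V')
  rw [h1, Nat.log_pow (by have := H.q2; omega)]
def DD (q : ℕ) {S : Type} [CommRing S] (s y : S) : S := s ^ q * y - s * y ^ q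
theorem QF.dep_card (H : QK) (V : AddSubgroup K) (hV : ∀ l x, l ^ q = l → x ∈ V → l * x ∈ V) (x : K) (hx : x ∈ V) (hx0 : x ≠ 0) :
    Nat.card {y : K // y ∈ V ∧ DD q x y = 0} = q := by
  refine Eq.trans ?_ H.fix
  have hq := H.q2
  refine Nat.card_congr ⟨fun y => ⟨y.1 / x, ?_⟩, fun l => ⟨l.1 * x, hV _ _ l.2 hx, ?_⟩, ?_, ?_⟩
  · have := y.2.2
    rw [DD] at this
    rw [div_pow]; field_simp
    linear_combination -this
  · rw [DD, mul_pow, l.2]; ring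
  · intro y; ext; simp [hx0]
  · intro y; ext; simp [hx0]
theorem QF.indep_card (H : QK) (V : AddSubgroup K) (hV : ∀ l x, l ^ q = l → x ∈ V → l * x ∈ V) :
    Nat.card {z : K × K // z.1 ∈ V ∧ z.2 ∈ V ∧ DD q z.1 z.2 ≠ 0} = (Nat.card V - 1) * (Nat.card V - q) := by
  classical
  have hq := H.q2
  have e : {z : K × K // z.1 ∈ V ∧ z.2 ∈ V ∧ DD q z.1 z.2 ≠ 0} ≃ Σ x : {x : K // x ∈ V ∧ x ≠ 0}, {y : K // y ∈ V ∧ DD q x.1 y ≠ 0} :=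
    { toFun := fun z => ⟨⟨z.1.1, z.2.1, fun h => z.2.2.2 (by rw [DD, h, zero_pow (by omega)]; ring)⟩, ⟨z.1.2, z.2.2⟩⟩
      invFun := fun z => ⟨(z.1.1, z.2.1), z.1.2.1, z.2.2⟩
      left_inv := fun _ => rfl
      right_inv := fun _ => rfl }
  have h1 : Nat.card {x : K // x ∈ V ∧ x ≠ 0} = Nat.card V - 1 := by
    have h2 := Nat.card_congr (Equiv.sumCompl (fun x : V => (x : K) = 0))
    rw [Nat.card_sum] at h2
    have h3 : Nat.card {x : V // (x : K) = 0} = 1 := by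
      rw [Nat.card_eq_one_iff_unique]
      exact ⟨⟨fun a b => by ext; rw [a.2, b.2]⟩, ⟨⟨0, rfl⟩⟩⟩
    have h4 : Nat.card {x : V // ¬ (x : K) = 0} = Nat.card {x : K // x ∈ V ∧ x ≠ 0} :=
      Nat.card_congr (Equiv.subtypeSubtypeEquivSubtypeInter (· ∈ V) (· ≠ 0))
    omega
  have h2 : ∀ x : {x : K // x ∈ V ∧ x ≠ 0}, Nat.card {y : K // y ∈ V ∧ DD q x.1 y ≠ 0} = Nat.card V - q := by
    intro x
    have h2 := Nat.card_congr (Equiv.sumCompl (fun y : V => DD q x.1 (y : K) = 0))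
    rw [Nat.card_sum] at h2
    have h3 : Nat.card {y : V // DD q x.1 (y : K) = 0} = q := by
      refine Eq.trans ?_ (H.dep_card V hV x.1 x.2.1 x.2.2)
      exact Nat.card_congr (Equiv.subtypeSubtypeEquivSubtypeInter (· ∈ V) (fun y => DD q x.1 y = 0))
    have h4 : Nat.card {y : V // ¬ DD q x.1 (y : K) = 0} = Nat.card {y : K // y ∈ V ∧ DD q x.1 y ≠ 0} :=
      Nat.card_congr (Equiv.subtypeSubtypeEquivSubtypeInter (· ∈ V) (fun y => DD q x.1 y ≠ 0))
    omega
  rw [Nat.card_congr e, Nat.card_sigma, Finset.sum_congr rfl (fun x _ => h2 x), Finset.sum_const, Finset.card_univ, ← Nat.card_eq_fintype_card, h1, smul_eq_mul]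
end QFs
open Polynomial (X C)
section LPs
variable {p e q n : ℕ} {K : Type} [Field K] [Fintype K] {S T : Type} [CommRing S] [Algebra K S] [CommRing T] [Algebra K T]
def LP (q k : ℕ) (a : ℕ → K) (z : S) : S := ∑ j ∈ Finset.range (k + 1), algebraMap K S (a j) * z ^ q ^ j
def AA (q k t : ℕ) (a : ℕ → K) (s y : S) : S := LP q k a s * y ^ q ^ t - LP q k a y * s ^ q ^ t
theorem LP_map (q k : ℕ) (a : ℕ → K) (φ : S →ₐ[K] T) (z : S) : φ (LP q k a z) = LP q k a (φ z) := by
  simp [LP, map_sum]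
theorem AA_map (q k t : ℕ) (a : ℕ → K) (φ : S →ₐ[K] T) (z w : S) : φ (AA q k t a z w) = AA q k t a (φ z) (φ w) := by
  simp [AA, LP_map]
theorem DD_map {S T : Type} [CommRing S] [CommRing T] (q : ℕ) (φ : S →+* T) (z w : S) : φ (DD q z w) = DD q (φ z) (φ w) := by
  simp [DD]
theorem QF.LP_add (H : QK) (k : ℕ) (a : ℕ → K) (x y : S) : LP q k a (x + y) = LP q k a x + LP q k a y := by
  simp only [LP, H.pow_add, mul_add, Finset.sum_add_distrib]
theorem fixpow (l : S) (hl : l ^ q = l) (j : ℕ) : l ^ q ^ j = l := by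
  induction j with
  | zero => simp
  | succ j ih => rw [pow_succ, pow_mul, ih, hl]
theorem LP_smul (k : ℕ) (a : ℕ → K) (l x : S) (hl : l ^ q = l) : LP q k a (l * x) = l * LP q k a x := by
  simp only [LP, mul_pow, fixpow l hl, Finset.mul_sum]
  exact Finset.sum_congr rfl fun j _ => by ring
theorem DD_dvd_aux (q : ℕ) (hq : 1 ≤ q) (x y : S) (b m : ℕ) (hb : 1 ≤ b) : DD q x y ∣ x ^ (b + (q - 1) * m) * y ^ b - y ^ (b + (q - 1) * m) * x ^ b := by
  obtain ⟨b, rfl⟩ := Nat.exists_eq_add_of_le' hb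
  obtain ⟨r, rfl⟩ := Nat.exists_eq_add_of_le' hq
  obtain ⟨g, hg⟩ := sub_dvd_pow_sub_pow (x ^ r) (y ^ r) m
  rw [← pow_mul, ← pow_mul] at hg
  refine ⟨x ^ b * y ^ b * g, ?_⟩
  rw [DD, Nat.add_sub_cancel]
  simp only [pow_add, pow_one]
  linear_combination (x ^ b * x * y ^ b * y) * hg
theorem DD_dvd_AA (q k t : ℕ) (hq : 1 ≤ q) (a : ℕ → K) (x y : S) : DD q x y ∣ AA q k t a x y := by
  have key : ∀ i j : ℕ, i ≤ j → DD q x y ∣ x ^ q ^ j * y ^ q ^ i - y ^ q ^ j * x ^ q ^ i := by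
    intro i j hij
    have h1 : q - 1 ∣ q ^ (j - i) - 1 := by simpa using Nat.sub_dvd_pow_sub_pow q 1 (j - i)
    obtain ⟨m, hm⟩ := h1
    have h2 : q ^ j = q ^ i + (q - 1) * (q ^ i * m) := by
      have h3 : q ^ (j - i) = 1 + (q - 1) * m := by
        have := Nat.one_le_pow (j - i) q hq
        omega
      rw [← Nat.sub_add_cancel hij, pow_add, h3]; ring
    rw [h2]
    exact DD_dvd_aux q hq x y _ _ (Nat.one_le_pow _ _ hq)
  rw [AA, LP, LP, Finset.sum_mul, Finset.sum_mul, ← Finset.sum_sub_distrib]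
  refine Finset.dvd_sum fun j _ => ?_
  have : algebraMap K S (a j) * x ^ q ^ j * y ^ q ^ t - algebraMap K S (a j) * y ^ q ^ j * x ^ q ^ t
    = algebraMap K S (a j) * (x ^ q ^ j * y ^ q ^ t - y ^ q ^ j * x ^ q ^ t) := by ring
  rw [this]
  apply Dvd.dvd.mul_left
  rcases le_total t j with h | h
  · exact key _ _ h
  · have := (dvd_neg.2 (key _ _ h))
    convert this using 1; ring
def QF.V (H : QK) (k t : ℕ) (a : ℕ → K) (m : K) : AddSubgroup K where
  carrier := {x | LP q k a x = m * x ^ q ^ t}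
  zero_mem' := by
    have := H.q2
    simp only [Set.mem_setOf_eq, LP]
    rw [zero_pow (by positivity), mul_zero]
    exact Finset.sum_eq_zero fun j _ => by rw [zero_pow (by positivity), mul_zero]
  add_mem' := by
    intro x y hx hy
    simp only [Set.mem_setOf_eq] at *
    rw [H.LP_add, H.pow_add, hx, hy]; ring
  neg_mem' := by
    intro x hx
    simp only [Set.mem_setOf_eq] at *
    have h0 := H.LP_add k a x (-x)
    have h1 := H.pow_add x (-x) t
    have := H.q2
    have hz : LP q k a (0 : K) = 0 := Finset.sum_eq_zero fun j _ => by rw [zero_pow (by positivity), mul_zero]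
    rw [add_neg_cancel, hz, hx] at h0
    rw [add_neg_cancel, zero_pow (by positivity)] at h1
    linear_combination -h0 + m * h1
theorem QF.V_mul (H : QK) (k t : ℕ) (a : ℕ → K) (m : K) (l x) (hl : l ^ q = l) (hx : x ∈ H.V k t a m) : l * x ∈ H.V k t a m := by
  change LP q k a (l * x) = m * (l * x) ^ q ^ t
  rw [LP_smul _ _ _ _ hl, show LP q k a x = m * x ^ q ^ t from hx, mul_pow, fixpow l hl]; ring
theorem QF.V_card (H : QK) (k t : ℕ) (a : ℕ → K) (m : K) :
    Nat.card {x : K // LP q k a x = m * x ^ q ^ t} = q ^ Nat.log q (Nat.card {x : K // LP q k a x = m * x ^ q ^ t}) :=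
  H.sub_card Vz (H.V_mul k t a m)
theorem QF.fat_pair (H : QK) (k t : ℕ) (a : ℕ → K) (m : K) (h : 2 ≤ Nat.log q (Nat.card {x : K // LP q k a x = m * x ^ q ^ t})) :
    ∃ x y : K, LP q k a x = m * x ^ q ^ t ∧ LP q k a y = m * y ^ q ^ t ∧ DD q x y ≠ 0 := by
  have h1 := H.indep_card Vz (H.V_mul k t a m)
  have h2 : Nat.card Vz = q ^ _ := H.V_card k t a m
  have hq := H.q2
  have h3 : q ^ 2 ≤ Nat.card Vz := h2 ▸ Nat.pow_le_pow_right (by omega) h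
  have h4 : q < q ^ 2 := by nlinarith
  have h5 : 0 < (Nat.card Vz - 1) * (Nat.card Vz - q) := Nat.mul_pos (by omega) (by omega)
  rw [← h1] at h5
  obtain ⟨z⟩ := (Nat.card_pos_iff.1 h5).1
  exact ⟨z.1.1, z.1.2, z.2⟩
theorem QF.count_le (H : QK) (k t W : ℕ) (a : ℕ → K)
    (hW : ∀ m : K, Nat.log q (Nat.card {x : K // LP q k a x = m * x ^ q ^ t}) ≤ W) :
    NAD ≤
      Nat.card {m : K // 1 < Nat.log q (Nat.card {x : K // LP q k a x = m * x ^ q ^ t})} * ((q ^ W - 1) * (q ^ W - q)) := by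
  classical
  have hq := H.q2
  let M := {m : K // 1 < Nat.log q (Nat.card {x : K // LP q k a x = m * x ^ q ^ t})}
  let B := fun m : M => {z : K × K // z.1 ∈ H.V k t a m.1 ∧ z.2 ∈ H.V k t a m.1 ∧ DD q z.1 z.2 ≠ 0}
  have hB : ∀ m : M, Nat.card (B m) ≤ (q ^ W - 1) * (q ^ W - q) := by
    intro m
    have h1 := H.indep_card Vz (H.V_mul k t a m)
    have h2 : Nat.card Vz = q ^ _ := H.V_card k t a m
    have h3 : Nat.card Vz ≤ q ^ W := h2 ▸ Nat.pow_le_pow_right (by omega) (hW m)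
    exact h1.trans_le (Nat.mul_le_mul (by omega) (by omega))
  have hx0 : ∀ z : {z : K × K // AA q k t a z.1 z.2 = 0 ∧ DD q z.1 z.2 ≠ 0}, z.1.1 ≠ 0 := fun z h => z.2.2 (by rw [DD, h, zero_pow (by omega)]; ring)
  have hm1 : ∀ z : {z : K × K // AA q k t a z.1 z.2 = 0 ∧ DD q z.1 z.2 ≠ 0},
      z.1.1 ∈ H.V k t a LPz ∧ z.1.2 ∈ H.V k t a LPz := by
    intro z
    have h0 := hx0 z
    constructor
    · change LP q k a _ = _; field_simp
    · change LP q k a _ = _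
      have := z.2.1
      rw [AA] at this
      field_simp
      linear_combination -this
  have hm2 : ∀ z : {z : K × K // AA q k t a z.1 z.2 = 0 ∧ DD q z.1 z.2 ≠ 0},
      1 < Nat.log q (Nat.card {x : K // LP q k a x = LPz * x ^ q ^ t}) := by
    intro z
    have h1 := H.indep_card (H.V k t a LPz) (H.V_mul k t a _)
    have h2 : Nat.card (H.V k t a LPz) = q ^ _ := H.V_card k t a _
    have h3 : 0 < (Nat.card (H.V k t a LPz) - 1) * (Nat.card (H.V k t a LPz) - q) := by
      rw [← h1]
      exact Nat.card_pos_iff.2 ⟨⟨⟨z.1, (hm1 z).1, (hm1 z).2, z.2.2⟩⟩, inferInstance⟩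
    by_contra hlt
    have h4 : Nat.card (H.V k t a LPz) ≤ q ^ 1 := h2 ▸ Nat.pow_le_pow_right (by omega) (by omega)
    rw [pow_one] at h4
    rw [Nat.sub_eq_zero_of_le h4] at h3
    simp at h3
  calc _ ≤ Nat.card (Σ m : M, B m) := by
        refine Nat.card_le_card_of_injective (fun z => ⟨⟨_, hm2 z⟩, ⟨z.1, (hm1 z).1, (hm1 z).2, z.2.2⟩⟩) ?_
        intro z w hzw
        ext1
        exact congrArg (fun s : (Σ m : M, B m) => s.2.1) hzw
    _ = ∑ m : M, Nat.card (B m) := Nat.card_sigma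
    _ ≤ ∑ m : M, (q ^ W - 1) * (q ^ W - q) := Finset.sum_le_sum fun m _ => hB m
    _ = _ := by rw [Finset.sum_const, Finset.card_univ, ← Nat.card_eq_fintype_card, smul_eq_mul]
end LPs
open Polynomial (X C)
section Gs
variable {q n k t : ℕ} {K : Type} [Field K]
theorem LP_top {B : Type} [CommRing B] [Algebra K B] (hq : 2 ≤ q) (a : ℕ → K) (ha : a k = 1) (z : Polynomial B) (hz : z.natDegree ≤ 1) :
    (LP q k a z).natDegree ≤ q ^ k ∧ (LP q k a z).coeff (q ^ k) = z.coeff 1 ^ q ^ k := by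
  have h1 : ∀ j, (z ^ q ^ j).natDegree ≤ q ^ j := fun j => by
    simpa using Polynomial.natDegree_pow_le_of_le (q ^ j) hz
  have h2 : ∀ j, (algebraMap K (Polynomial B) (a j) * z ^ q ^ j).natDegree ≤ q ^ j := fun j => by
    rw [Polynomial.algebraMap_apply]
    exact (Polynomial.natDegree_C_mul_le _ _).trans (h1 j)
  constructor
  · refine Polynomial.natDegree_sum_le_of_forall_le _ _ fun j hj => (h2 j).trans ?_
    exact Nat.pow_le_pow_right (by omega) (by simpa [Nat.lt_succ_iff] using hj)
  · rw [LP, Finset.sum_range_succ, Polynomial.coeff_add, Polynomial.finset_sum_coeff, Finset.sum_eq_zero, zero_add, ha, map_one, one_mul]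
    · simpa using Polynomial.coeff_pow_of_natDegree_le (m := q ^ k) hz
    · intro j hj
      refine Polynomial.coeff_eq_zero_of_natDegree_lt ((h2 j).trans_lt ?_)
      exact Nat.pow_lt_pow_right (by omega) (Finset.mem_range.1 hj)
theorem pw_top {B : Type} [CommRing B] (N : ℕ) (z : Polynomial B) (hz : z.natDegree ≤ 1) :
    (z ^ N).natDegree ≤ N ∧ (z ^ N).coeff N = z.coeff 1 ^ N :=
  ⟨by simpa using Polynomial.natDegree_pow_le_of_le N hz, by simpa using Polynomial.coeff_pow_of_natDegree_le (m := N) hz⟩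
theorem AA_top {B : Type} [CommRing B] [Algebra K B] (hq : 2 ≤ q) (a : ℕ → K) (ha : a k = 1) (z w : Polynomial B) (hz : z.natDegree ≤ 1) (hw : w.natDegree ≤ 1) :
    (AA q k t a z w).natDegree ≤ q ^ k + q ^ t ∧ (AA q k t a z w).coeff (q ^ k + q ^ t) = z.coeff 1 ^ q ^ k * w.coeff 1 ^ q ^ t - w.coeff 1 ^ q ^ k * z.coeff 1 ^ q ^ t := by
  obtain ⟨h1, h2⟩ := LP_top (k := k) hq a ha z hz
  obtain ⟨h3, h4⟩ := LP_top (k := k) hq a ha w hw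
  obtain ⟨h5, h6⟩ := pw_top (q ^ t) z hz
  obtain ⟨h7, h8⟩ := pw_top (q ^ t) w hw
  constructor
  · refine (Polynomial.natDegree_sub_le _ _).trans (max_le ?_ ?_)
    · exact Polynomial.natDegree_mul_le_of_le h1 h7
    · exact Polynomial.natDegree_mul_le_of_le h3 h5
  · rw [AA, Polynomial.coeff_sub, Polynomial.coeff_mul_add_eq_of_natDegree_le h1 h7, Polynomial.coeff_mul_add_eq_of_natDegree_le h3 h5, h2, h4, h6, h8]
theorem DD_top {B : Type} [CommRing B] (z w : Polynomial B) (hz : z.natDegree ≤ 1) (hw : w.natDegree ≤ 1) :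
    (DD q z w).natDegree ≤ q + 1 ∧ (DD q z w).coeff (q + 1) = z.coeff 1 ^ q * w.coeff 1 - z.coeff 1 * w.coeff 1 ^ q := by
  obtain ⟨h5, h6⟩ := pw_top q z hz
  obtain ⟨h7, h8⟩ := pw_top q w hw
  have h9 : (z * w ^ q).coeff (1 + q) = z.coeff 1 * w.coeff 1 ^ q := by rw [Polynomial.coeff_mul_add_eq_of_natDegree_le hz h7, h8]
  constructor
  · refine (Polynomial.natDegree_sub_le _ _).trans (max_le ?_ ?_)
    · exact Polynomial.natDegree_mul_le_of_le h5 hw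
    · rw [add_comm]; exact Polynomial.natDegree_mul_le_of_le hz h7
  · rw [DD, Polynomial.coeff_sub, Polynomial.coeff_mul_add_eq_of_natDegree_le h5 hw, h6, add_comm q 1, h9]
noncomputable def sv (c : K) : KXX := C X + C (C c) * X
theorem sv_deg (c : K) : (sv c).natDegree ≤ 1 := by
  unfold sv; compute_degree
theorem ex_G [Fintype K] (hq : 2 ≤ q) (a : ℕ → K) (ha : a k = 1) (hk : 2 ≤ k) (c : K)
    (hc : (t = 0 ∧ c = 0) ∨ (c ^ q ^ k ≠ c ^ q ^ t ∧ c ^ q ≠ c)) :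
    ∃ (G : KXX) (g : K), g ≠ 0 ∧ G.Monic ∧ G.natDegree + q + 1 = q ^ k + q ^ t ∧ (psi K G).natDegree ≤ G.natDegree ∧
      AA q k t a (sv c) X = C (C g) * (DD q (sv c) X * G) := by
  obtain ⟨G0, hG0⟩ := DD_dvd_AA q k t (by omega) a (sv c) (X : KXX)
  have hs1 : (sv c).coeff 1 = C c := by simp [sv, Polynomial.coeff_C]
  have hX1 : (X : KXX).natDegree ≤ 1 := Polynomial.natDegree_X_le
  obtain ⟨a1, a2⟩ := AA_top (k := k) (t := t) hq a ha (sv c) (X : KXX) (sv_deg c) hX1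
  obtain ⟨d1, d2⟩ := DD_top (q := q) (sv c) (X : KXX) (sv_deg c) hX1
  rw [hs1, Polynomial.coeff_X_one] at a2 d2
  have hqk : q ^ 2 ≤ q ^ k := Nat.pow_le_pow_right (by omega) hk
  have main : ∃ g : K, g ≠ 0 ∧ (DD q (sv c) (X : KXX)) ≠ 0 ∧
      (AA q k t a (sv c) (X : KXX)).leadingCoeff = C g * (DD q (sv c) (X : KXX)).leadingCoeff ∧
      (AA q k t a (sv c) (X : KXX)).natDegree + q + 1 = (DD q (sv c) (X : KXX)).natDegree + q ^ k + q ^ t := by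
    rcases hc with ⟨rfl, rfl⟩ | ⟨h1, h2⟩
    · have hs : sv (0 : K) = C X := by simp [sv]
      have e1 : (AA q k 0 a (sv 0) (X : KXX)).coeff (q ^ k) = - X := by
        rw [AA, hs, pow_zero, pow_one, pow_one, Polynomial.coeff_sub, Polynomial.coeff_mul_C, (LP_top hq a ha X hX1).2,
          Polynomial.coeff_X_one, one_pow, one_mul]
        have : LP q k a (C X : KXX) = C (LP q k a X) := by simp [LP, map_sum]
        rw [this, Polynomial.coeff_C_mul, Polynomial.coeff_X_of_ne_one (by nlinarith)]; simp
      have e2 : (AA q k 0 a (sv 0) (X : KXX)).natDegree ≤ q ^ k := by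
        rw [AA, hs, pow_zero, pow_one, pow_one]
        have : LP q k a (C X : KXX) = C (LP q k a X) := by simp [LP, map_sum]
        rw [this]
        refine (Polynomial.natDegree_sub_le _ _).trans (max_le ?_ ?_)
        · exact (Polynomial.natDegree_C_mul_le _ _).trans (hX1.trans (by nlinarith))
        · exact (Polynomial.natDegree_mul_C_le _ _).trans (LP_top hq a ha X hX1).1
      have e3 : (DD q (sv 0) (X : KXX)).coeff q = - X := by
        rw [DD, hs, Polynomial.coeff_sub, Polynomial.coeff_C_mul, ← map_pow, Polynomial.coeff_C_mul, Polynomial.coeff_X_of_ne_one (by omega)]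
        simp
      have e4 : (DD q (sv 0) (X : KXX)).natDegree ≤ q := by
        rw [DD, hs, ← map_pow]
        refine (Polynomial.natDegree_sub_le _ _).trans (max_le ?_ ?_)
        · exact (Polynomial.natDegree_C_mul_le _ _).trans (hX1.trans (by omega))
        · exact (Polynomial.natDegree_C_mul_le _ _).trans (Polynomial.natDegree_X_pow_le _)
      have hX0 : (-X : KX) ≠ 0 := neg_ne_zero.2 Polynomial.X_ne_zero
      have f1 := Polynomial.natDegree_eq_of_le_of_coeff_ne_zero e2 (by rw [e1]; exact hX0)
      have f2 := Polynomial.natDegree_eq_of_le_of_coeff_ne_zero e4 (by rw [e3]; exact hX0)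
      refine ⟨1, one_ne_zero, ?_, ?_, ?_⟩
      · intro h; rw [h] at e3; exact hX0 (by simpa using e3.symm)
      · rw [Polynomial.leadingCoeff, Polynomial.leadingCoeff, f1, f2, e1, e3]; simp
      · rw [f1, f2, pow_zero]; omega
    · have a3 : c ^ q ^ k - c ^ q ^ t ≠ 0 := sub_ne_zero.2 h1
      have d3 : c ^ q - c ≠ 0 := sub_ne_zero.2 h2
      have a4 : (AA q k t a (sv c) (X : KXX)).coeff (q ^ k + q ^ t) = C (c ^ q ^ k - c ^ q ^ t) := by rw [a2]; simp
      have d4 : (DD q (sv c) (X : KXX)).coeff (q + 1) = C (c ^ q - c) := by rw [d2]; simp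
      have f1 := Polynomial.natDegree_eq_of_le_of_coeff_ne_zero a1 (by rw [a4]; exact Polynomial.C_ne_zero.2 a3)
      have f2 := Polynomial.natDegree_eq_of_le_of_coeff_ne_zero d1 (by rw [d4]; exact Polynomial.C_ne_zero.2 d3)
      refine ⟨(c ^ q ^ k - c ^ q ^ t) / (c ^ q - c), div_ne_zero a3 d3, ?_, ?_, ?_⟩
      · intro h; rw [h] at d4; exact Polynomial.C_ne_zero.2 d3 (by simpa using d4.symm)
      · rw [Polynomial.leadingCoeff, Polynomial.leadingCoeff, f1, f2, a4, d4, ← map_mul, div_mul_cancel₀ _ d3]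
      · rw [f1, f2]; omega
  obtain ⟨g, hg, hD0, hlc, hnd⟩ := main
  have hCg : (C g⁻¹ : KX) * C g = 1 := by rw [← map_mul, inv_mul_cancel₀ hg, map_one]
  have hlc0 : G0.leadingCoeff = C g := by
    rw [hG0, Polynomial.leadingCoeff_mul, mul_comm] at hlc
    exact mul_right_cancel₀ (Polynomial.leadingCoeff_ne_zero.2 hD0) hlc
  have hG00 : G0 ≠ 0 := by
    rintro rfl
    exact hg (Polynomial.C_eq_zero.1 (by simpa using hlc0.symm))
  have hm : (C (C g⁻¹) * G0).Monic := by
    rw [Polynomial.Monic, Polynomial.leadingCoeff_mul, Polynomial.leadingCoeff_C, hlc0, hCg]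
  have hfac : AA q k t a (sv c) X = C (C g) * (DD q (sv c) X * (C (C g⁻¹) * G0)) := by
    have : (C (C g⁻¹) : KXX) * C (C g) = 1 := by rw [← map_mul, hCg, map_one]
    rw [hG0]; linear_combination -(DD q (sv c) X * G0) * this
  have hdeg : (C (C g⁻¹) * G0).natDegree = G0.natDegree := Polynomial.natDegree_C_mul_of_isUnit (Polynomial.isUnit_C.2 (by simpa using hg)) _
  have hdG : (C (C g⁻¹) * G0).natDegree + q + 1 = q ^ k + q ^ t := by
    rw [hG0, Polynomial.natDegree_mul hD0 hG00] at hnd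
    omega
  refine ⟨_, g, hg, hm, hdG, ?_, hfac⟩
  have hps : psi K (sv c) = C (sv c) * X := by
    rw [sv, map_add, map_mul, psi_C, psi_C, psi_X]; simp [Polynomial.algebraMap_apply]; ring
  have hpD : psi K (DD q (sv c) X) = C (DD q (sv c) X) * X ^ (q + 1) := by
    have := DD_map (T := Polynomial KXX) q (psi K).toRingHom (sv c) X
    refine this.trans ?_
    change DD q (psi K (sv c)) (psi K X) = _
    rw [hps, psi_X, DD, DD]; simp only [map_sub, map_mul, map_pow]; ring
  have h1 : (psi K (AA q k t a (sv c) X)).natDegree ≤ q ^ k + q ^ t := by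
    have h0 : psi K (AA q k t a (sv c) X) = _ := AA_map (T := Polynomial KXX) q k t a (psi K) (sv c) X
    rw [h0, hps, psi_X]
    exact (AA_top hq a ha _ _ ((Polynomial.natDegree_C_mul_le _ _).trans Polynomial.natDegree_X_le) ((Polynomial.natDegree_C_mul_le _ _).trans Polynomial.natDegree_X_le)).1
  have h2 : psi K (C (C g)) = C (C (C g)) := by rw [psi_C]; simp [Polynomial.algebraMap_apply]
  rw [hfac, map_mul, map_mul, h2, Polynomial.natDegree_C_mul (Polynomial.C_ne_zero.2 (Polynomial.C_ne_zero.2 hg)), Polynomial.natDegree_mul (fun h => hD0 (psi_inj _ h)) (fun h => hm.ne_zero (psi_inj _ h)),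
    hpD, Polynomial.natDegree_C_mul hD0, Polynomial.natDegree_X_pow] at h1
  omega
end Gs
open Polynomial (X C)
section Br
variable {p e q n : ℕ} {K : Type} [Field K]
theorem ev2_comp {S T : Type} [CommRing S] [Algebra K S] [CommRing T] [Algebra K T] (θ : S →ₐ[K] T) (a b : S) (g : KXX) :
    θ (ev2 a b g) = ev2 (θ a) (θ b) g := by
  have h : (θ : S →+* T).comp (Polynomial.aeval a : KX →ₐ[K] S).toRingHom = (Polynomial.aeval (θ a) : KX →ₐ[K] T).toRingHom := by
    ext <;> simp
  rw [ev2_apply, ev2_apply, Polynomial.eval_map, Polynomial.eval_map, ← h]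
  exact Polynomial.hom_eval₂ g _ (θ : S →+* T) b
theorem ev2_C {S : Type} [CommRing S] [Algebra K S] (a b : S) (g : KX) : ev2 a b (C g) = Polynomial.aeval a g := by
  simp [ev2_apply]
theorem ev2_X {S : Type} [CommRing S] [Algebra K S] (a b : S) : ev2 (K := K) a b X = b := by
  simp [ev2_apply]
theorem ev2_sv {S : Type} [CommRing S] [Algebra K S] (a b : S) (c : K) : ev2 a b (sv c) = a + algebraMap K S c * b := by
  rw [sv, map_add, map_mul, ev2_C, ev2_C, ev2_X]; simp
theorem ev2_K (x0 y0 : K) (g : KXX) : ev2 x0 y0 g = (g.map (Polynomial.evalRingHom x0)).eval y0 := by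
  rw [ev2_apply]
  congr 2
def ccA (K : Type) [Field K] : PK →ₐ[K] K := { (PowerSeries.constantCoeff : PK →+* K) with
  commutes' := fun c => by simp [PowerSeries.algebraMap_apply] }
theorem smooth_phi (G : KXX) (hG : G.Monic) (x0 y0 : K) (h0 : ev2 x0 y0 G = 0) (h1 : ev2 x0 y0 G.derivative ≠ 0) :
    ∃ φ : KXX →ₐ[K] PK, φ G = 0 ∧ φ G.derivative ≠ 0 ∧ ∃ z, φ z ≠ 0 ∧ PowerSeries.constantCoeff (φ z) = 0 := by
  set a : PK := algebraMap K _ x0 + PowerSeries.X with ha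
  have hca : ccA K a = x0 := by 
    have hX : ccA K PowerSeries.X = 0 := PowerSeries.constantCoeff_X
    rw [ha, map_add, AlgHom.commutes, hX]; simp
  have hc : ∀ (b : PK) g, PowerSeries.constantCoeff (ev2 a b g) = ev2 x0 (PowerSeries.constantCoeff b) g := fun b g => by
    have := ev2_comp (ccA K) a b g
    rw [hca] at this; exact this
  obtain ⟨Y, hY, hY0⟩ := ps_hensel (G.map (Polynomial.aeval a : KX →ₐ[K] PK).toRingHom) ⟨1, isUnit_one, by simpa using hG.map _⟩ y0
    (by rw [← ev2_apply, hc]; simpa using h0)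
    (by rw [Polynomial.derivative_map, ← ev2_apply, hc]; simpa using h1)
  refine ⟨ev2 a Y, by rw [ev2_apply]; exact hY, ?_, C X - C (C x0), ?_⟩
  · intro h
    have := hc Y G.derivative
    rw [h, hY0, map_zero] at this
    exact h1 this.symm
  · rw [map_sub, ev2_C, ev2_C]
    simp [ha, PowerSeries.X_ne_zero]
variable [Fintype K]
theorem QF.dpow (H : QK) {B : Type} [CommRing B] [Algebra K B] (z : Polynomial B) (j : ℕ) (hj : j ≠ 0) : Polynomial.derivative (z ^ q ^ j) = 0 := by
  nontriviality B
  haveI := H.ch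
  haveI : CharP B p := charP_of_injective_algebraMap (algebraMap K B).injective p
  have : ((q ^ j : ℕ) : B) = 0 := by
    rw [CharP.cast_eq_zero_iff B p, H.hq, ← pow_mul]
    exact dvd_pow_self _ (Nat.mul_ne_zero (by have := H.he; omega) hj)
  rw [Polynomial.derivative_pow, this, map_zero, zero_mul, zero_mul]
theorem QF.dLP (H : QK) {B : Type} [CommRing B] [Algebra K B] (k : ℕ) (a : ℕ → K) (z : Polynomial B) :
    Polynomial.derivative (LP q k a z) = algebraMap K _ (a 0) * Polynomial.derivative z := by
  rw [LP, Polynomial.derivative_sum, Finset.sum_eq_single 0]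
  · simp [Polynomial.algebraMap_apply]
  · intro j _ hj
    rw [Polynomial.algebraMap_apply, Polynomial.derivative_C_mul, H.dpow z j hj, mul_zero]
  · simp
theorem dsv (c : K) : Polynomial.derivative (sv c) = C (C c) := by simp [sv]
theorem QF.dAA_pos (H : QK) (k t : ℕ) (ht : t ≠ 0) (a : ℕ → K) (c : K) :
    Polynomial.derivative (AA q k t a (sv c) X) = C (C (a 0)) * (C (C c) * X ^ q ^ t - sv c ^ q ^ t) := by
  rw [AA, Polynomial.derivative_sub, Polynomial.derivative_mul, Polynomial.derivative_mul, H.dpow _ t ht, H.dpow _ t ht, H.dLP, H.dLP, dsv, Polynomial.derivative_X]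
  simp only [Polynomial.algebraMap_apply, Algebra.algebraMap_self, RingHom.id_apply]
  ring
theorem dfac (G : KXX) (k t : ℕ) (a : ℕ → K) (c g : K) (hfac : AA q k t a (sv c) X = C (C g) * (DD q (sv c) X * G)) (x0 y0 : K) :
    AA q k t a (x0 + c * y0) y0 = g * (DD q (x0 + c * y0) y0 * ev2 x0 y0 G) ∧
    ∃ D', ev2 x0 y0 (Polynomial.derivative (AA q k t a (sv c) X)) = g * (D' * ev2 x0 y0 G + DD q (x0 + c * y0) y0 * ev2 x0 y0 G.derivative) := by
  have hs : ev2 x0 y0 (sv c) = x0 + c * y0 := ev2_sv x0 y0 c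
  have hD : ev2 x0 y0 (DD q (sv c) X) = DD q (x0 + c * y0) y0 := by
    refine (DD_map q (ev2 x0 y0).toRingHom (sv c) X).trans ?_
    change DD q (ev2 x0 y0 (sv c)) (ev2 x0 y0 X) = _
    rw [hs, ev2_X]
  constructor
  · have := congrArg (ev2 x0 y0) hfac
    rw [map_mul, map_mul, hD, ev2_C, AA_map, hs, ev2_X] at this
    simpa using this
  · refine ⟨ev2 x0 y0 (Polynomial.derivative (DD q (sv c) X)), ?_⟩
    rw [hfac, Polynomial.derivative_C_mul, Polynomial.derivative_mul, map_mul, map_add, map_mul, map_mul, hD, ev2_C]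
    simp
theorem dd_mono (d D : ℕ) (h1 : 1 ≤ d) (h2 : d ≤ D) : ((d : ℝ) - 1) * (d - 2) ≤ ((D : ℝ) - 1) * (D - 2) := by
  rcases h2.eq_or_lt with rfl | h
  · rfl
  · have a1 : (1 : ℝ) ≤ d := by exact_mod_cast h1
    have a2 : (d : ℝ) + 1 ≤ D := by exact_mod_cast h
    nlinarith
theorem QF.sq1 (H : QK) : 1 ≤ Real.sqrt cK := by
  rw [Real.one_le_sqrt]
  exact_mod_cast Nat.card_pos
theorem QF.case_pos (H : QK) (k t : ℕ) (ht : 1 ≤ t) (htk : t < k) (hkn : k < n) (a : ℕ → K) (ha : a k = 1) (ha0 : a 0 ≠ 0) (x1 y1 : K)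
    (h1 : AA q k t a x1 y1 = 0) (h2 : DD q x1 y1 ≠ 0) : 
    (Nat.card K : ℝ) - (qr ^ k + q ^ t - q - 2) * (qr ^ k + q ^ t - q - 3) * Real.sqrt cK - (qr ^ k + q ^ t - q - 1)
      ≤ NAD := by
  classical
  have hq := H.q2
  have hy1 : y1 ≠ 0 := fun h => h2 (by rw [DD, h, zero_pow (by omega)]; ring)
  obtain ⟨c, hc1, hc2⟩ : ∃ c : K, c ^ q ^ k ≠ c ^ q ^ t ∧ c ≠ (x1 / y1) ^ q ^ t := by
    by_contra! hcon
    have hp0 : (X ^ q ^ k - X ^ q ^ t : KX).natDegree = q ^ k := by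
      rw [Polynomial.natDegree_sub_eq_left_of_natDegree_lt, Polynomial.natDegree_X_pow]
      simp only [Polynomial.natDegree_X_pow]
      exact Nat.pow_lt_pow_right (by omega) htk
    have hne : (X ^ q ^ k - X ^ q ^ t : KX) ≠ 0 := by
      intro h; rw [h] at hp0
      have : 0 < q ^ k := by positivity
      simp at hp0; omega
    have hsub : (Finset.univ : Finset K) ⊆ insert ((x1 / y1) ^ q ^ t) (X ^ q ^ k - X ^ q ^ t : KX).roots.toFinset := by
      intro c _
      rw [Finset.mem_insert]
      by_cases hc : c ^ q ^ k = c ^ q ^ t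
      · right; simp [hne, hc]
      · left; exact hcon c hc
    have h3 := (Finset.card_le_card hsub).trans (Finset.card_insert_le _ _)
    have h4 := (Multiset.toFinset_card_le _).trans ((Polynomial.card_roots' (X ^ q ^ k - X ^ q ^ t : KX)))
    rw [hp0] at h4
    rw [Finset.card_univ, ← Nat.card_eq_fintype_card, H.card] at h3
    have h5 : q ^ (k + 1) ≤ q ^ n := Nat.pow_le_pow_right (by omega) hkn
    have h6 : q ^ 1 ≤ q ^ k := Nat.pow_le_pow_right (by omega) (by omega)
    rw [pow_succ] at h5
    nlinarith
  have hc3 : c ^ q ≠ c := fun h => hc1 (by rw [fixpow c h, fixpow c h])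
  obtain ⟨G, g, hg, hm, hdG, hT, hfac⟩ := ex_G (k := k) (t := t) hq a ha (by omega) c (Or.inr ⟨hc1, hc3⟩)
  have hev : ∀ x0 y0 : K, ev2 x0 y0 (Polynomial.derivative (AA q k t a (sv c) X)) = a 0 * (c * y0 ^ q ^ t - (x0 + c * y0) ^ q ^ t) := by
    intro x0 y0
    rw [H.dAA_pos k t (by omega), map_mul, map_sub, map_mul, map_pow, map_pow, ev2_sv, ev2_X, ev2_C, ev2_C]
    simp
  obtain ⟨f1, D', f2⟩ := dfac G k t a c g hfac (x1 - c * y1) y1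
  rw [hev] at f2
  rw [sub_add_cancel] at f1 f2
  have hG0 : ev2 (x1 - c * y1) y1 G = 0 := by
    rw [h1] at f1; simpa [hg, h2] using f1.symm
  rw [hG0, mul_zero, zero_add] at f2
  have hG1 : ev2 (x1 - c * y1) y1 G.derivative ≠ 0 := by
    intro h
    rw [h, mul_zero, mul_zero, mul_eq_zero, or_iff_right ha0, sub_eq_zero] at f2
    exact hc2 (by rw [div_pow, ← f2, mul_div_cancel_right₀ _ (by positivity)])
  obtain ⟨φ, p1, p2, z, p3, p4⟩ := smooth_phi G hm _ _ hG0 hG1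
  obtain ⟨P, d, δ, hd1, hPm, hPd, hPG, -, hmain, -⟩ := curve hm hT φ p1 z p3 p4 dvd_rfl (Or.inl p2)
  have hcnt : NZP ≤ Nat.card (Option {z : K × K // AA q k t a z.1 z.2 = 0 ∧ DD q z.1 z.2 ≠ 0}) := by
    have key : ∀ x0 y0 : K, (P.map (Polynomial.evalRingHom x0)).eval y0 = 0 → AA q k t a (x0 + c * y0) y0 = 0 ∧ (DD q (x0 + c * y0) y0 = 0 → x0 = 0 ∧ y0 = 0) := by
      intro x0 y0 h
      rw [← ev2_K] at h
      obtain ⟨R, hR⟩ := hPG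
      have hG : ev2 x0 y0 G = 0 := by rw [hR, map_mul, h, zero_mul]
      obtain ⟨f1, D', f2⟩ := dfac G k t a c g hfac x0 y0
      rw [hG] at f1 f2
      refine ⟨by simpa using f1, fun hD => ?_⟩
      rw [hev, hD, mul_zero, zero_mul, zero_add, mul_zero, mul_eq_zero, or_iff_right ha0, sub_eq_zero] at f2
      by_cases hy : y0 = 0
      · rw [hy, zero_pow (by positivity), mul_zero, add_zero] at f2
        exact ⟨pow_eq_zero_iff (by positivity) |>.1 f2.symm, hy⟩
      · exfalso
        have hl : ((x0 + c * y0) / y0) ^ q = (x0 + c * y0) / y0 := by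
          rw [DD] at hD
          rw [div_pow, div_eq_div_iff (by positivity) hy]
          linear_combination hD
        have := fixpow _ hl t
        rw [div_pow, ← f2, mul_div_cancel_right₀ _ (by positivity)] at this
        rw [← this] at hl
        exact hc3 hl
    refine Nat.card_le_card_of_injective (fun z => if h : DD q (z.1.1 + c * z.1.2) z.1.2 ≠ 0 then some ⟨(z.1.1 + c * z.1.2, z.1.2), (key _ _ z.2).1, h⟩ else none) ?_
    intro z w hzw
    simp only at hzw
    split_ifs at hzw with u1 u2 u2
    · simp only [Option.some.injEq, Subtype.mk.injEq, Prod.mk.injEq] at hzw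
      obtain ⟨v1, v2⟩ := hzw
      ext
      · rw [v2] at v1; exact add_right_cancel v1
      · exact v2
    · have v1 := (key _ _ z.2).2 (not_not.1 u1)
      have v2 := (key _ _ w.2).2 (not_not.1 u2)
      ext
      · rw [v1.1, v2.1]
      · rw [v1.2, v2.2]
  rw [Finite.card_option] at hcnt
  have hdD : d ≤ G.natDegree := hPd ▸ Polynomial.natDegree_le_of_dvd hPG hm.ne_zero
  have e1 := dd_mono d _ hd1 hdD
  have e2 : (G.natDegree : ℝ) = qr ^ k + q ^ t - q - 1 := by
    have : ((G.natDegree + q + 1 : ℕ) : ℝ) = ((q ^ k + q ^ t : ℕ) : ℝ) := by rw [hdG]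
    push_cast at this; linarith
  have e3 : (NZP : ℝ) ≤ NAD + 1 := by exact_mod_cast hcnt
  have e4 : (d : ℝ) ≤ G.natDegree := by exact_mod_cast hdD
  have e5 := H.sq1
  have e6 : (0 : ℝ) ≤ δ := by positivity
  have e7 := mul_le_mul_of_nonneg_right e1 (zero_le_one.trans e5)
  have e8 := mul_le_mul_of_nonneg_left e5 e6
  rw [e2] at e4 e7
  have e9 : (qr ^ k + q ^ t - q - 1 - 1) * (qr ^ k + q ^ t - q - 1 - 2) = (qr ^ k + q ^ t - q - 2) * (qr ^ k + q ^ t - q - 3) := by ring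
  rw [e9] at e7
  linarith
end Br
open Polynomial (X C)
section Z0
variable {p e q n : ℕ} {K : Type} [Field K] [Fintype K]
theorem QF.pow_sum (H : QK) {S : Type} [CommRing S] [Algebra K S] (f : ℕ → S) (j m : ℕ) :
    (∑ i ∈ Finset.range m, f i) ^ q ^ j = ∑ i ∈ Finset.range m, f i ^ q ^ j := by
  have := H.q2
  induction m with
  | zero => rw [Finset.range_zero, Finset.sum_empty, Finset.sum_empty, zero_pow (by positivity)]
  | succ m ih => rw [Finset.sum_range_succ, Finset.sum_range_succ, H.pow_add, ih]
theorem QF.froot (H : QK) (k v : ℕ) (a : ℕ → K) (hvk : v < k) (ha : a k = 1) (hv : a v ≠ 0) (hmin : ∀ j, j < v → a j = 0) :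
    ∃ b : ℕ → K, b (k - v) = 1 ∧ b 0 ≠ 0 ∧
      ∀ (S : Type) [CommRing S] [Algebra K S] (z : S), LP q k a z = (LP q (k - v) b z) ^ q ^ v := by
  haveI := H.ch
  haveI := Fact.mk H.hp
  have hq := H.q2
  have hinj : Function.Injective (fun x : K => x ^ q ^ v) := by
    have := iterateFrobenius_inj K p (e * v)
    intro x y hxy
    apply this
    simp only [iterateFrobenius_def, pow_mul]
    simpa only [H.hq] using hxy
  have hsur := Finite.surjective_of_injective hinj
  choose b hb using fun j => hsur (a (j + v))
  refine ⟨b, hinj ?_, ?_, ?_⟩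
  · simp only [hb, one_pow]; rw [Nat.sub_add_cancel hvk.le, ha]
  · intro h
    have := hb 0
    simp only [h] at this
    rw [zero_pow (by positivity), zero_add] at this
    exact hv this.symm
  · intro S _ _ z
    rw [LP, LP, H.pow_sum, show k + 1 = v + (k - v + 1) by omega, Finset.sum_range_add, Finset.sum_eq_zero, zero_add]
    · refine Finset.sum_congr rfl fun j _ => ?_
      have := hb j
      simp only at this
      rw [mul_pow, ← map_pow, this, ← pow_mul, ← _root_.pow_add, add_comm v j]
    · intro j hj
      rw [hmin j (Finset.mem_range.1 hj), map_zero, zero_mul]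
theorem LP_C (k : ℕ) (a : ℕ → K) : LP q k a (sv (0 : K)) = C (LP q k a X) := by
  simp [LP, map_sum, sv]
theorem QF.dAA_zero (H : QK) (k : ℕ) (a : ℕ → K) (h0 : a 0 = 0) :
    Polynomial.derivative (AA q k 0 a (sv (0 : K)) X) = C (LP q k a X) := by
  rw [AA, Polynomial.derivative_sub, Polynomial.derivative_mul, Polynomial.derivative_mul, H.dLP, H.dLP, h0, ← LP_C]
  simp [dsv]
theorem ev2_DD {S : Type} [CommRing S] [Algebra K S] (x y : S) : ev2 x y (DD q (sv (0 : K)) X) = DD q x y := by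
  rw [DD, DD, map_sub, map_mul, map_mul, map_pow, map_pow, ev2_sv, ev2_X, map_zero, zero_mul, add_zero]
theorem LP_ne (hq : 2 ≤ q) (k : ℕ) (a : ℕ → K) (ha : a k = 1) : LP q k a (X : KX) ≠ 0 := by
  intro h
  have := (LP_top hq a ha (X : KX) Polynomial.natDegree_X_le).2
  rw [h] at this
  simp at this
theorem QF.zpt (H : QK) (k : ℕ) (a : ℕ → K) (h0 : a 0 = 0) (G : KXX) (g : K)
    (hfac : AA q k 0 a (sv 0) X = C (C g) * (DD q (sv 0) X * G)) (x0 y0 : K) (hG : ev2 x0 y0 G = 0) :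
    AA q k 0 a x0 y0 = 0 ∧ (DD q x0 y0 = 0 → LP q k a x0 = 0 ∧ LP q k a y0 = 0) := by
  have hq := H.q2
  obtain ⟨f1, D', f2⟩ := dfac G k 0 a 0 g hfac x0 y0
  rw [hG] at f1 f2
  rw [H.dAA_zero k a h0, ev2_C, LP_map, Polynomial.aeval_X] at f2
  simp only [zero_mul, add_zero, mul_zero, zero_add] at f1 f2
  refine ⟨f1, fun hD => ?_⟩
  rw [hD, zero_mul, mul_zero] at f2
  refine ⟨f2, ?_⟩
  by_cases hx : x0 = 0
  · have e1 := congrArg (ev2 (X : KX) (C y0)) hfac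
    have hs : ev2 (X : KX) (C y0) (sv (0 : K)) = X := by rw [ev2_sv]; simp
    rw [AA_map, map_mul, map_mul, ev2_DD, hs, ev2_X, ev2_C] at e1
    have hG' : (ev2 (X : KX) (C y0) G).eval 0 = 0 := by
      have := ev2_comp (Polynomial.aeval (0 : K)) (X : KX) (C y0) G
      rw [Polynomial.aeval_X, Polynomial.aeval_C, Algebra.algebraMap_self, RingHom.id_apply, ← hx, hG] at this
      rwa [Polynomial.coe_aeval_eq_eval, hx] at this
    have e2 := congrArg (fun u => (Polynomial.derivative u).eval 0) e1
    have hL : LP q k a (C y0 : KX) = C (LP q k a y0) := by simp [LP, map_sum]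
    have hL0 : (LP q k a (X : KX)).eval 0 = 0 := by
      have : Polynomial.aeval (0 : K) (LP q k a (X : KX)) = 0 := by
        rw [LP_map, Polynomial.aeval_X]; rw [hx] at f2; exact f2
      rwa [Polynomial.coe_aeval_eq_eval] at this
    simp only [AA, DD, hL, Polynomial.derivative_sub, Polynomial.derivative_mul, H.dLP, h0] at e2
    have hq0 : (0 : K) ^ (q - 1) = 0 := zero_pow (by omega)
    have hq1 : (0 : K) ^ q = 0 := zero_pow (by omega)
    simpa [hG', hL0, hq0, hq1, ← map_pow] using e2
  · have hl : (y0 / x0) ^ q = y0 / x0 := by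
      rw [DD] at hD
      rw [div_pow, div_eq_div_iff (by positivity) hx]
      linear_combination -hD
    have := LP_smul k a _ x0 hl
    rwa [div_mul_cancel₀ _ hx, f2, mul_zero] at this
theorem QF.phi0 (H : QK) (k v : ℕ) (a : ℕ → K) (hv1 : 1 ≤ v) (b : ℕ → K) (hb1 : b (k - v) = 1) (hb0 : b 0 ≠ 0)
    (hb : ∀ (S : Type) [CommRing S] [Algebra K S] (z : S), LP q k a z = (LP q (k - v) b z) ^ q ^ v) (x0 : K) (hx0 : x0 ≠ 0) (hf : LP q k a x0 = 0) :
    ∃ x y : PK, AA q k 0 a x y = 0 ∧ DD q x y ≠ 0 ∧ y ≠ 0 ∧ PowerSeries.constantCoeff y = 0 := by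
  have hq := H.q2
  set l := k - v with hl
  have hqv : ∀ j, 2 ≤ q ^ (v + j) := fun j => hq.trans (Nat.le_self_pow (by omega) q)
  let w : ℕ → PK := fun j => algebraMap K _ (b j) * (1 - PowerSeries.X ^ (q ^ (v + j) - 1))
  have hw : ∀ j, PowerSeries.constantCoeff (w j) = b j := fun j => by
    have : q ^ (v + j) - 1 ≠ 0 := by have := hqv j; omega
    simp [w, this, PowerSeries.algebraMap_apply]
  let g : Polynomial PK := ∑ j ∈ Finset.range (l + 1), C (w j) * X ^ q ^ j
  have hgd : g.natDegree ≤ q ^ l := by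
    refine Polynomial.natDegree_sum_le_of_forall_le _ _ fun j hj => (Polynomial.natDegree_C_mul_X_pow_le _ _).trans ?_
    exact Nat.pow_le_pow_right (by omega) (by simpa [Nat.lt_succ_iff] using hj)
  have hgc : g.coeff (q ^ l) = w l := by
    simp only [g]
    rw [Polynomial.finset_sum_coeff, Finset.sum_eq_single l]
    · simp
    · intro j _ hj
      rw [Polynomial.coeff_C_mul_X_pow, if_neg]
      intro h; exact hj (Nat.pow_right_injective hq h).symm
    · simp
  have hu : IsUnit (w l) := by
    rw [PowerSeries.isUnit_iff_constantCoeff, hw, hb1]; exact isUnit_one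
  have hgev : ∀ z, g.eval z = ∑ j ∈ Finset.range (l + 1), w j * z ^ q ^ j := fun z => by simp [g, Polynomial.eval_finset_sum]
  have hf1 : LP q l b x0 = 0 := by
    rw [hb] at hf; exact pow_eq_zero_iff (by positivity) |>.1 hf
  obtain ⟨x, hx, hxc⟩ := ps_hensel g (by
      obtain ⟨u, hu⟩ := hu
      refine ⟨(u⁻¹ : _ˣ), Units.isUnit _, Polynomial.monic_of_natDegree_le_of_coeff_eq_one (q ^ l) ((Polynomial.natDegree_C_mul_le _ _).trans hgd) ?_⟩
      rw [Polynomial.coeff_C_mul, hgc, ← hu, Units.inv_mul]) x0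
    (by rw [hgev]; simpa [hw, LP] using hf1)
    (by
      have : Polynomial.derivative g = C (w 0) := by
        simp only [g]
        rw [Polynomial.derivative_sum, Finset.sum_eq_single 0]
        · simp
        · intro j _ hj
          rw [Polynomial.derivative_C_mul, H.dpow _ j hj, mul_zero]
        · simp
      rw [this, Polynomial.eval_C, hw]; exact hb0)
  have hx1 : x ≠ 0 := by rintro rfl; exact hx0 (by simpa using hxc.symm)
  have hqv0 := hqv 0
  rw [add_zero] at hqv0
  refine ⟨x, PowerSeries.X ^ q ^ v * x, ?_, ?_, ?_, ?_⟩
  · have : PowerSeries.X * LP q l b x + -1 * LP q l b (PowerSeries.X ^ q ^ v * x) = 0 := by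
      have h2 : PowerSeries.X * LP q l b x + -1 * LP q l b (PowerSeries.X ^ q ^ v * x) = PowerSeries.X * g.eval x := by
        rw [hgev, LP, LP, Finset.mul_sum, Finset.mul_sum, Finset.mul_sum, ← Finset.sum_add_distrib]
        refine Finset.sum_congr rfl fun j _ => ?_
        have h3 : (PowerSeries.X : PK) ^ q ^ (v + j) = PowerSeries.X * PowerSeries.X ^ (q ^ (v + j) - 1) := by
          rw [← pow_succ', Nat.sub_add_cancel (by have := hqv j; omega)]
        simp only [w]
        rw [mul_pow, ← pow_mul, ← _root_.pow_add, h3]; ring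
      rw [h2, hx, mul_zero]
    have h4 := congrArg (· ^ q ^ v) this
    have h5 : (-1 : PK) ^ q ^ v = -1 := by
      have := H.pow_add (1 : PK) (-1) v
      rw [add_neg_cancel, zero_pow (by positivity), one_pow] at this
      linear_combination -this
    simp only [H.pow_add] at h4
    rw [mul_pow, mul_pow, h5, ← hb, ← hb, zero_pow (by positivity)] at h4
    rw [AA, pow_zero, pow_one, pow_one]
    linear_combination x * h4
  · have : DD q x (PowerSeries.X ^ q ^ v * x) = x ^ (q + 1) * (PowerSeries.X ^ q ^ v - PowerSeries.X ^ (q ^ v * q)) := by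
      rw [DD, mul_pow, ← pow_mul]; ring
    rw [this]
    refine mul_ne_zero (pow_ne_zero _ hx1) (sub_ne_zero.2 fun h => ?_)
    have := congrArg (PowerSeries.coeff (q ^ v)) h
    rw [PowerSeries.coeff_X_pow_self, PowerSeries.coeff_X_pow, if_neg (by nlinarith)] at this
    exact one_ne_zero this
  · exact mul_ne_zero (pow_ne_zero _ PowerSeries.X_ne_zero) hx1
  · simp; omega
theorem QF.phiz (H : QK) (k v : ℕ) (a : ℕ → K) (h0 : a 0 = 0) (hv1 : 1 ≤ v) (b : ℕ → K) (hb1 : b (k - v) = 1) (hb0 : b 0 ≠ 0)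
    (hb : ∀ (S : Type) [CommRing S] [Algebra K S] (z : S), LP q k a z = (LP q (k - v) b z) ^ q ^ v)
    (G : KXX) (hm : G.Monic) (g : K) (hg : g ≠ 0)
    (hfac : AA q k 0 a (sv 0) X = C (C g) * (DD q (sv 0) X * G)) (m x1 y1 : K) (h1 : LP q k a x1 = m * x1) (h2 : LP q k a y1 = m * y1) (h3 : DD q x1 y1 ≠ 0) :
    ∃ φ : KXX →ₐ[K] PK, φ G = 0 ∧ ∃ z, φ z ≠ 0 ∧ PowerSeries.constantCoeff (φ z) = 0 := by
  have hq := H.q2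
  have hx1 : x1 ≠ 0 := fun h => h3 (by rw [DD, h, zero_pow (by omega)]; ring)
  by_cases hm0 : m = 0
  · rw [hm0, zero_mul] at h1
    obtain ⟨x, y, e1, e2, e3, e4⟩ := H.phi0 k v a hv1 b hb1 hb0 hb x1 hx1 h1
    have hs : ev2 x y (sv (0 : K)) = x := by rw [ev2_sv]; simp
    refine ⟨ev2 x y, ?_, X, by rwa [ev2_X], by rwa [ev2_X]⟩
    have e5 := congrArg (ev2 x y) hfac
    rw [AA_map, map_mul, map_mul, ev2_DD, hs, ev2_X, ev2_C, Polynomial.aeval_C, e1] at e5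
    have e6 : algebraMap K PK g ≠ 0 := by simpa using hg
    exact (mul_eq_zero.1 ((mul_eq_zero.1 e5.symm).resolve_left e6)).resolve_left e2
  · obtain ⟨f1, D', f2⟩ := dfac G k 0 a 0 g hfac x1 y1
    rw [H.dAA_zero k a h0, ev2_C, LP_map, Polynomial.aeval_X] at f2
    rw [zero_mul, add_zero] at f1 f2
    have hA : AA q k 0 a x1 y1 = 0 := by rw [AA, h1, h2]; ring
    have hG0 : ev2 x1 y1 G = 0 := by
      rw [hA] at f1; simpa [hg, h3] using f1.symm
    rw [hG0, h1, mul_zero, zero_add] at f2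
    obtain ⟨φ, p1, -, p3⟩ := smooth_phi G hm _ _ hG0 (fun h => by
      rw [h, mul_zero, mul_zero] at f2
      exact (mul_ne_zero hm0 hx1) f2)
    exact ⟨φ, p1, p3⟩
end Z0
open Polynomial (X C)
section Fin0
variable {p e q n : ℕ} {K : Type} [Field K] [Fintype K]
theorem fin_arith (q Dr Q s d δ Np N A B hh kv c2 : ℝ) (hq : 2 ≤ q) (hs : 1 ≤ s) (hQ : Q = s * s) (hN : 0 ≤ N) (hA : A = Dr + q)
    (hm : Q + 1 - ((d - 1) * (d - 2) - δ) * s ≤ Np + δ + d) (hNp : Np ≤ N + q * hh + hh - q)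
    (hc2 : c2 = 2 * kv + A - q * hh + hh - 1) (hkv : q * kv ≤ A) (hh1 : 1 ≤ hh)
    (hd1 : (d - 1) * (d - 2) ≤ (Dr - 1) * (Dr - 2)) (hdD : d ≤ Dr) (hδ : 0 ≤ δ)
    (hlt : q * hh ≤ kv ∨ (hh = kv ∧ ((q * kv = A ∧ Dr = 2 ∧ q = 2) ∨ (6 ≤ Dr ∧ (1 ≤ δ ∨ (d ≤ Dr - 1 ∧ (d - 1) * (d - 2) ≤ (Dr - 2) * (Dr - 3))))))) :
    Q - (Dr - 1) * (Dr - 2) * s - c2 ≤ N := by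
  have h1 := mul_le_mul_of_nonneg_right hd1 (zero_le_one.trans hs)
  have h2 : 0 ≤ δ * (s - 1) := mul_nonneg hδ (by linarith)
  rcases hlt with h | ⟨rfl, h⟩
  · nlinarith
  · rcases h with ⟨g1, g2, g3⟩ | ⟨g1, g | ⟨g2, g3⟩⟩
    · subst g3; nlinarith
    · by_cases hs2 : s ≤ (Dr - 1) * (Dr - 2)
      · have := mul_le_mul_of_nonneg_right hs2 (zero_le_one.trans hs)
        nlinarith
      · have h3 : s - 1 ≤ δ * (s - 1) := by nlinarith
        nlinarith
    · have h3 := mul_le_mul_of_nonneg_right g3 (zero_le_one.trans hs)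
      have h4 : (2 * Dr - 4) ≤ ((Dr - 1) * (Dr - 2) - (Dr - 2) * (Dr - 3)) * s := by nlinarith
      nlinarith
theorem QF.ker_le (H : QK) (l : ℕ) (b : ℕ → K) (hb1 : b l = 1) : Nat.card {x : K // LP q l b x = 0} ≤ q ^ l := by
  classical
  have hq := H.q2
  have h0 := LP_ne hq l b hb1
  rw [Nat.card_eq_fintype_card, Fintype.card_subtype]
  calc _ ≤ (LP q l b (X : KX)).roots.toFinset.card := by
        apply Finset.card_le_card
        intro x hx
        have h1 : LP q l b x = 0 := by simpa using hx
        have := LP_map q l b (Polynomial.aeval x) (X : KX)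
        rw [Polynomial.aeval_X, h1, Polynomial.coe_aeval_eq_eval] at this
        simpa [h0] using this
    _ ≤ _ := (Multiset.toFinset_card_le _).trans ((Polynomial.card_roots' _).trans (LP_top hq b hb1 _ Polynomial.natDegree_X_le).1)
theorem QF.no_split (H : QK) (k v : ℕ) (a : ℕ → K) (hv1 : 1 ≤ v) (hvk : v < k) (b : ℕ → K) (hb1 : b (k - v) = 1)
    (hb : ∀ (S : Type) [CommRing S] [Algebra K S] (z : S), LP q k a z = (LP q (k - v) b z) ^ q ^ v)
    (P : KXX) (hP : q ^ (k - v) < P.natDegree) (hPA : P ∣ AA q k 0 a (sv 0) X)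
    (hspl : ∀ N, 1 ≤ N → ∀ num den : KXX, ¬ P ∣ den → P ∣ C X * num ^ N - X * den ^ N →
        ∃ α β γ : K, P ∣ C X * num - (C (C α + C β * X) + C (C γ) * X) * den) : False := by
  have hq := H.q2
  have hs : sv (0 : K) = C X := by simp [sv]
  have hX : (X : KXX).natDegree ≤ 1 := Polynomial.natDegree_X_le
  obtain ⟨α, β, γ, h⟩ := hspl (q ^ v) (Nat.one_le_pow _ _ (by omega)) (LP q (k - v) b X) (LP q (k - v) b (sv 0))
    (by
      rw [LP_C]
      intro h
      have := Polynomial.natDegree_le_of_dvd h (Polynomial.C_ne_zero.2 (LP_ne hq _ b hb1))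
      rw [Polynomial.natDegree_C] at this
      omega)
    (by
      rw [← hb, ← hb, ← dvd_neg]
      convert hPA using 1
      rw [AA, hs]; ring)
  rw [LP_C] at h
  obtain ⟨t1, t2⟩ := LP_top (k := k - v) hq b hb1 (X : KXX) hX
  have hkv : 2 ≤ q ^ (k - v) := hq.trans (Nat.le_self_pow (by omega) q)
  have hd : ((C (C α + C β * X) + C (C γ) * X) * C (LP q (k - v) b X) : KXX).natDegree ≤ 1 := by
    refine (Polynomial.natDegree_mul_C_le _ _).trans ?_
    compute_degree
  have hE := Polynomial.eq_zero_of_dvd_of_natDegree_lt h (by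
    refine lt_of_le_of_lt ((Polynomial.natDegree_sub_le _ _).trans (max_le ((Polynomial.natDegree_C_mul_le _ _).trans t1) (hd.trans (by omega)))) hP)
  have := congrArg (fun u => u.coeff (q ^ (k - v))) hE
  simp only [Polynomial.coeff_sub, Polynomial.coeff_C_mul, t2] at this
  rw [Polynomial.coeff_eq_zero_of_natDegree_lt (hd.trans_lt (by omega))] at this
  simp at this
theorem QF.case_zero (H : QK) (k v h : ℕ) (a : ℕ → K) (ha : a k = 1) (h0 : a 0 = 0) (hvk : v < k) (hv : a v ≠ 0) (hmin : ∀ j, j < v → a j = 0)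
    (hh : Nat.card {x : K // LP q k a x = 0} = q ^ h) (m x1 y1 : K) (h1 : LP q k a x1 = m * x1) (h2 : LP q k a y1 = m * y1) (h3 : DD q x1 y1 ≠ 0) :
    (Nat.card K : ℝ) - (qr ^ k + q ^ 0 - q - 2) * (qr ^ k + q ^ 0 - q - 3) * Real.sqrt cK
        - (2 * qr ^ (k - v) + q ^ k - q ^ (h + 1) + q ^ h - 1)
      ≤ Nat.card {z : K × K // AA q k 0 a z.1 z.2 = 0 ∧ DD q z.1 z.2 ≠ 0} := by
  classical
  have hq := H.q2
  have hv1 : 1 ≤ v := by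
    by_contra hc
    exact hv (by rw [show v = 0 by omega, h0])
  obtain ⟨b, hb1, hb0, hb⟩ := H.froot k v a hvk ha hv hmin
  obtain ⟨G, g, hg, hm, hdG, hT, hfac⟩ := ex_G (k := k) (t := 0) hq a ha (by omega) 0 (Or.inl ⟨rfl, rfl⟩)
  have hGA : G ∣ AA q k 0 a (sv 0) X := ⟨C (C g) * DD q (sv 0) X, by rw [hfac]; ring⟩
  obtain ⟨φ, p1, z, p3, p4⟩ := H.phiz k v a h0 hv1 b hb1 hb0 hb G hm g hg hfac m x1 y1 h1 h2 h3
  obtain ⟨P, d, δ, hd1, hPm, hPd, hPG, -, hmain, hspl⟩ := curve hm hT φ p1 z p3 p4 hGA (Or.inr ⟨_, LP_ne hq k a ha, H.dAA_zero k a h0⟩)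
  have hkey : ∀ x0 y0 : K, (P.map (Polynomial.evalRingHom x0)).eval y0 = 0 → AA q k 0 a x0 y0 = 0 ∧ (DD q x0 y0 = 0 → LP q k a x0 = 0 ∧ LP q k a y0 = 0) := by
    intro x0 y0 hz
    rw [← ev2_K] at hz
    obtain ⟨R, hR⟩ := hPG
    exact H.zpt k a h0 G g hfac x0 y0 (by rw [hR, map_mul, hz, zero_mul])
  have hV : Nat.card (H.V k 0 a 0) = q ^ h := by
    rw [← hh]
    refine Nat.card_congr (Equiv.subtypeEquivRight fun x => ?_)
    change LP q k a x = 0 * _ ↔ _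
    rw [zero_mul]
  have hVm : ∀ x, x ∈ H.V k 0 a 0 ↔ LP q k a x = 0 := fun x => by
    change LP q k a x = 0 * _ ↔ _
    rw [zero_mul]
  have hcnt : NZP + (q ^ h - 1) * (q ^ h - q)
      ≤ Nat.card {z : K × K // AA q k 0 a z.1 z.2 = 0 ∧ DD q z.1 z.2 ≠ 0} + q ^ h * q ^ h := by
    have i1 := H.indep_card (H.V k 0 a 0) (H.V_mul k 0 a 0)
    rw [hV] at i1
    rw [← i1, ← hV, ← Nat.card_prod]
    simp only [Nat.card_eq_fintype_card]
    rw [← Fintype.card_sum, ← Fintype.card_sum]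
    refine Fintype.card_le_of_injective (fun w => match w with
      | Sum.inl z => if hD : DD q z.1.1 z.1.2 = 0 then
          Sum.inr (⟨z.1.1, (hVm _).2 ((hkey _ _ z.2).2 hD).1⟩, ⟨z.1.2, (hVm _).2 ((hkey _ _ z.2).2 hD).2⟩)
          else Sum.inl ⟨z.1, (hkey _ _ z.2).1, hD⟩
      | Sum.inr z => Sum.inr (⟨z.1.1, z.2.1⟩, ⟨z.1.2, z.2.2.1⟩)) ?_
    rintro (⟨⟨x, y⟩, hz⟩ | ⟨⟨x, y⟩, hz⟩) (⟨⟨x', y'⟩, hz'⟩ | ⟨⟨x', y'⟩, hz'⟩) hw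
    · simp only at hw
      split_ifs at hw with u1 u2 u2 <;> simp at hw <;> simp [hw]
    · exfalso
      simp only at hw
      split_ifs at hw with u1
      simp at hw
      rw [hw.1, hw.2] at u1
      exact hz'.2.2 u1
    · exfalso
      simp only at hw
      split_ifs at hw with u1
      simp at hw
      rw [← hw.1, ← hw.2] at u1
      exact hz.2.2 u1
    · simp at hw; simp [hw]
  have hkv : h ≤ k - v := by
    rw [← Nat.pow_le_pow_iff_right (by omega : 1 < q), ← hh]
    refine le_trans (le_of_eq (Nat.card_congr (Equiv.subtypeEquivRight fun x => ?_))) (H.ker_le (k - v) b hb1)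
    rw [hb, pow_eq_zero_iff (by positivity)]
  have hdD : d ≤ G.natDegree := hPd ▸ Polynomial.natDegree_le_of_dvd hPG hm.ne_zero
  have hDk : G.natDegree + q = q ^ k := by rw [pow_zero] at hdG; omega
  have hk1 : q ^ (k - v) * q ≤ q ^ k := by
    rw [← pow_succ]; exact Nat.pow_le_pow_right (by omega) (by omega)
  have hone : q ^ h = 1 ∨ q ≤ q ^ h := by
    rcases Nat.eq_zero_or_pos h with rfl | hp
    · left; simp
    · right; exact Nat.le_self_pow (by omega) q
  have hNp : (NZP : ℝ) ≤
      Nat.card {z : K × K // AA q k 0 a z.1 z.2 = 0 ∧ DD q z.1 z.2 ≠ 0} + q * qr ^ h + q ^ h - q := by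
    have hc : ((q ^ h - 1) * (q ^ h - q) : ℕ) = (qr ^ h - 1) * (qr ^ h - q) := by
      rcases hone with h1 | h1
      · rw [h1]; have : qr ^ h = 1 := by exact_mod_cast h1
        rw [this]; simp
      · push_cast [Nat.cast_sub h1, Nat.cast_sub (show 1 ≤ q ^ h by omega)]; ring
    have : ((NZP + (q ^ h - 1) * (q ^ h - q) : ℕ) : ℝ)
      ≤ ((Nat.card {z : K × K // AA q k 0 a z.1 z.2 = 0 ∧ DD q z.1 z.2 ≠ 0} + q ^ h * q ^ h : ℕ) : ℝ) := by exact_mod_cast hcnt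
    rw [Nat.cast_add, hc] at this
    push_cast at this
    linarith
  have e2 : qr ^ k = (G.natDegree : ℝ) + q := by exact_mod_cast hDk.symm
  have key := fin_arith q G.natDegree cK (Real.sqrt cK) d δ _ _ (qr ^ k) 0 (qr ^ h) (qr ^ (k - v)) _
    (by exact_mod_cast hq) H.sq1 (Real.mul_self_sqrt (by positivity)).symm (Nat.cast_nonneg _) e2 hmain hNp rfl
    (by rw [mul_comm]; exact_mod_cast hk1) (by exact_mod_cast Nat.one_le_pow h q (by omega)) (dd_mono d _ hd1 hdD) (by exact_mod_cast hdD) (by positivity) ?_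
  · refine le_trans (le_of_eq ?_) key
    rw [e2]; ring
  rcases hkv.lt_or_eq with hlt | heq
  · left
    rw [← pow_succ']
    exact pow_le_pow_right₀ (by exact_mod_cast (by omega : 1 ≤ q)) hlt
  · right
    refine ⟨by rw [heq], ?_⟩
    by_cases h22 : q = 2 ∧ k = 2
    · left
      obtain ⟨rfl, rfl⟩ := h22
      have : v = 1 := by omega
      subst this
      have : G.natDegree = 2 := by omega
      rw [this]; norm_num
    · right
      have hk2 : 2 ≤ k := by omega
      have h6 : 6 ≤ G.natDegree ∧ q ^ (k - 1) < G.natDegree := by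
        have hk' : q ^ k = q ^ (k - 1) * q := by rw [← pow_succ]; congr 1; omega
        have hqk : q ≤ q ^ (k - 1) := Nat.le_self_pow (by omega) q
        by_cases hq2 : q = 2
        · have hk3 : 2 ^ 2 ≤ q ^ (k - 1) := by rw [hq2]; exact Nat.pow_le_pow_right (by omega) (by omega)
          subst hq2; omega
        · have : 3 ≤ q := by omega
          have : q ^ (k - 1) * 3 ≤ q ^ (k - 1) * q := Nat.mul_le_mul_left _ this
          have : q * 3 ≤ q ^ (k - 1) * q := by nlinarith
          constructor <;> nlinarith
      refine ⟨by exact_mod_cast h6.1, ?_⟩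
      by_cases hδ : δ = 0
      · right
        have hne : d < G.natDegree := by
          refine lt_of_le_of_ne hdD fun hdeq => ?_
          refine H.no_split k v a hv1 hvk b hb1 hb P ?_ (hPG.trans hGA) (hspl hδ)
          rw [hPd, hdeq]
          exact lt_of_le_of_lt (Nat.pow_le_pow_right (by omega) (by omega)) h6.2
        have := dd_mono d (G.natDegree - 1) hd1 (by omega)
        rw [Nat.cast_sub (by omega), Nat.cast_one] at this
        refine ⟨?_, by linarith⟩
        have : (d : ℝ) + 1 ≤ G.natDegree := by exact_mod_cast hne
        linarith
      · left
        exact_mod_cast Nat.one_le_iff_ne_zero.2 hδ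
end Fin0
theorem stmt_2 (p e q n k t v h W r : ℕ) (hp : p.Prime) (he : 1 ≤ e) (hq : q = p ^ e)
    (htn : t < n) (hkn : k < n)
    (K : Type) [Field K] [Fintype K] (hcard : Fintype.card K = q ^ n)
    (a : ℕ → K) (hmonic : a k = 1) (hat : a t = 0)
    (hnotmono : ∃ j, j < k ∧ a j ≠ 0)
    (hstruct :
      (t = 0 ∧ a 0 = 0) ∨
      (1 ≤ t ∧ a 0 ≠ 0 ∧
        ((t = 1 ∧ 3 ≤ k) ∨
         (2 ≤ t ∧ (t ∣ k → 3 * t ≤ k) ∧ (¬ t ∣ k → 2 * t - 1 ≤ k) ∧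
           (((∀ j, 2 ≤ j → j ≤ t → a j = 0) ∧ t + 2 ≤ k) ∨
            (∀ j, 1 ≤ j → j ≤ t → a j = 0))))))
    (f : K → K) (hf : f = fun x => ∑ j ∈ Finset.range (k + 1), a j * x ^ q ^ j)
    (hv : a v ≠ 0) (hvmin : ∀ j, j < v → a j = 0)
    (hh : h = Nat.log q (Nat.card {x : K // f x = 0}))
    (hr : r = Nat.card {m : K // 1 < Nat.log q (Nat.card {x : K // f x = m * x ^ q ^ t})})
    (hW2 : 2 ≤ W)
    (hWub : ∀ m : K, Nat.log q (Nat.card {x : K // f x = m * x ^ q ^ t}) ≤ W)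
    (hWatt : ∃ m : K, Nat.log q (Nat.card {x : K // f x = m * x ^ q ^ t}) = W) :
    (r : ℝ) ≥
      ((q : ℝ) ^ n
        - ((q : ℝ) ^ k + (q : ℝ) ^ t - (q : ℝ) - 2) *
            ((q : ℝ) ^ k + (q : ℝ) ^ t - (q : ℝ) - 3) * Real.sqrt ((q : ℝ) ^ n)
        - (if t = 0 then
            2 * (q : ℝ) ^ (k - v) + (q : ℝ) ^ k - (q : ℝ) ^ (h + 1) + (q : ℝ) ^ h - 1
          else (q : ℝ) ^ k + (q : ℝ) ^ t - (q : ℝ) - 1))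
      / ((q : ℝ) ^ (2 * W) - (q : ℝ) ^ (W + 1) - (q : ℝ) ^ W + (q : ℝ)) := by
  have H : QF p e q n K := ⟨hp, he, hq, by omega, by rw [Nat.card_eq_fintype_card, hcard], by
    haveI := Fact.mk hp
    exact charP_of_card_eq_prime_pow (f := e * n) (by rw [hcard, hq, pow_mul])⟩
  have hfL : f = fun x => LP q k a x := by rw [hf]; funext x; simp [LP]
  subst hfL
  have hq2 := H.q2
  have hqn : (q : ℝ) ^ n = Nat.card K := by rw [H.card]; push_cast; rfl
  obtain ⟨m, hm⟩ := hWatt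
  obtain ⟨x1, y1, e1, e2, e3⟩ := H.fat_pair k t a m (by rw [hm]; exact hW2)
  have hcount := H.count_le k t W a hWub
  rw [← hr] at hcount
  have hWq : q ^ 2 ≤ q ^ W := Nat.pow_le_pow_right (by omega) hW2
  have hWq' : q * 2 ≤ q ^ W := le_trans (by nlinarith) hWq
  have hden : (((q ^ W - 1) * (q ^ W - q) : ℕ) : ℝ) = (q : ℝ) ^ (2 * W) - (q : ℝ) ^ (W + 1) - (q : ℝ) ^ W + (q : ℝ) := by
    push_cast [Nat.cast_sub (show q ≤ q ^ W by omega), Nat.cast_sub (show 1 ≤ q ^ W by omega)]; ring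
  have hpos : (0 : ℝ) < (q : ℝ) ^ (2 * W) - (q : ℝ) ^ (W + 1) - (q : ℝ) ^ W + (q : ℝ) := by
    rw [← hden]; exact_mod_cast Nat.mul_pos (by omega) (by omega)
  rw [ge_iff_le, div_le_iff₀ hpos, ← hden]
  rw [← Nat.cast_mul]
  refine le_trans ?_ (Nat.cast_le.2 hcount)
  rw [hqn]
  rcases hstruct with ⟨rfl, ha0⟩ | ⟨ht, ha0, hs⟩
  · rw [if_pos rfl]
    have hvk : v < k := by
      obtain ⟨j, hj, hj0⟩ := hnotmono
      by_contra hc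
      exact hj0 (hvmin j (by omega))
    have hcV := H.V_card k 0 a 0
    simp only [zero_mul] at hcV
    rw [pow_zero, pow_one] at e1 e2
    exact H.case_zero k v h a hmonic ha0 hvk hv hvmin (by rw [hh]; exact hcV) m x1 y1 e1 e2 e3
  · rw [if_neg (by omega)]
    have htk : t < k := by
      rcases hs with ⟨h1, h2⟩ | ⟨h1, h2, h3, -⟩
      · omega
      · by_cases hd : t ∣ k
        · have := h2 hd; omega
        · have := h3 hd
          have : t ≠ k := fun h => hd (h ▸ dvd_rfl)
          omega
    exact H.case_pos k t ht htk hkn a hmonic ha0 x1 y1 (by rw [AA, e1, e2]; ring) e3
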